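/- arXiv:2108.10190 — 4 statements merged into one kernel-verified Lean document; each statement's English description precedes it below -/
import Mathlib

section
/- Let n = 2^a for some integer a ≥ 2 and let q = p^f be a power of a prime p. If q^n - 1 has exactly one primitive prime divisor r (i.e., P_q^n = {r}), then either r ≥ 4nf + 1, or one of the following holds: (i) (n,q) ∈ {(4,2),(4,3),(4,7)} and r = nf + 1 = 5; (ii) (n,q) ∈ {(4,4),(8,2)} and r = 2nf + 1 = 17; (iii) (n,q) ∈ {(4,5),(4,239)} and r = 3nf + 1 = 13. -/
/-- The set of primitive prime divisors of `a^n - 1`. -/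
def ppdSet (a n : ℕ) : Set ℕ :=
  {r | r.Prime ∧ r ∣ a ^ n - 1 ∧ ∀ i, 1 ≤ i → i < n → ¬ r ∣ a ^ i - 1}

/-- If `k` is odd and `X ^ 2 + 1 = 2 * y ^ k`, then factoring in `ℤ[i]` shows that `2 * y - 1` is the
square of a divisor of `X`. -/
lemma exists_dvd_of_sq_add_one_eq_two_mul_pow {X y : ℤ} {k : ℕ} (hy : 0 ≤ y) (hk : Odd k)
    (h : X ^ 2 + 1 = 2 * y ^ k) : ∃ s : ℤ, s ∣ X ∧ s ^ 2 + 1 = 2 * y := by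
  obtain ⟨m, rfl⟩ : Odd X := by
    by_contra hX
    obtain ⟨m, rfl⟩ := Int.not_odd_iff_even.1 hX
    ring_nf at h
    omega
  set w : GaussianInt := ⟨m + 1, -m⟩ with hw
  let I : GaussianInt := ⟨0, 1⟩
  have hnorm : w * star w = (y : GaussianInt) ^ k := by
    have h1 : y ^ k = 2 * (m * m) + 2 * m + 1 := by linarith
    rw [← Int.cast_pow, h1]
    ext <;> simp [hw] <;> ring
  have hcop : IsCoprime w (star w) := by
    refine ⟨star w - ((m * m + m : ℤ) : GaussianInt) * ⟨1, -1⟩,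
      -((m * m + m : ℤ) : GaussianInt) * ⟨1, 1⟩, ?_⟩
    ext <;> simp [hw] <;> ring
  obtain ⟨d, u, hu⟩ := exists_associated_pow_of_mul_eq_pow' hcop hnorm
  have hu4 : (u : GaussianInt) ^ 4 = 1 := by
    have h1 : (u : GaussianInt).norm.natAbs = 1 := Zsqrtd.norm_eq_one_iff.2 u.isUnit
    have h2 : (u : GaussianInt).norm = 1 := by
      have := GaussianInt.norm_nonneg (u : GaussianInt)
      omega
    replace h2 : (u : GaussianInt).re ^ 2 + (u : GaussianInt).im ^ 2 = 1 := by
      rw [Zsqrtd.norm_def] at h2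
      linarith
    have h3 : (u : GaussianInt).re * (u : GaussianInt).im = 0 := by
      have ha : (u : GaussianInt).re ^ 2 ≤ 1 := by
        linarith [sq_nonneg (u : GaussianInt).im]
      have hb : (u : GaussianInt).im ^ 2 ≤ 1 := by
        linarith [sq_nonneg (u : GaussianInt).re]
      have ha' := abs_le.1 ((sq_le_one_iff_abs_le_one _).1 ha)
      have hb' := abs_le.1 ((sq_le_one_iff_abs_le_one _).1 hb)
      generalize (u : GaussianInt).re = x at *
      generalize (u : GaussianInt).im = z at *
      obtain ⟨ha1, ha2⟩ := ha'
      obtain ⟨hb1, hb2⟩ := hb'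
      interval_cases x <;> interval_cases z <;> simp_all
    have h4 : ((u : GaussianInt) ^ 2) * (u : GaussianInt) ^ 2 = 1 := by
      ext
      · simp [pow_two]
        linear_combination (-8 * (u : GaussianInt).re * (u : GaussianInt).im) * h3 +
          ((u : GaussianInt).re ^ 2 + (u : GaussianInt).im ^ 2 + 1) * h2
      · simp [pow_two]
        linear_combination (4 * ((u : GaussianInt).re ^ 2 - (u : GaussianInt).im ^ 2)) * h3
    rw [← h4]; ring
  obtain ⟨α, hα⟩ : ∃ α : GaussianInt, α ^ k = w := by
    refine ⟨d * u ^ k, ?_⟩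
    have hk2 : (u : GaussianInt) ^ (k * k) = u := by
      obtain ⟨j, rfl⟩ := hk
      rw [show (2 * j + 1) * (2 * j + 1) = 4 * (j * j + j) + 1 by ring, pow_succ, pow_mul, hu4,
        one_pow, one_mul]
    rw [mul_pow, ← pow_mul, hk2, hu]
  obtain ⟨ε, hε, hεk⟩ : ∃ ε : ℤ, ε ^ 2 = 1 ∧ ((ε : GaussianInt) * I) ^ k = I := by
    have hI : I ^ 2 = -1 := by ext <;> simp [I, pow_two]
    obtain ⟨j, rfl⟩ := hk
    refine ⟨(-1) ^ j, by rw [← pow_mul, mul_comm, pow_mul]; simp, ?_⟩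
    rw [pow_succ, pow_mul, mul_pow, hI]
    push_cast
    rw [← pow_mul, mul_comm j 2, pow_mul]
    simp only [even_two, Even.neg_pow, one_pow, one_mul]
    rw [← mul_assoc, ← mul_pow]
    simp
  set γ : GaussianInt := (ε : GaussianInt) * I * star α with hγ
  have hγk : γ ^ k = I * star w := by rw [hγ, mul_pow, hεk, ← star_pow, hα]
  have hadd : α + γ ∣ ⟨1, 1⟩ := by
    convert hk.add_dvd_pow_add_pow α γ using 1
    rw [hα, hγk]
    ext <;> simp [hw, I]
  have hsub : α - γ ∣ ⟨2 * m + 1, -(2 * m + 1)⟩ := by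
    convert sub_dvd_pow_sub_pow α γ k using 1
    rw [hα, hγk]
    ext <;> simp [hw, I] <;> ring
  have hnα : α.re ^ 2 + α.im ^ 2 = y := by
    have h1 : α.norm ^ k = y ^ k := by
      have h2 : ((α.norm ^ k : ℤ) : GaussianInt) = ((y ^ k : ℤ) : GaussianInt) := by
        push_cast
        rw [← hnorm, ← hα, star_pow, ← mul_pow, Zsqrtd.norm_eq_mul_conj]
      exact_mod_cast h2
    have h3 := (pow_left_inj₀ (GaussianInt.norm_nonneg α) hy (by rintro rfl; simp at hk)).1 h1
    rw [← h3, Zsqrtd.norm_def]; ring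
  have hnadd : (α + γ).norm = 2 * (α.re + ε * α.im) ^ 2 := by
    simp only [Zsqrtd.norm_def, hγ, I]
    simp
    linear_combination (α.re ^ 2 - α.im ^ 2) * hε
  have hnsub : (α - γ).norm = 2 * (α.re - ε * α.im) ^ 2 := by
    simp only [Zsqrtd.norm_def, hγ, I]
    simp
    linear_combination (α.re ^ 2 - α.im ^ 2) * hε
  have hA : 2 * (α.re + ε * α.im) ^ 2 ∣ 2 * 1 := by
    obtain ⟨c, hc⟩ := hadd
    exact ⟨c.norm, by rw [← hnadd, ← Zsqrtd.norm_mul, ← hc]; rfl⟩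
  have hB : 2 * (α.re - ε * α.im) ^ 2 ∣ 2 * (2 * m + 1) ^ 2 := by
    obtain ⟨c, hc⟩ := hsub
    exact ⟨c.norm, by rw [← hnsub, ← Zsqrtd.norm_mul, ← hc, Zsqrtd.norm_def]; ring⟩
  have hA1 : (α.re + ε * α.im) ^ 2 = 1 :=
    Int.eq_one_of_dvd_one (sq_nonneg _) ((mul_dvd_mul_iff_left two_ne_zero).1 hA)
  refine ⟨α.re - ε * α.im,
    (Int.pow_dvd_pow_iff two_ne_zero).1 ((mul_dvd_mul_iff_left two_ne_zero).1 hB), ?_⟩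
  linear_combination 2 * hnα - hA1 + 2 * α.im ^ 2 * hε

/-- The descent step for Fermat's theorem that `m ^ 2 + n ^ 2` and `m ^ 2 - n ^ 2` are not both
squares, normalised so that `v` is even, where `y = u + v` and `x = u - v`. -/
lemma exists_smaller_of_even {m n u v : ℤ} (hn : n ≠ 0) (hmn : IsCoprime m n) (hu : 0 < u)
    (hv : 0 < v) (hm : 0 < m) (hvev : Even v) (hadd : u ^ 2 + v ^ 2 = m ^ 2)
    (hmul : 2 * (u * v) = n ^ 2) :
    ∃ m' n' x' y' : ℤ, n' ≠ 0 ∧ IsCoprime m' n' ∧ 0 < y' ∧ m' ^ 2 + n' ^ 2 = y' ^ 2 ∧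
      m' ^ 2 - n' ^ 2 = x' ^ 2 ∧ n' ^ 2 < n ^ 2 := by
  have huv : IsCoprime u v := by
    have h1 : IsCoprime (m ^ 2) (n ^ 2) := hmn.pow
    obtain ⟨a, b, hab⟩ := h1
    exact ⟨a * u + 2 * b * v, a * v, by rw [← hab, ← hadd, ← hmul]; ring⟩
  obtain ⟨w, rfl⟩ := even_iff_two_dvd.1 hvev
  have huodd : u % 2 = 1 := by
    by_contra h
    have h2 : (2 : ℤ) ∣ u := by omega
    have := huv.isUnit_of_dvd' h2 (Dvd.intro w rfl)
    norm_num [Int.isUnit_iff] at this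
  have hnev : Even n := by
    have : Even (n ^ 2) := ⟨u * (2 * w), by rw [← hmul]; ring⟩
    exact (Int.even_pow.1 this).1
  obtain ⟨n₁, rfl⟩ := even_iff_two_dvd.1 hnev
  have huw : u * w = n₁ ^ 2 := by linarith
  have hw : 0 < w := by linarith
  have huw' : IsCoprime u w := huv.of_isCoprime_of_dvd_right (Dvd.intro_left 2 rfl)
  obtain ⟨s, t, hust, hwst, -, hgcd, hpar, hs0⟩ := PythagoreanTriple.coprime_classification'
    (x := u) (y := 2 * w) (z := m) (by unfold PythagoreanTriple; linarith)
    (Int.isCoprime_iff_gcd_eq_one.1 huv) huodd hm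
  have hst : s * t = w := by linarith
  have hs : 0 < s := lt_of_le_of_ne hs0 (by rintro rfl; simp at hst; omega)
  have ht : 0 < t := pos_of_mul_pos_right (hst ▸ hw) hs.le
  have eq_sq {a b c : ℤ} (ha : 0 < a) (hab : IsCoprime a b) (h : a * b = c ^ 2) :
      ∃ d, a = d ^ 2 := by
    obtain ⟨d, hd | hd⟩ := Int.sq_of_isCoprime hab h
    · exact ⟨d, hd⟩
    · nlinarith [sq_nonneg d]
  obtain ⟨c, hc⟩ := eq_sq hu huw' huw
  obtain ⟨d, hd⟩ := eq_sq hw huw'.symm (by rw [mul_comm]; exact huw)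
  have hst' : IsCoprime s t := Int.isCoprime_iff_gcd_eq_one.2 hgcd
  obtain ⟨S, hS⟩ := eq_sq hs hst' (hst.trans hd)
  obtain ⟨T, hT⟩ := eq_sq ht hst'.symm (by rw [mul_comm]; exact hst.trans hd)
  have hcop : IsCoprime (s + t) (s - t) := by
    have h1 : IsCoprime (s + t) s := by
      have := hst'.symm.add_mul_left_left 1
      rwa [mul_one, add_comm] at this
    have h2 : IsCoprime (s + t) 2 := by
      rw [Int.isCoprime_iff_gcd_eq_one, Int.gcd_comm, ← Int.isCoprime_iff_gcd_eq_one]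
      refine (Int.prime_two.coprime_iff_not_dvd).2 ?_
      omega
    have h3 := (h1.mul_right h2).add_mul_left_right (-1)
    rwa [show s * 2 + (s + t) * -1 = s - t by ring] at h3
  have hfac : (s + t) * (s - t) = c ^ 2 := by rw [← hc, hust]; ring
  have hpos : 0 < s + t := by omega
  obtain ⟨y, hy⟩ := eq_sq hpos hcop hfac
  obtain ⟨x, hx⟩ := eq_sq (pos_of_mul_pos_right (by rw [hfac, ← hc]; exact hu) hpos.le)
    hcop.symm (by rw [mul_comm]; exact hfac)
  have hST : IsCoprime S T := by
    rw [hS, hT] at hst'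
    exact (IsCoprime.pow_iff two_pos two_pos).1 hst'
  have hy0 : y ≠ 0 := by rintro rfl; simp at hy; omega
  refine ⟨S, T, x, |y|, ?_, hST, abs_pos.2 hy0, ?_, ?_, ?_⟩
  · rintro rfl; simp at hT; omega
  · rw [sq_abs, ← hS, ← hT, hy]
  · rw [← hS, ← hT, hx]
  · rw [← hT]
    have h1 : t ≤ w := by nlinarith
    have h2 : w ≤ u * w := by nlinarith
    have h3 : (2 * n₁) ^ 2 = 4 * (u * w) := by rw [huw]; ring
    linarith

/-- The descent step for Fermat's theorem that `m ^ 2 + n ^ 2` and `m ^ 2 - n ^ 2` are not both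
squares. -/
lemma exists_smaller_congruum {m n x y : ℤ} (hn : n ≠ 0) (hmn : IsCoprime m n) (hy : 0 < y)
    (hadd : m ^ 2 + n ^ 2 = y ^ 2) (hsub : m ^ 2 - n ^ 2 = x ^ 2) :
    ∃ m' n' x' y' : ℤ, n' ≠ 0 ∧ IsCoprime m' n' ∧ 0 < y' ∧ m' ^ 2 + n' ^ 2 = y' ^ 2 ∧
      m' ^ 2 - n' ^ 2 = x' ^ 2 ∧ n' ^ 2 < n ^ 2 := by
  wlog hm : 0 < m generalizing m
  · refine this (m := -m) hmn.neg_left (by rwa [neg_sq]) (by rwa [neg_sq]) ?_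
    have : m ≠ 0 := by
      rintro rfl
      have : 0 < n ^ 2 := by positivity
      nlinarith [sq_nonneg x]
    omega
  have hmn2 : (m % 2 = 1 ∧ n % 2 = 0) := by
    have key : ∀ a b c d : ZMod 4, a ^ 2 + b ^ 2 = c ^ 2 → a ^ 2 - b ^ 2 = d ^ 2 →
      (a = 0 ∨ a = 2) ∧ (b = 0 ∨ b = 2) ∨ (a = 1 ∨ a = 3) ∧ (b = 0 ∨ b = 2) := by decide
    have h1 := key m n y x (by exact_mod_cast congrArg (Int.cast : ℤ → ZMod 4) hadd)
      (by exact_mod_cast congrArg (Int.cast : ℤ → ZMod 4) hsub)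
    have cast_iff (a : ℤ) (k : ℤ) : (a : ZMod 4) = (k : ZMod 4) ↔ a % 4 = k % 4 :=
      ZMod.intCast_eq_intCast_iff' a k 4
    have e0 := cast_iff m 0
    have e1 := cast_iff m 1
    have e2 := cast_iff m 2
    have e3 := cast_iff m 3
    have f0 := cast_iff n 0
    have f2 := cast_iff n 2
    push_cast at e0 e1 e2 e3 f0 f2
    rw [e0, e1, e2, e3, f0, f2] at h1
    have hnot : ¬ ((2 : ℤ) ∣ m ∧ (2 : ℤ) ∣ n) := by
      rintro ⟨h2m, h2n⟩
      have := hmn.isUnit_of_dvd' h2m h2n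
      norm_num [Int.isUnit_iff] at this
    omega
  have hodd {z : ℤ} (hz : z ^ 2 % 2 = 1) : z % 2 = 1 := by
    rw [← Int.odd_iff] at hz ⊢
    exact (Int.odd_pow' two_ne_zero).1 hz
  have hy2 : y % 2 = 1 := hodd (by rw [← hadd]; simp [pow_two, Int.add_emod, Int.mul_emod, hmn2])
  have hx2 : x % 2 = 1 := hodd (by rw [← hsub]; simp [pow_two, Int.sub_emod, Int.mul_emod, hmn2])
  obtain ⟨u, hu⟩ : (2 : ℤ) ∣ y + x := by omega
  obtain ⟨v, hv⟩ : (2 : ℤ) ∣ y - x := by omega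
  obtain rfl : y = u + v := by omega
  obtain rfl : x = u - v := by omega
  have h1 : u ^ 2 + v ^ 2 = m ^ 2 := by linarith
  have h2 : 2 * (u * v) = n ^ 2 := by linarith
  have h3 : 0 < u * v := by
    have : 0 < n ^ 2 := by positivity
    linarith
  have hu0 : 0 < u := by
    by_contra! h
    nlinarith
  have hv0 : 0 < v := pos_of_mul_pos_right h3 hu0.le
  rcases Int.even_or_odd v with hve | hvo
  · exact exists_smaller_of_even hn hmn hu0 hv0 hm hve h1 h2
  · refine exists_smaller_of_even hn hmn hv0 hu0 hm ?_ (by rw [← h1]; ring) (by rw [← h2]; ring)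
    rw [Int.even_iff]
    rw [Int.odd_iff] at hvo
    omega

lemma eq_zero_of_sq_add_sub_sq {m n x y : ℤ} (hmn : IsCoprime m n) (hy : 0 < y)
    (hadd : m ^ 2 + n ^ 2 = y ^ 2) (hsub : m ^ 2 - n ^ 2 = x ^ 2) : n = 0 := by
  induction hN : (n ^ 2).toNat using Nat.strong_induction_on generalizing m n x y with
  | _ N ih =>
    by_contra hn
    obtain ⟨m', n', x', y', hn', hmn', hy', hadd', hsub', hlt⟩ :=
      exists_smaller_congruum hn hmn hy hadd hsub
    exact hn' (ih _ (by have := sq_nonneg n'; omega) hmn' hy' hadd' hsub' rfl)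

lemma sq_eq_one_of_pow_four_add_one_eq {x y : ℤ} (h : x ^ 4 + 1 = 2 * y ^ 2) : x ^ 2 = 1 := by
  obtain ⟨g, hg⟩ : Odd (x ^ 2) := by
    by_contra hx
    obtain ⟨m, hm⟩ := Int.not_odd_iff_even.1 hx
    rw [show x ^ 4 = (x ^ 2) ^ 2 by ring, hm] at h
    ring_nf at h
    omega
  rw [show x ^ 4 = (x ^ 2) ^ 2 by ring, hg] at h
  have hy : y ≠ 0 := by
    rintro rfl
    nlinarith [sq_nonneg (2 * g + 1)]
  have hg0 : g = 0 := eq_zero_of_sq_add_sub_sq (m := g + 1) (n := g) (x := x) (y := |y|)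
    ⟨1, -1, by ring⟩ (abs_pos.2 hy) (by rw [sq_abs]; linarith) (by rw [hg]; ring)
  rw [hg, hg0]; norm_num

/-- There is a quadratic obstruction modulo `2281`. -/
lemma sq_add_one_ne_two_mul_five_pow (x t : ℕ) : x ^ 2 + 1 ≠ 2 * 5 ^ 2 ^ (t + 2) := by
  intro h
  have hcyc : (5 : ZMod 2281) ^ 2 ^ (t + 2) ∈ ({625, 574, 1012, 2256} : Set (ZMod 2281)) := by
    clear h
    induction t with
    | zero => left; norm_num
    | succ t ih =>
      rw [show t + 1 + 2 = t + 2 + 1 by ring, pow_succ 2, pow_mul]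
      rcases ih with ih | ih | ih | ih <;> rw [ih] <;> decide
  have hsq (a : ℤ) (ha : (5 : ZMod 2281) ^ 2 ^ (t + 2) = a) :
      IsSquare ((2 * a - 1 : ℤ) : ZMod 2281) := by
    refine ⟨x, ?_⟩
    have := congrArg (Nat.cast : ℕ → ZMod 2281) h
    push_cast at this ⊢
    rw [ha] at this
    linear_combination -this
  rcases hcyc with hc | hc | hc | hc
  · exact ZMod.nonsquare_of_jacobiSym_eq_neg_one (by norm_num) (hsq 625 (by exact_mod_cast hc))
  · exact ZMod.nonsquare_of_jacobiSym_eq_neg_one (by norm_num) (hsq 574 (by exact_mod_cast hc))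
  · exact ZMod.nonsquare_of_jacobiSym_eq_neg_one (by norm_num) (hsq 1012 (by exact_mod_cast hc))
  · exact ZMod.nonsquare_of_jacobiSym_eq_neg_one (by norm_num) (hsq 2256 (by exact_mod_cast hc))

/-- There is a quadratic obstruction modulo `1009`. -/
lemma sq_add_one_ne_two_mul_thirteen_pow (x t : ℕ) : x ^ 2 + 1 ≠ 2 * 13 ^ 2 ^ (t + 3) := by
  intro h
  have hcyc : (13 : ZMod 1009) ^ 2 ^ (t + 3) ∈ ({635, 634, 374} : Set (ZMod 1009)) := by
    clear h
    induction t with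
    | zero => left; reduce_mod_char
    | succ t ih =>
      rw [show t + 1 + 3 = t + 3 + 1 by ring, pow_succ 2, pow_mul]
      rcases ih with ih | ih | ih <;> rw [ih] <;> decide
  have hsq (a : ℤ) (ha : (13 : ZMod 1009) ^ 2 ^ (t + 3) = a) :
      IsSquare ((2 * a - 1 : ℤ) : ZMod 1009) := by
    refine ⟨x, ?_⟩
    have := congrArg (Nat.cast : ℕ → ZMod 1009) h
    push_cast at this ⊢
    rw [ha] at this
    linear_combination -this
  rcases hcyc with hc | hc | hc
  · exact ZMod.nonsquare_of_jacobiSym_eq_neg_one (by norm_num) (hsq 635 (by exact_mod_cast hc))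
  · exact ZMod.nonsquare_of_jacobiSym_eq_neg_one (by norm_num) (hsq 634 (by exact_mod_cast hc))
  · exact ZMod.nonsquare_of_jacobiSym_eq_neg_one (by norm_num) (hsq 374 (by exact_mod_cast hc))

lemma orderOf_eq_of_dvd_pow_add_one {p r b : ℕ} [Fact r.Prime] (hr : r ≠ 2)
    (h : r ∣ p ^ 2 ^ b + 1) : orderOf (p : ZMod r) = 2 ^ (b + 1) := by
  have h1 : (p : ZMod r) ^ 2 ^ b = -1 := by
    have := (ZMod.natCast_eq_zero_iff _ _).2 h
    push_cast at this
    linear_combination this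
  have : Fact (2 < r) := ⟨by have := (Fact.out : r.Prime).two_le; omega⟩
  apply orderOf_eq_prime_pow
  · rw [h1]; exact ZMod.neg_one_ne_one
  · rw [pow_succ, pow_mul, h1]; norm_num

lemma two_pow_dvd_sub_one_of_dvd_pow_add_one {p r b : ℕ} (hr : r.Prime) (hr2 : r ≠ 2)
    (h : r ∣ p ^ 2 ^ b + 1) : 2 ^ (b + 1) ∣ r - 1 := by
  have : Fact r.Prime := ⟨hr⟩
  rw [← orderOf_eq_of_dvd_pow_add_one hr2 h]
  apply ZMod.orderOf_dvd_card_sub_one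
  intro h0
  have := (ZMod.natCast_eq_zero_iff _ _).2 h
  push_cast at this
  rw [h0] at this
  simp at this

/-- If the prime `r` divides both `p ^ 2 ^ b + 1` and `p ^ e + 1`, then `2 ^ b ≤ e`. -/
lemma two_pow_le_of_dvd_pow_add_one {p r b e : ℕ} (hr : r.Prime) (hr2 : r ≠ 2) (he : e ≠ 0)
    (h : r ∣ p ^ 2 ^ b + 1) (h' : r ∣ p ^ e + 1) : 2 ^ b ≤ e := by
  have : Fact r.Prime := ⟨hr⟩
  have h1 : (p : ZMod r) ^ (2 * e) = 1 := by
    have := (ZMod.natCast_eq_zero_iff _ _).2 h'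
    push_cast at this
    rw [mul_comm, pow_mul]
    linear_combination ((p : ZMod r) ^ e - 1) * this
  have h2 := Nat.le_of_dvd (by omega) (orderOf_dvd_of_pow_eq_one h1)
  rw [orderOf_eq_of_dvd_pow_add_one hr2 h, pow_succ] at h2
  omega

/-- In `p ^ 2 ^ (b + 1) + 1 = 2 * r ^ k`, the exponent `k` is a power of two: otherwise
`2 * r ^ 2 ^ t` would be of the form `p ^ (2 * e) + 1` with `e` too small for the order of `p`. -/
lemma exponent_eq_two_pow {p r b k : ℕ} (hp : p.Prime) (hr : r.Prime) (hr2 : r ≠ 2)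
    (h : p ^ 2 ^ (b + 1) + 1 = 2 * r ^ k) : ∃ t, k = 2 ^ t := by
  have hM : 1 < p ^ 2 ^ (b + 1) := Nat.one_lt_pow (by positivity) hp.one_lt
  have hk : k ≠ 0 := by rintro rfl; rw [pow_zero] at h; omega
  obtain ⟨t, k', hk', rfl⟩ := Nat.exists_eq_two_pow_mul_odd hk
  obtain ⟨s, hsX, hs⟩ := exists_dvd_of_sq_add_one_eq_two_mul_pow (X := (p ^ 2 ^ b : ℕ))
    (y := (r ^ 2 ^ t : ℕ)) (k := k') (by positivity) hk' (by
      rw [pow_succ, pow_mul, pow_mul] at h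
      exact_mod_cast h)
  obtain ⟨e, -, he⟩ := (Nat.dvd_prime_pow hp).1 (Int.natCast_dvd_natCast.1 (Int.natAbs_dvd.2 hsX))
  have hse : p ^ (2 * e) + 1 = 2 * r ^ 2 ^ t := by
    rw [mul_comm, pow_mul, ← he]
    zify
    rw [sq_abs]
    exact_mod_cast hs
  have hrt : 1 < r ^ 2 ^ t := Nat.one_lt_pow (by positivity) hr.one_lt
  have he0 : e ≠ 0 := by rintro rfl; rw [mul_zero, pow_zero] at hse; omega
  have hle : 2 ^ (b + 1) ≤ 2 * e := two_pow_le_of_dvd_pow_add_one hr hr2 (by omega)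
    (h ▸ (dvd_pow_self r hk).mul_left 2) (hse ▸ (dvd_pow_self r (by positivity)).mul_left 2)
  have hpow := Nat.pow_le_pow_right hp.pos hle
  have hfin : r ^ (2 ^ t * k') ≤ r ^ 2 ^ t := by omega
  have := (Nat.pow_le_pow_iff_right hr.one_lt).1 hfin
  refine ⟨t, le_antisymm this (Nat.le_mul_of_pos_right _ hk'.pos)⟩

lemma eq_two_pow_add_one_of_prime_pow_eq {r b k : ℕ} (hr : r.Prime)
    (h : 2 ^ 2 ^ b + 1 = r ^ k) : r = 2 ^ 2 ^ b + 1 := by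
  have hM : 1 < 2 ^ 2 ^ b := Nat.one_lt_two_pow (by positivity)
  have hk : k ≠ 0 := by rintro rfl; rw [pow_zero] at h; omega
  have hr2 : r ≠ 2 := by
    rintro rfl
    have h1 : 2 ∣ 2 ^ 2 ^ b := dvd_pow_self 2 (by positivity)
    have h2 : 2 ∣ 2 ^ k := dvd_pow_self 2 hk
    omega
  have h1 : r - 1 ∣ 2 ^ 2 ^ b := by
    have := Nat.sub_dvd_pow_sub_pow r 1 k
    rwa [one_pow, ← h, Nat.add_sub_cancel] at this
  obtain ⟨i, -, hi⟩ := (Nat.dvd_prime_pow Nat.prime_two).1 h1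
  have hi' : 2 ^ i + 1 = r := by have := hr.two_le; omega
  have hi0 : i ≠ 0 := by rintro rfl; omega
  have hle : 2 ^ b ≤ i := two_pow_le_of_dvd_pow_add_one hr hr2 hi0
    (h ▸ dvd_pow_self r hk) hi'.symm.dvd
  have hpow := Nat.pow_le_pow_right two_pos hle
  have : r ≤ r ^ k := Nat.le_self_pow hk r
  omega

lemma odd_prime_pow_add_one_small {p r b k : ℕ} (hp : p.Prime) (hp2 : p ≠ 2) (hr : r.Prime)
    (hr2 : r ≠ 2) (h : p ^ 2 ^ (b + 1) + 1 = 2 * r ^ k) (hle : r ≤ 6 * 2 ^ (b + 1) + 1) :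
    b = 0 ∧ ((p = 3 ∨ p = 7) ∧ r = 5 ∨ (p = 5 ∨ p = 239) ∧ r = 13) := by
  have hp3 : 3 ≤ p := by have := hp.two_le; omega
  obtain ⟨t, rfl⟩ := exponent_eq_two_pow hp hr hr2 h
  rcases b with _ | b
  · refine ⟨rfl, ?_⟩
    have h4 := two_pow_dvd_sub_one_of_dvd_pow_add_one (b := 1) (p := p) hr hr2
      (h ▸ (dvd_pow_self r (by positivity)).mul_left 2)
    norm_num at h4 hle h
    have hr513 : r = 5 ∨ r = 13 := by
      have := hr.two_le
      interval_cases r <;> revert hr <;> first | omega | norm_num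
    have sq_inj {a : ℕ} (hpa : p ^ 2 = a ^ 2) : p = a := Nat.pow_left_injective two_ne_zero hpa
    rcases hr513 with rfl | rfl
    · left
      rcases t with _ | _ | t
      · exact ⟨Or.inl (sq_inj (by omega)), rfl⟩
      · exact ⟨Or.inr (sq_inj (by omega)), rfl⟩
      · exact (sq_add_one_ne_two_mul_five_pow p t h).elim
    · right
      rcases t with _ | _ | _ | t
      · exact ⟨Or.inl (sq_inj (by omega)), rfl⟩
      · have h1 : 18 < p := lt_of_pow_lt_pow_left₀ 2 (by norm_num) (by omega)
        have h2 : p < 19 := lt_of_pow_lt_pow_left₀ 2 (by norm_num) (by omega)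
        omega
      · exact ⟨Or.inr (sq_inj (by norm_num at h; omega)), rfl⟩
      · exact (sq_add_one_ne_two_mul_thirteen_pow p t h).elim
  · exfalso
    rcases t with _ | t
    · have h3 := Nat.pow_le_pow_left hp3 (2 ^ (b + 1 + 1))
      have hgrow : ∀ n, 4 ≤ n → 12 * n + 1 < 3 ^ n := by
        intro n hn
        induction n, hn using Nat.le_induction with
        | base => norm_num
        | succ n hn ih => rw [pow_succ]; omega
      have h4 := hgrow (2 ^ (b + 1 + 1)) (by
        have := Nat.one_le_two_pow (n := b)
        rw [pow_succ, pow_succ]; omega)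
      rw [pow_zero, pow_one] at h
      omega
    · have h1 := sq_eq_one_of_pow_four_add_one_eq (x := (p ^ 2 ^ b : ℕ)) (y := (r ^ 2 ^ t : ℕ)) (by
        norm_cast
        rw [← pow_mul, ← pow_mul, ← pow_succ, ← h, pow_add, pow_add, mul_assoc]
        norm_num)
      norm_cast at h1
      have := Nat.one_lt_pow (n := 2 ^ b) (by positivity) hp.one_lt
      nlinarith

lemma two_pow_add_one_small {r b k : ℕ} (hr : r.Prime)
    (h : 2 ^ 2 ^ (b + 1) + 1 = r ^ k) (hle : r ≤ 6 * 2 ^ (b + 1) + 1) :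
    b = 0 ∧ r = 5 ∨ b = 1 ∧ r = 17 := by
  have hr' := eq_two_pow_add_one_of_prime_pow_eq hr h
  rcases b with _ | _ | b
  · left; exact ⟨rfl, hr'⟩
  · right; exact ⟨rfl, hr'⟩
  · exfalso
    have hgrow : ∀ n, 8 ≤ n → 6 * n < 2 ^ n := by
      intro n hn
      induction n, hn using Nat.le_induction with
      | base => norm_num
      | succ n hn ih => rw [pow_succ]; omega
    have h4 := hgrow (2 ^ (b + 1 + 1 + 1)) (by
      have := Nat.one_le_two_pow (n := b)
      rw [pow_succ, pow_succ, pow_succ]; omega)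
    omega

/-- For an odd prime `l`, the numbers `Q + 1` and `Q ^ l + 1` cannot have the same cofactor `c` next to
a power of the odd prime `r`. -/
lemma pow_add_one_ne {c Q l r j k : ℕ} (hr : r.Prime) (hc : 0 < c) (hQ : 4 ≤ Q) (hl : l.Prime)
    (hlodd : Odd l) (hr2 : r ≠ 2) (hj : j ≠ 0) (hQj : Q + 1 = c * r ^ j) :
    Q ^ l + 1 ≠ c * r ^ k := by
  intro h
  have : Fact r.Prime := ⟨hr⟩
  have hl3 : 3 ≤ l := by
    have := hl.two_le
    obtain ⟨i, rfl⟩ := hlodd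
    omega
  have hrQ1 : r ∣ Q + 1 := hQj ▸ (dvd_pow_self r hj).mul_left c
  have hrQ : ¬ r ∣ Q := fun hd => hr.one_lt.ne' (Nat.dvd_one.1 ((Nat.dvd_add_right hd).1 hrQ1))
  have hlte := padicValNat.pow_add_pow (hr.odd_of_ne_two hr2) (x := Q) (y := 1) hrQ1 hrQ hlodd
  rw [one_pow, h, hQj, padicValNat.mul hc.ne' (pow_ne_zero _ hr.ne_zero),
    padicValNat.mul hc.ne' (pow_ne_zero _ hr.ne_zero), padicValNat.prime_pow,
    padicValNat.prime_pow] at hlte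
  have hkj : k = j + padicValNat r l := by omega
  have hle : Q ^ l + 1 ≤ (Q + 1) * l := by
    rw [h, hkj, pow_add, ← mul_assoc, ← hQj]
    exact Nat.mul_le_mul_left _ (Nat.le_of_dvd hl.pos pow_padicValNat_dvd)
  have hgrow : ∀ n, 3 ≤ n → (Q + 1) * n < Q ^ n := by
    intro n hn
    induction n, hn using Nat.le_induction with
    | base => nlinarith [mul_le_mul hQ hQ (by norm_num) (by positivity)]
    | succ n hn ih =>
      calc (Q + 1) * (n + 1) ≤ ((Q + 1) * n) * Q := by
            rw [mul_assoc]
            exact Nat.mul_le_mul_left _ (by nlinarith)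
        _ < Q ^ (n + 1) := by
            rw [pow_succ]
            exact Nat.mul_lt_mul_of_pos_right ih (by omega)
  have := hgrow l hl3
  omega

lemma natCast_pow_eq_one_iff {q r : ℕ} (hq : 0 < q) (i : ℕ) :
    (q : ZMod r) ^ i = 1 ↔ r ∣ q ^ i - 1 := by
  rw [← ZMod.natCast_eq_zero_iff, Nat.cast_sub (Nat.one_le_pow _ _ hq), sub_eq_zero]
  push_cast
  rfl

/-- The primitive prime divisors of `q ^ 2 ^ (b + 1) - 1` are the odd prime divisors of
`q ^ 2 ^ b + 1`. -/
lemma mem_ppdSet_two_pow_iff {q b r : ℕ} (hq : 0 < q) :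
    r ∈ ppdSet q (2 ^ (b + 2)) ↔ r.Prime ∧ r ≠ 2 ∧ r ∣ q ^ 2 ^ (b + 1) + 1 := by
  constructor
  · rintro ⟨hr, hdvd, hmin⟩
    refine ⟨hr, ?_, ?_⟩
    · rintro rfl
      refine hmin 1 le_rfl (Nat.one_lt_two_pow (by omega)) ?_
      rw [pow_one]
      have h1 := (Nat.even_sub (Nat.one_le_pow _ _ hq)).1 (even_iff_two_dvd.2 hdvd)
      rw [Nat.even_pow' (by positivity)] at h1
      exact even_iff_two_dvd.1 ((Nat.even_sub hq).2 h1)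
    · have h1 : q ^ 2 ^ (b + 2) - 1 = (q ^ 2 ^ (b + 1) + 1) * (q ^ 2 ^ (b + 1) - 1) := by
        have := Nat.sq_sub_sq (q ^ 2 ^ (b + 1)) 1
        rwa [one_pow, ← pow_mul, ← pow_succ] at this
      rw [h1] at hdvd
      exact (hr.dvd_mul.1 hdvd).resolve_right
        (hmin _ Nat.one_le_two_pow (Nat.pow_lt_pow_right (by norm_num) (by omega)))
  · rintro ⟨hr, hr2, hdvd⟩
    have : Fact r.Prime := ⟨hr⟩
    have hord := orderOf_eq_of_dvd_pow_add_one hr2 hdvd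
    refine ⟨hr, ?_, fun i hi hin hd => ?_⟩
    · rw [← natCast_pow_eq_one_iff hq, ← orderOf_dvd_iff_pow_eq_one, hord]
    · rw [← natCast_pow_eq_one_iff hq, ← orderOf_dvd_iff_pow_eq_one, hord] at hd
      exact absurd (Nat.le_of_dvd hi hd) (not_le.2 hin)

/-- If `r` is the only odd prime divisor of `p ^ (2 * e) + 1`, then the latter is a power of `r` up to
the obvious factor `2`. -/
lemma exists_eq_mul_pow_of_unique {p e r : ℕ} (hp : p.Prime) (he : e ≠ 0)
    (h : ∀ l, l.Prime → l ≠ 2 → l ∣ p ^ (2 * e) + 1 → l = r) :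
    ∃ k ≠ 0, p ^ (2 * e) + 1 = (if p = 2 then 1 else 2) * r ^ k := by
  have hgt : 2 < p ^ (2 * e) + 1 := by
    have := Nat.one_lt_pow (n := 2 * e) (by omega) hp.one_lt
    omega
  split_ifs with hp2
  · subst hp2
    have h1 := Nat.eq_prime_pow_of_unique_prime_dvd (p := r) (n := 2 ^ (2 * e) + 1) (by omega)
      (fun {d} hd hdvd => h d hd (by
        rintro rfl
        have h2 : 2 ∣ 2 ^ (2 * e) := dvd_pow_self 2 (by omega)
        omega) hdvd)
    refine ⟨_, ?_, by rw [one_mul]; exact h1⟩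
    intro h0
    rw [h0, pow_zero] at h1
    omega
  · have hodd : p % 2 = 1 := Nat.odd_iff.1 (hp.odd_of_ne_two hp2)
    obtain ⟨g, hg⟩ : ∃ g, p ^ (2 * e) + 1 = 2 * (2 * g + 1) := by
      have h4 : p ^ (2 * e) % 4 = 1 := by
        have : p ^ 2 % 4 = 1 := by
          rcases (by omega : p % 4 = 1 ∨ p % 4 = 3) with h | h <;> simp [Nat.pow_mod, h]
        rw [pow_mul, Nat.pow_mod, this, one_pow, Nat.one_mod]
      exact ⟨p ^ (2 * e) / 4, by omega⟩
    have h1 := Nat.eq_prime_pow_of_unique_prime_dvd (p := r) (n := 2 * g + 1) (by omega)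
      (fun {d} hd hdvd => h d hd (by rintro rfl; omega) (hg ▸ hdvd.mul_left 2))
    refine ⟨_, ?_, by rw [hg, ← h1]⟩
    intro h0
    rw [h0, pow_zero] at h1
    omega

lemma exponent_eq_two_pow_of_unique {p f b r : ℕ} (hp : p.Prime) (hf : 0 < f) (hr : r.Prime)
    (hr2 : r ≠ 2) (h : ∀ l, l.Prime → l ≠ 2 → l ∣ p ^ (f * 2 ^ (b + 1)) + 1 → l = r) :
    ∃ g, f = 2 ^ g := by
  rcases f.eq_two_pow_or_exists_odd_prime_and_dvd with hg | ⟨l, hl, ⟨f', rfl⟩, hlodd⟩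
  · exact hg
  exfalso
  have hf' : 0 < f' := Nat.pos_of_mul_pos_left hf
  have hexp : l * f' * 2 ^ (b + 1) = 2 * (f' * 2 ^ b) * l := by ring
  have hdvd : p ^ (2 * (f' * 2 ^ b)) + 1 ∣ p ^ (l * f' * 2 ^ (b + 1)) + 1 := by
    rw [hexp, pow_mul p (2 * (f' * 2 ^ b)) l]
    have := hlodd.nat_add_dvd_pow_add_pow (p ^ (2 * (f' * 2 ^ b))) 1
    rwa [one_pow] at this
  obtain ⟨j, hj, hQj⟩ := exists_eq_mul_pow_of_unique hp (e := f' * 2 ^ b) (by positivity)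
    (fun d hd hd2 hdd => h d hd hd2 (hdd.trans hdvd))
  obtain ⟨k, -, hk⟩ := exists_eq_mul_pow_of_unique hp (e := l * f' * 2 ^ b) (by positivity)
    (fun d hd hd2 hdd => h d hd hd2 (by
      rwa [show 2 * (l * f' * 2 ^ b) = l * f' * 2 ^ (b + 1) by ring] at hdd))
  refine pow_add_one_ne hr ?_ ?_ hl hlodd hr2 hj hQj (k := k) ?_
  · split_ifs <;> norm_num
  · calc 4 ≤ p ^ 2 := Nat.pow_le_pow_left hp.two_le 2
      _ ≤ p ^ (2 * (f' * 2 ^ b)) := Nat.pow_le_pow_right hp.pos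
        (Nat.le_mul_of_pos_right _ (by positivity))
  · rw [← hk, ← pow_mul]
    congr 2
    ring

/-- Lemma 2.5: if `n = 2^a` (`a ≥ 2`), `q = p^f` a prime power, and `q^n - 1`
has a unique primitive prime divisor `r`, then `r ≥ 4nf + 1` or one of the
listed exceptions holds. -/
theorem stmt5 (a p f n q r : ℕ) (ha : 2 ≤ a) (hn : n = 2 ^ a) (hp : p.Prime)
    (hf : 0 < f) (hq : q = p ^ f) (h : ppdSet q n = {r}) :
    4 * n * f + 1 ≤ r ∨
    (((n, q) = (4, 2) ∨ (n, q) = (4, 3) ∨ (n, q) = (4, 7)) ∧ r = n * f + 1 ∧ r = 5) ∨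
    (((n, q) = (4, 4) ∨ (n, q) = (8, 2)) ∧ r = 2 * n * f + 1 ∧ r = 17) ∨
    (((n, q) = (4, 5) ∨ (n, q) = (4, 239)) ∧ r = 3 * n * f + 1 ∧ r = 13) := by
  obtain ⟨b, rfl⟩ := Nat.exists_eq_add_of_le' ha
  subst hn hq
  have hiff (l : ℕ) : l.Prime ∧ l ≠ 2 ∧ l ∣ p ^ (f * 2 ^ (b + 1)) + 1 ↔ l = r := by
    rw [pow_mul, ← mem_ppdSet_two_pow_iff (pow_pos hp.pos f), h, Set.mem_singleton_iff]
  obtain ⟨hr, hr2, hrdvd⟩ := (hiff r).2 rfl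
  have huniq (l : ℕ) (hl : l.Prime) (hl2 : l ≠ 2) (hdvd : l ∣ p ^ (f * 2 ^ (b + 1)) + 1) : l = r :=
    (hiff l).1 ⟨hl, hl2, hdvd⟩
  obtain ⟨g, rfl⟩ := exponent_eq_two_pow_of_unique hp hf hr hr2 huniq
  obtain ⟨k, -, hk⟩ := exists_eq_mul_pow_of_unique hp (e := 2 ^ (g + b)) (by positivity)
    (fun d hd hd2 hdd => huniq d hd hd2 (by
      rwa [show 2 * 2 ^ (g + b) = 2 ^ g * 2 ^ (b + 1) by ring] at hdd))
  rw [← pow_succ'] at hk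
  refine or_iff_not_imp_left.2 fun hlt => ?_
  have hN : 2 ^ (b + 2) * 2 ^ g = 2 * 2 ^ (g + b + 1) := by ring
  have hle : r ≤ 6 * 2 ^ (g + b + 1) + 1 := by
    rw [← pow_add, show g + (b + 1) = g + b + 1 by ring] at hrdvd
    obtain ⟨j, hj⟩ := two_pow_dvd_sub_one_of_dvd_pow_add_one hr hr2 hrdvd
    rw [pow_succ] at hj
    rw [mul_assoc, hN] at hlt
    have h2 := hr.two_le
    have hj4 : j < 4 := by
      by_contra! hj4
      have := Nat.mul_le_mul_left (2 ^ (g + b + 1) * 2) hj4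
      omega
    have := Nat.mul_le_mul_left (2 ^ (g + b + 1) * 2) (Nat.le_of_lt_succ hj4)
    omega
  split_ifs at hk with hp2
  · subst hp2
    rw [one_mul] at hk
    rcases two_pow_add_one_small hr hk hle with ⟨hb, rfl⟩ | ⟨hb, rfl⟩
    · obtain ⟨rfl, rfl⟩ : g = 0 ∧ b = 0 := by omega
      norm_num
    · obtain ⟨rfl, rfl⟩ | ⟨rfl, rfl⟩ : g = 0 ∧ b = 1 ∨ g = 1 ∧ b = 0 := by omega
      all_goals norm_num
  · obtain ⟨hb, hcases⟩ := odd_prime_pow_add_one_small hp hp2 hr hr2 hk hle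
    obtain ⟨rfl, rfl⟩ : g = 0 ∧ b = 0 := by omega
    rcases hcases with ⟨rfl | rfl, rfl⟩ | ⟨rfl | rfl, rfl⟩ <;> norm_num
end

section
/- Let n = 2^a · 3 for some integer a ≥ 0 and let q = p^f be a power of a prime p. If q^n - 1 has exactly one primitive prime divisor r (i.e., P_q^n = {r}), then either r ≥ 4nf + 1, or one of the following holds: (i) (n,q) ∈ {(3,4),(6,3),(6,4),(6,5),(6,8),(6,19),(12,2)} and r = nf + 1; (ii) (n,q) ∈ {(3,2),(6,23)} and r = 2nf + 1. -/
open NumberField in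
/-- The ring of Eisenstein integers. -/
abbrev Eisenstein : Type := 𝓞 (CyclotomicField 3 ℚ)

namespace Eisenstein

instance : IsCyclotomicExtension {3} ℚ (CyclotomicField 3 ℚ) :=
  CyclotomicField.isCyclotomicExtension 3 ℚ

instance : NumberField (CyclotomicField 3 ℚ) := IsCyclotomicExtension.numberField {3} ℚ _

instance : IsPrincipalIdealRing Eisenstein := IsCyclotomicExtension.Rat.three_pid _

/-- A primitive cube root of unity. -/
noncomputable def omega : Eisenstein :=
  (IsCyclotomicExtension.zeta_spec 3 ℚ (CyclotomicField 3 ℚ)).toInteger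

theorem omega_sq_add : omega ^ 2 + omega + 1 = 0 :=
  IsCyclotomicExtension.Rat.Three.eta_sq_add_eta_add_one
    (IsCyclotomicExtension.zeta_spec 3 ℚ (CyclotomicField 3 ℚ))

theorem omega_cube : omega ^ 3 = 1 := by
  linear_combination (omega - 1) * omega_sq_add

theorem pow_six_of_isUnit {u : Eisenstein} (hu : IsUnit u) : u ^ 6 = 1 := by
  obtain ⟨v, rfl⟩ := hu
  have h := IsCyclotomicExtension.Rat.Three.Units.mem
    (IsCyclotomicExtension.zeta_spec 3 ℚ (CyclotomicField 3 ℚ)) v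
  have h6 : omega ^ 6 = 1 := by linear_combination (omega ^ 3 + 1) * omega_cube
  have h12 : (omega ^ 2) ^ 6 = 1 := by linear_combination (omega ^ 6 + 1) * h6
  simp only [List.mem_cons, List.not_mem_nil, or_false] at h
  rcases h with rfl | rfl | rfl | rfl | rfl | rfl
  · simp
  · norm_num
  · exact h6
  · rw [Units.val_neg, Even.neg_pow (by decide)]; exact h6
  · exact h12
  · rw [Units.val_neg, Even.neg_pow (by decide)]; exact h12

theorem exists_eq_add_mul (x : Eisenstein) : ∃ a b : ℤ, x = a + b * omega := by
  have hx : x ∈ Algebra.adjoin ℤ {omega} := by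
    have hζ := IsCyclotomicExtension.zeta_spec 3 ℚ (CyclotomicField 3 ℚ)
    have h := hζ.integralPowerBasis.adjoin_gen_eq_top
    rw [hζ.integralPowerBasis_gen] at h
    rw [omega, h]
    trivial
  induction hx using Algebra.adjoin_induction with
  | mem y hy => exact ⟨0, 1, by rw [Set.mem_singleton_iff.mp hy]; push_cast; ring⟩
  | algebraMap n => exact ⟨n, 0, by simp⟩
  | add y z _ _ hy hz =>
    obtain ⟨a, b, rfl⟩ := hy
    obtain ⟨c, d, rfl⟩ := hz
    exact ⟨a + c, b + d, by push_cast; ring⟩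
  | mul y z _ _ hy hz =>
    obtain ⟨a, b, rfl⟩ := hy
    obtain ⟨c, d, rfl⟩ := hz
    exact ⟨a * c - b * d, a * d + b * c - b * d, by
      push_cast; linear_combination (b * d : Eisenstein) * omega_sq_add⟩

theorem eq_zero_of_add_mul {a b : ℤ} (h : (a : Eisenstein) + b * omega = 0) : a = 0 ∧ b = 0 := by
  have h1 : a ^ 2 - a * b + b ^ 2 = 0 := by
    have : ((a ^ 2 - a * b + b ^ 2 : ℤ) : Eisenstein) = 0 := by
      push_cast
      linear_combination (a - b - b * omega : Eisenstein) * h + (b ^ 2 : Eisenstein) * omega_sq_add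
    exact_mod_cast this
  constructor <;> nlinarith [sq_nonneg (2 * a - b), sq_nonneg (2 * b - a), sq_nonneg a, sq_nonneg b]

theorem intCast_dvd_intCast {m n : ℤ} (h : (m : Eisenstein) ∣ n) : m ∣ n := by
  obtain ⟨x, hx⟩ := h
  obtain ⟨a, b, rfl⟩ := exists_eq_add_mul x
  have h0 : ((n - m * a : ℤ) : Eisenstein) + ((-(m * b) : ℤ) : Eisenstein) * omega = 0 := by
    push_cast
    linear_combination hx
  exact ⟨a, by linarith [(eq_zero_of_add_mul h0).1]⟩

end Eisenstein

open Eisenstein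

theorem sq_mod_six_of_prime {l : ℕ} (hl : l.Prime) (h5 : 5 ≤ l) : ∃ j, l ^ 2 = 1 + 6 * j := by
  have h2 : ¬ 2 ∣ l := fun h => by
    have := (Nat.prime_dvd_prime_iff_eq Nat.prime_two hl).mp h; omega
  have h3 : ¬ 3 ∣ l := fun h => by
    have := (Nat.prime_dvd_prime_iff_eq Nat.prime_three hl).mp h; omega
  have h6 : l % 6 = 1 ∨ l % 6 = 5 := by omega
  have hm : l ^ 2 % 6 = 1 := by
    rcases h6 with h | h <;> simp [Nat.pow_mod, h]
  exact ⟨l ^ 2 / 6, by omega⟩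

theorem Eisenstein.pow_sq_of_isUnit {l : ℕ} (hl : l.Prime) (h5 : 5 ≤ l) {u : Eisenstein}
    (hu : IsUnit u) : (u ^ l) ^ l = u := by
  obtain ⟨j, hj⟩ := sq_mod_six_of_prime hl h5
  rw [← pow_mul, ← sq, hj, pow_add, pow_mul, pow_six_of_isUnit hu]
  simp

/-- Coprime factors of an `l`-th power are `l`-th powers, as every unit is one for prime `l ≥ 5`. -/
theorem Eisenstein.exists_pow_eq {l : ℕ} (hl : l.Prime) (h5 : 5 ≤ l) {x x' y : Eisenstein}
    (hc : IsCoprime x x') (h : x * x' = y ^ l) : ∃ z, z ^ l = x := by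
  obtain ⟨d, u, hu⟩ := exists_associated_pow_of_mul_eq_pow' hc h
  exact ⟨d * (u : Eisenstein) ^ l, by rw [mul_pow, pow_sq_of_isUnit hl h5 u.isUnit, hu]⟩

theorem exists_one_add_pow_prime {R : Type*} [CommRing R] {l : ℕ} (hl : l.Prime) (h2 : 2 < l)
    (x : R) : ∃ s, (1 + x) ^ l = 1 + l * x + l * x ^ 2 * s + x ^ l := by
  have hc (i : ℕ) (hi : i ∈ Finset.Ico 2 l) : (l : R) * x ^ 2 ∣ x ^ i * (l.choose i : ℕ) := by
    rw [Finset.mem_Ico] at hi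
    rw [mul_comm]
    exact mul_dvd_mul (pow_dvd_pow x hi.1) (Nat.cast_dvd_cast (hl.dvd_choose_self (by omega) hi.2))
  obtain ⟨s, hs⟩ := Finset.dvd_sum hc
  refine ⟨s, ?_⟩
  rw [add_comm, add_pow, Finset.range_eq_Ico, Finset.sum_Ico_succ_top (by omega),
    Finset.sum_eq_sum_Ico_succ_bot (by omega), Finset.sum_eq_sum_Ico_succ_bot (by omega)]
  simp only [one_pow, mul_one, hs]
  simp
  ring

theorem isUnit_of_pow_add_pow_eq_one {l : ℕ} (hl : l.Prime) (h5 : 5 ≤ l) {a b : Eisenstein}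
    (ha : a ≠ 0) (hab : a + b = 1) (h : a ^ l + b ^ l = 1) : IsUnit a := by
  obtain ⟨s, hs⟩ := exists_one_add_pow_prime hl (by omega) (-a)
  have hb : 1 + -a = b := by linear_combination -hab
  rw [hb, Odd.neg_pow (hl.odd_of_ne_two (by omega))] at hs
  have hl0 : (l : Eisenstein) * a ≠ 0 := mul_ne_zero (by exact_mod_cast hl.ne_zero) ha
  have h1 : (l * a) * (a * s) = (l * a) * 1 := by linear_combination h - hs
  exact IsUnit.of_mul_eq_one _ (mul_left_cancel₀ hl0 h1)

theorem sub_one_dvd_six {v : Eisenstein} (h : v ^ 6 = 1) (h1 : v ≠ 1) : v - 1 ∣ 6 := by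
  have h2 : v ^ 5 + v ^ 4 + v ^ 3 + v ^ 2 + v + 1 = 0 := by
    refine (mul_eq_zero.mp ?_).resolve_left (sub_ne_zero.mpr h1)
    linear_combination h
  exact ⟨-(v ^ 4 + 2 * v ^ 3 + 3 * v ^ 2 + 4 * v + 5), by linear_combination h2⟩

theorem not_nine_dvd (x : ℤ) : ¬ 9 ∣ x ^ 2 + x + 1 := by
  have h : x % 9 = 0 ∨ x % 9 = 1 ∨ x % 9 = 2 ∨ x % 9 = 3 ∨ x % 9 = 4 ∨ x % 9 = 5 ∨ x % 9 = 6 ∨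
    x % 9 = 7 ∨ x % 9 = 8 := by omega
  rw [Int.dvd_iff_emod_eq_zero]
  rcases h with h | h | h | h | h | h | h | h | h <;>
    simp [pow_two, Int.add_emod, Int.mul_emod, h]

theorem odd_sq_add_add_one (x : ℤ) : Odd (x ^ 2 + x + 1) := by
  have h : x ^ 2 + x + 1 = x * (x + 1) + 1 := by ring
  rw [h]
  exact (Int.even_mul_succ_self x).add_one

/-- Nagell: `x² + x + 1 = 3 yˡ` has no solution with `y > 1` for a prime `l ≥ 5`. -/
theorem sq_add_add_one_ne_three_mul_pow {l : ℕ} (hl : l.Prime) (h5 : 5 ≤ l) {x y : ℤ} (hy : 1 < y) :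
    x ^ 2 + x + 1 ≠ 3 * y ^ l := by
  intro hxy
  obtain ⟨w, rfl⟩ : ∃ w, x = 3 * w + 1 := by
    have h3 : (x ^ 2 + x + 1) % 3 = 0 := by rw [hxy, Int.mul_emod_right]
    have : x % 3 = 0 ∨ x % 3 = 1 ∨ x % 3 = 2 := by omega
    rcases this with h | h | h
    · simp [pow_two, Int.add_emod, Int.mul_emod, h] at h3
    · exact ⟨x / 3, by omega⟩
    · simp [pow_two, Int.add_emod, Int.mul_emod, h] at h3
  have hy6 : ¬ y ∣ 6 := by
    intro h
    have hyl : Odd y := by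
      have := odd_sq_add_add_one (3 * w + 1)
      rw [hxy, Int.odd_mul, Int.odd_pow' hl.ne_zero] at this
      exact this.2
    have hy3 : ¬ 3 ∣ y := fun h3 => not_nine_dvd (3 * w + 1) (by
      rw [hxy]
      exact mul_dvd_mul (dvd_refl 3) (dvd_pow h3 hl.ne_zero))
    have := Int.le_of_dvd (by norm_num) h
    interval_cases y <;> revert hyl hy3 h <;> decide
  set ξ : Eisenstein := (w + 1 : ℤ) + (2 * w + 1 : ℤ) * omega with hξ
  set ξ' : Eisenstein := (-w : ℤ) + (-(2 * w + 1) : ℤ) * omega with hξ'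
  have hsum : ξ + ξ' = 1 := by rw [hξ, hξ']; push_cast; ring
  have hprod : ξ * ξ' = (y : Eisenstein) ^ l := by
    have h1 : (3 * w ^ 2 + 3 * w + 1 : ℤ) = y ^ l := by linarith
    have h2 : (3 * w ^ 2 + 3 * w + 1 : Eisenstein) = (y : Eisenstein) ^ l := by exact_mod_cast h1
    rw [hξ, hξ']
    push_cast
    linear_combination h2 - (2 * w + 1 : Eisenstein) ^ 2 * omega_sq_add
  have hc : IsCoprime ξ ξ' := ⟨1, 1, by linear_combination hsum⟩
  obtain ⟨a, ha⟩ := exists_pow_eq hl h5 hc hprod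
  obtain ⟨b, hb⟩ := exists_pow_eq hl h5 hc.symm (by rw [mul_comm]; exact hprod)
  have hy0 : (y : Eisenstein) ≠ 0 := by
    have : y ≠ 0 := by omega
    exact_mod_cast this
  have hpow : (a * b) ^ l = (y : Eisenstein) ^ l := by rw [mul_pow, ha, hb, hprod]
  have hyab : (y : Eisenstein) ∣ a * b :=
    (IsIntegrallyClosed.pow_dvd_pow_iff hl.ne_zero).mp hpow.symm.dvd
  have haby : a * b ∣ (y : Eisenstein) :=
    (IsIntegrallyClosed.pow_dvd_pow_iff hl.ne_zero).mp hpow.dvd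
  have hab0 : a * b ≠ 0 := fun h => hy0 (by rw [h] at haby; exact zero_dvd_iff.mp haby)
  have hab : a ^ l + b ^ l = 1 := by rw [ha, hb, hsum]
  have hu : IsUnit (a + b) := by
    refine isUnit_of_dvd_one ?_
    rw [← hab]
    exact (hl.odd_of_ne_two (by omega)).add_dvd_pow_add_pow a b
  obtain ⟨s, hs⟩ := exists_add_pow_prime_eq hl a b
  have hul : (a + b) ^ l = 1 := by
    by_contra hne
    have h6 := sub_one_dvd_six (pow_six_of_isUnit (hu.pow l)) hne
    have hd : (y : Eisenstein) ∣ (a + b) ^ l - 1 :=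
      hyab.trans ⟨l * s, by linear_combination hs + hab⟩
    exact hy6 (intCast_dvd_intCast (by exact_mod_cast hd.trans h6))
  have hab1 : a + b = 1 := by
    rw [← pow_sq_of_isUnit hl h5 hu, hul, one_pow]
  have hua := isUnit_of_pow_add_pow_eq_one hl h5 (left_ne_zero_of_mul hab0) hab1 hab
  have hub := isUnit_of_pow_add_pow_eq_one hl h5 (right_ne_zero_of_mul hab0)
    (by rw [add_comm]; exact hab1) (by rw [add_comm]; exact hab)
  have hy1 : (y : Eisenstein) ∣ ((1 : ℤ) : Eisenstein) := by
    rw [Int.cast_one]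
    exact hyab.trans (hua.mul hub).dvd
  have := Int.le_of_dvd one_pos (intCast_dvd_intCast hy1)
  omega

namespace Eisenstein

/-- If `(a + bω)ˡ = A + Bω`, then `b ∣ B`, and the same identity holds for the conjugates. -/
theorem exists_pow_eq_add_mul (a b : ℤ) (l : ℕ) : ∃ A B : ℤ, b ∣ B ∧
    ((a : Eisenstein) + b * omega) ^ l = A + B * omega ∧
    ((a : Eisenstein) + b * omega ^ 2) ^ l = A + B * omega ^ 2 := by
  induction l with
  | zero => exact ⟨1, 0, dvd_zero b, by simp, by simp⟩
  | succ l ih =>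
    obtain ⟨A, B, ⟨c, rfl⟩, h1, h2⟩ := ih
    refine ⟨A * a - b * c * b, A * b + b * c * a - b * c * b, ⟨A + c * a - c * b, by ring⟩, ?_, ?_⟩
    · rw [pow_succ, h1]
      push_cast
      linear_combination (b * c * b : Eisenstein) * omega_sq_add
    · rw [pow_succ, h2]
      push_cast
      linear_combination (b * c * b : Eisenstein) * (omega ^ 2 - omega + 1) * omega_sq_add

theorem eq_of_add_mul_eq {a b c d : ℤ}
    (h : (a : Eisenstein) + b * omega = c + d * omega) : a = c ∧ b = d := by
  have h0 : ((a - c : ℤ) : Eisenstein) + ((b - d : ℤ) : Eisenstein) * omega = 0 := by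
    push_cast
    linear_combination h
  have := eq_zero_of_add_mul h0
  omega

/-- The integer `c` with `ωʲ - ω²ʲ = c (ω - ω²)`. -/
def imCoeff (j : ℕ) : ℤ := if j % 3 = 0 then 0 else if j % 3 = 1 then 1 else -1

theorem omega_pow_sub (j : ℕ) :
    omega ^ j - (omega ^ 2) ^ j = (imCoeff j : Eisenstein) * (omega - omega ^ 2) := by
  have hj : omega ^ j = omega ^ (j % 3) := by
    conv_lhs => rw [← Nat.div_add_mod j 3, pow_add, pow_mul, omega_cube, one_pow, one_mul]
  rw [← pow_mul, mul_comm 2 j, pow_mul, hj]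
  have h3 : j % 3 = 0 ∨ j % 3 = 1 ∨ j % 3 = 2 := by omega
  rcases h3 with h | h | h <;> simp only [imCoeff, h]
  · simp
  · simp
  · norm_num
    linear_combination omega * omega_cube

theorem sum_imCoeff_eq {u A B : ℤ} {l : ℕ}
    (h1 : ((u : Eisenstein) + omega) ^ l = A + B * omega)
    (h2 : ((u : Eisenstein) + omega ^ 2) ^ l = A + B * omega ^ 2) :
    ∑ i ∈ Finset.range (l + 1), u ^ i * imCoeff (l - i) * (l.choose i : ℤ) = B := by
  have hne : omega - omega ^ 2 ≠ 0 := fun h => by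
    have h0 : ((1 : ℤ) : Eisenstein) + ((2 : ℤ) : Eisenstein) * omega = 0 := by
      push_cast
      linear_combination h + omega_sq_add
    have := (eq_zero_of_add_mul h0).1
    omega
  have h : ((∑ i ∈ Finset.range (l + 1), u ^ i * imCoeff (l - i) * (l.choose i : ℤ) : ℤ) :
      Eisenstein) * (omega - omega ^ 2) = (B : Eisenstein) * (omega - omega ^ 2) := by
    have h3 : (B : Eisenstein) * (omega - omega ^ 2) =
        ((u : Eisenstein) + omega) ^ l - ((u : Eisenstein) + omega ^ 2) ^ l := by
      rw [h1, h2]; ring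
    rw [h3, add_pow, add_pow, ← Finset.sum_sub_distrib]
    push_cast
    rw [Finset.sum_mul]
    refine Finset.sum_congr rfl fun i _ => ?_
    linear_combination (-(u : Eisenstein) ^ i * (l.choose i : Eisenstein)) * omega_pow_sub (l - i)
  exact_mod_cast mul_right_cancel₀ hne h

end Eisenstein

theorem two_pow_dvd_mul_sub_one {i v : ℕ} (hi : 3 ≤ i) (h : 2 ^ v ∣ i * (i - 1)) : v ≤ i - 2 := by
  have hc : Nat.Coprime i (i - 1) := by
    have h1 := Nat.coprime_self_add_right (m := i - 1) (n := 1)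
    rw [Nat.sub_add_cancel (by omega)] at h1
    exact (h1.mpr (by simp)).symm
  have hle : 2 ^ v ≤ i := by
    rcases Nat.eq_zero_or_pos v with rfl | hv
    · simp; omega
    by_cases h2 : 2 ∣ i
    · have h3 : Nat.Coprime (2 ^ v) (i - 1) := by
        apply Nat.Coprime.pow_left
        rw [Nat.coprime_two_left, Nat.odd_iff]
        omega
      exact Nat.le_of_dvd (by omega) (h3.dvd_of_dvd_mul_right h)
    · have h3 : Nat.Coprime (2 ^ v) i := by
        apply Nat.Coprime.pow_left
        rw [Nat.coprime_two_left, Nat.odd_iff]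
        omega
      exact (Nat.le_of_dvd (by omega) (h3.dvd_of_dvd_mul_left h)).trans (by omega)
  have hlt : i < 2 ^ (i - 1) := by
    obtain ⟨m, rfl⟩ := Nat.exists_eq_add_of_le' hi
    clear h hc hle
    induction m with
    | zero => norm_num
    | succ m ih =>
      have : 2 ^ (m + 1 + 3 - 1) = 2 * 2 ^ (m + 3 - 1) := by
        rw [← pow_succ']; congr 1
      omega
  have := (Nat.pow_lt_pow_iff_right (by norm_num : 1 < 2)).mp (hle.trans_lt hlt)
  omega

/-- The terms of index at least `3` in `∑ (l choose i) uⁱ⁻² cᵢ` are more divisible by `2` than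
`l choose 2` when `u` is even. -/
theorem two_pow_dvd_choose_mul {l i v : ℕ} (hi : 3 ≤ i) (hv : 2 ^ v ∣ l.choose 2) :
    2 ^ (v + 1) ∣ l.choose i * 2 ^ (i - 2) := by
  have h := Nat.choose_mul (n := l) (k := i) (s := 2) (by omega)
  obtain ⟨w, m, hm, hw⟩ := Nat.exists_eq_pow_mul_and_not_dvd (n := i * (i - 1)) (p := 2)
    (Nat.mul_pos (by omega) (by omega)).ne' (by norm_num)
  have hwi : w ≤ i - 2 := two_pow_dvd_mul_sub_one hi ⟨m, hw⟩
  have h2 : i.choose 2 * 2 = i * (i - 1) := by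
    rw [Nat.choose_two_right]; exact Nat.div_mul_cancel (Nat.even_mul_pred_self i).two_dvd
  have h3 : 2 ^ (v + 1) ∣ 2 ^ w * (l.choose i * m) := by
    have : 2 ^ w * (l.choose i * m) = l.choose 2 * 2 * (l - 2).choose (i - 2) := by
      calc _ = l.choose i * (2 ^ w * m) := by ring
        _ = (l.choose i * i.choose 2) * 2 := by rw [← hw, ← h2]; ring
        _ = _ := by rw [h]; ring
    rw [this, pow_succ]
    exact Dvd.dvd.mul_right (mul_dvd_mul_right hv 2) _
  have hcop : Nat.Coprime (2 ^ (v + 1)) m := by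
    apply Nat.Coprime.pow_left
    rw [Nat.coprime_two_left, ← Nat.not_even_iff_odd, even_iff_two_dvd]
    exact hm
  rw [← mul_assoc] at h3
  refine (hcop.dvd_of_dvd_mul_right h3).trans ?_
  rw [mul_comm]
  exact mul_dvd_mul_left _ (pow_dvd_pow 2 hwi)

/-- For even `u ≠ 0` and a prime `l ≥ 5`, the coefficient of `ω` in `(u + ω)ˡ` is not `±1`. -/
theorem not_isUnit_of_add_omega_pow {l : ℕ} (hl : l.Prime) (h5 : 5 ≤ l) {u A B : ℤ} (hu : Even u)
    (hu0 : u ≠ 0) (h1 : ((u : Eisenstein) + omega) ^ l = A + B * omega)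
    (h2 : ((u : Eisenstein) + omega ^ 2) ^ l = A + B * omega ^ 2) : ¬ IsUnit B := by
  intro hB
  have hS := sum_imCoeff_eq h1 h2
  rw [Finset.range_eq_Ico, Finset.sum_eq_sum_Ico_succ_bot (by omega),
    Finset.sum_Ico_succ_top (by omega)] at hS
  have h0 : imCoeff 0 = 0 := rfl
  simp only [pow_zero, Nat.sub_zero, Nat.choose_zero_right, Nat.cast_one, mul_one, one_mul,
    Nat.sub_self, h0, mul_zero, add_zero, zero_mul, zero_add] at hS
  have hdl : (l : ℤ) ∣ B - imCoeff l := by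
    rw [← hS, add_sub_cancel_left]
    refine Finset.dvd_sum fun i hi => ?_
    rw [Finset.mem_Ico] at hi
    exact Dvd.dvd.mul_left (Int.natCast_dvd_natCast.mpr (hl.dvd_choose_self (by omega) hi.2)) _
  have h3 : ¬ 3 ∣ l := fun h => by
    have := (Nat.prime_dvd_prime_iff_eq Nat.prime_three hl).mp h; omega
  have hcl : imCoeff l = 1 ∨ imCoeff l = -1 := by
    unfold imCoeff; split_ifs <;> omega
  have hBl : B = imCoeff l := by
    have hB' := Int.isUnit_iff.mp hB
    have := Int.eq_zero_of_abs_lt_dvd hdl (by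
      rw [abs_lt]; constructor <;> omega)
    omega
  rw [hBl, add_eq_left, Finset.sum_eq_sum_Ico_succ_bot (by omega)] at hS
  have h2u : (2 : ℤ) ∣ u := hu.two_dvd
  have hl3 : l % 3 = 2 ∨ l % 3 = 1 := by omega
  rcases hl3 with hl3 | hl3
  · have hc : imCoeff (l - 1) = 1 := by
      unfold imCoeff; split_ifs <;> omega
    have hd : u * 2 ∣ ∑ i ∈ Finset.Ico (1 + 1) l, u ^ i * imCoeff (l - i) * (l.choose i : ℤ) := by
      refine Finset.dvd_sum fun i hi => ?_
      rw [Finset.mem_Ico] at hi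
      refine Dvd.dvd.mul_right (Dvd.dvd.mul_right ?_ _) _
      exact (mul_dvd_mul_left u h2u).trans ((pow_two u).symm.dvd.trans (pow_dvd_pow u hi.1))
    have h : u * 2 ∣ u * (l : ℤ) := by
      have := (dvd_add_left hd).mp (hS ▸ dvd_zero (u * 2))
      simpa [hc] using this
    have h2l : (2 : ℤ) ∣ l := (mul_dvd_mul_iff_left hu0).mp h
    have := (Nat.prime_dvd_prime_iff_eq Nat.prime_two hl).mp (by exact_mod_cast h2l)
    omega
  · have hc : imCoeff (l - 1) = 0 := by
      unfold imCoeff; split_ifs <;> omega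
    have hc2 : imCoeff (l - (1 + 1)) = -1 := by
      unfold imCoeff; split_ifs <;> omega
    rw [Finset.sum_eq_sum_Ico_succ_bot (by omega), hc, hc2] at hS
    obtain ⟨v, m, hm, hv⟩ := Nat.exists_eq_pow_mul_and_not_dvd (n := l.choose 2) (p := 2)
      (Nat.choose_pos (by omega)).ne' (by norm_num)
    have hd : u ^ 2 * 2 ^ (v + 1) ∣
        ∑ i ∈ Finset.Ico (1 + 1 + 1) l, u ^ i * imCoeff (l - i) * (l.choose i : ℤ) := by
      refine Finset.dvd_sum fun i hi => ?_
      rw [Finset.mem_Ico] at hi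
      obtain ⟨t, rfl⟩ := h2u
      have h : ((2 ^ (v + 1) : ℕ) : ℤ) ∣ ((l.choose i * 2 ^ (i - 2) : ℕ) : ℤ) :=
        Int.natCast_dvd_natCast.mpr (two_pow_dvd_choose_mul hi.1 ⟨m, hv⟩)
      push_cast at h
      have hi2 : (2 * t) ^ i = (2 * t) ^ 2 * (2 ^ (i - 2) * t ^ (i - 2)) := by
        rw [← mul_pow, ← pow_add, Nat.add_sub_cancel' (by omega)]
      rw [hi2]
      have h4 : (2 * t) ^ 2 * (2 ^ (i - 2) * t ^ (i - 2)) * imCoeff (l - i) * (l.choose i : ℤ) =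
          (2 * t) ^ 2 * (l.choose i * 2 ^ (i - 2)) * (t ^ (i - 2) * imCoeff (l - i)) := by ring
      rw [h4]
      exact Dvd.dvd.mul_right (mul_dvd_mul_left _ h) _
    have h : u ^ 2 * 2 ^ (v + 1) ∣ u ^ 2 * (l.choose 2 : ℤ) := by
      rw [mul_zero, zero_mul, zero_add] at hS
      have := (dvd_add_left hd).mp (hS ▸ dvd_zero (u ^ 2 * 2 ^ (v + 1)))
      have h4 : u ^ (1 + 1) * -1 * (l.choose (1 + 1) : ℤ) = -(u ^ 2 * (l.choose 2 : ℤ)) := by ring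
      rwa [h4, dvd_neg] at this
    have h5 : (2 : ℤ) ^ (v + 1) ∣ l.choose 2 := (mul_dvd_mul_iff_left (pow_ne_zero 2 hu0)).mp h
    have h6 : 2 ^ (v + 1) ∣ l.choose 2 := by exact_mod_cast h5
    rw [hv, pow_succ] at h6
    exact hm ((Nat.mul_dvd_mul_iff_left (by positivity)).mp h6)

/-- Nagell: `x² + x + 1 = yˡ` has no solution with `y > 1` for a prime `l ≥ 5`. -/
theorem sq_add_add_one_ne_pow {l : ℕ} (hl : l.Prime) (h5 : 5 ≤ l) {x y : ℤ} (hy : 1 < y) :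
    x ^ 2 + x + 1 ≠ y ^ l := by
  intro hxy
  have hodd : Odd l := hl.odd_of_ne_two (by omega)
  have hy3 : ¬ 3 ∣ y := fun h3 => not_nine_dvd x (by
    rw [hxy]
    exact ((by norm_num : (9 : ℤ) ∣ 3 ^ 2)).trans
      ((pow_dvd_pow_of_dvd h3 2).trans (pow_dvd_pow y (by omega))))
  have hyx : ((x : Eisenstein) - omega) * (x + 1 + omega) = (y : Eisenstein) ^ l := by
    have h : (x ^ 2 + x + 1 : Eisenstein) = (y : Eisenstein) ^ l := by exact_mod_cast hxy
    linear_combination h - omega_sq_add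
  have hc : IsCoprime ((x : Eisenstein) - omega) (x + 1 + omega) := by
    have h3 : IsCoprime (3 : ℤ) (y ^ l) :=
      (Int.prime_three.irreducible.coprime_iff_not_dvd.mpr hy3).pow_right
    obtain ⟨s, t, hst⟩ := h3
    have hst' : (s * 3 + t * (y : Eisenstein) ^ l : Eisenstein) = 1 := by exact_mod_cast hst
    refine ⟨s * (1 + 2 * omega) + t * (x + 1 + omega), -(s * (1 + 2 * omega)), ?_⟩
    linear_combination hst' + (t : Eisenstein) * hyx - 4 * (s : Eisenstein) * omega_sq_add
  obtain ⟨z, hz⟩ := exists_pow_eq hl h5 hc hyx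
  obtain ⟨a, b, rfl⟩ := exists_eq_add_mul z
  obtain ⟨A, B, hbB, hA, hA'⟩ := exists_pow_eq_add_mul a b l
  obtain ⟨rfl, rfl⟩ : A = x ∧ B = -1 := eq_of_add_mul_eq (by
    rw [← hA, hz]; push_cast; ring)
  have hnorm : a ^ 2 - a * b + b ^ 2 = y := by
    have h : (((a ^ 2 - a * b + b ^ 2) ^ l : ℤ) : Eisenstein) = (A ^ 2 + A + 1 : ℤ) := by
      have h1 : ((a ^ 2 - a * b + b ^ 2 : ℤ) : Eisenstein) =
          (a + b * omega) * (a + b * omega ^ 2) := by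
        push_cast
        linear_combination (-(a * b : Eisenstein) - (b ^ 2 : Eisenstein) * (omega - 1)) *
          omega_sq_add
      rw [Int.cast_pow, h1, mul_pow, hA, hA']
      push_cast
      linear_combination (-A + omega - 1 : Eisenstein) * omega_sq_add
    have h' : (a ^ 2 - a * b + b ^ 2) ^ l = y ^ l := by rw [← hxy]; exact_mod_cast h
    exact hodd.strictMono_pow.injective h'
  have key {u C D : ℤ} (hu : Even u) (hu0 : u ≠ 0) (hD : IsUnit D)
      (h1 : ((u : Eisenstein) + omega) ^ l = C + D * omega)
      (h2 : ((u : Eisenstein) + omega ^ 2) ^ l = C + D * omega ^ 2) : False :=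
    not_isUnit_of_add_omega_pow hl h5 hu hu0 h1 h2 hD
  have hb : b = 1 ∨ b = -1 := Int.isUnit_iff.mp (isUnit_of_dvd_unit hbB (by decide))
  have hw : omega ^ 2 = -1 - omega := by linear_combination omega_sq_add
  rw [hw] at hA'
  rcases hb with rfl | rfl <;> rcases Int.even_or_odd a with ha | ha
  · refine key (u := a) (C := A) (D := -1) ha ?_ (by decide) ?_ ?_
    · rintro rfl; omega
    · rw [← hA]; push_cast; ring
    · rw [hw, ← hA']; push_cast; ring
  · refine key (u := 1 - a) (C := -A - 1) (D := -1) (by grind) ?_ (by decide) ?_ ?_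
    · intro h
      obtain rfl : a = 1 := by omega
      omega
    · have h : ((1 - a : ℤ) : Eisenstein) + omega = -(a + (1 : ℤ) * (-1 - omega)) := by
        push_cast; ring
      rw [h, hodd.neg_pow, hA']; push_cast; ring
    · have h : ((1 - a : ℤ) : Eisenstein) + omega ^ 2 = -(a + (1 : ℤ) * omega) := by
        rw [hw]; push_cast; ring
      rw [h, hodd.neg_pow, hA, hw]; push_cast; ring
  · refine key (u := -a) (C := -A) (D := 1) ha.neg ?_ (by decide) ?_ ?_
    · intro h
      obtain rfl : a = 0 := by omega
      omega
    · have h : ((-a : ℤ) : Eisenstein) + omega = -(a + (-1 : ℤ) * omega) := by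
        push_cast; ring
      rw [h, hodd.neg_pow, hA]; push_cast; ring
    · have h : ((-a : ℤ) : Eisenstein) + omega ^ 2 = -(a + (-1 : ℤ) * (-1 - omega)) := by
        rw [hw]; push_cast; ring
      rw [h, hodd.neg_pow, hA', hw]; push_cast; ring
  · refine key (u := a + 1) (C := A + 1) (D := 1) (by grind) ?_ (by decide) ?_ ?_
    · intro h
      obtain rfl : a = -1 := by omega
      omega
    · have h : ((a + 1 : ℤ) : Eisenstein) + omega = a + (-1 : ℤ) * (-1 - omega) := by
        push_cast; ring
      rw [h, hA']; push_cast; ring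
    · have h : ((a + 1 : ℤ) : Eisenstein) + omega ^ 2 = a + (-1 : ℤ) * omega := by
        rw [hw]; push_cast; ring
      rw [h, hA, hw]; push_cast; ring

theorem sq_add_add_one_ne_sq {x y : ℤ} (h0 : x ≠ 0) (h1 : x ≠ -1) : x ^ 2 + x + 1 ≠ y ^ 2 := by
  intro h
  rw [← sq_abs y] at h
  have hy := abs_nonneg y
  rcases (by omega : 1 ≤ x ∨ x ≤ -2) with hx | hx
  · rcases le_or_gt |y| x with hyx | hyx <;> nlinarith
  · rcases le_or_gt |y| (-x - 1) with hyx | hyx <;> nlinarith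

/-- `x² + x + 1 = 3 y³` is equivalent to `(x - 1)³ + (3 y)³ = (x + 2)³`. -/
theorem sq_add_add_one_ne_three_mul_cube {x y : ℤ} (h1 : x ≠ 1) (h2 : x ≠ -2) :
    x ^ 2 + x + 1 ≠ 3 * y ^ 3 := by
  intro h
  have hy : y ≠ 0 := by
    rintro rfl
    nlinarith
  exact fermatLastTheoremFor_iff_int.mp fermatLastTheoremThree (x - 1) (3 * y) (x + 2)
    (by omega) (by omega) (by omega) (by linear_combination -9 * h)

theorem eq_of_sq_add_add_one_eq_cube {p e : ℕ} (hp : p.Prime) {x y : ℤ} (hx : x.natAbs = p ^ e)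
    (hy : 1 < y) (h : x ^ 2 + x + 1 = y ^ 3) : x = -19 ∧ y = 7 := by
  have small (hy8 : y ≤ 8) : x = -19 ∧ y = 7 := by
    have hx18 : x ≠ 18 := by
      rintro rfl
      have h2 : 2 ∣ p ^ e := hx ▸ (by norm_num : 2 ∣ (18 : ℤ).natAbs)
      have h3 : 3 ∣ p ^ e := hx ▸ (by norm_num : 3 ∣ (18 : ℤ).natAbs)
      have h2' := (Nat.prime_dvd_prime_iff_eq Nat.prime_two hp).mp (Nat.prime_two.dvd_of_dvd_pow h2)
      have h3' := (Nat.prime_dvd_prime_iff_eq Nat.prime_three hp).mp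
        (Nat.prime_three.dvd_of_dvd_pow h3)
      omega
    have hy3 : y ^ 3 ≤ 8 ^ 3 := pow_le_pow_left₀ (by omega) hy8 3
    have hl : -24 < x := by nlinarith
    have hr : x < 24 := by nlinarith
    clear hy3
    interval_cases y <;> interval_cases x <;> omega
  have hmul : x * (x + 1) = (y - 1) * (y ^ 2 + y + 1) := by linear_combination h
  have hcop {z : ℤ} (hz : ¬ (p : ℤ) ∣ z) : IsCoprime x z := by
    rw [Int.isCoprime_iff_gcd_eq_one, Int.gcd_eq_natAbs, hx]
    exact Nat.Coprime.pow_left _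
      ((Nat.Prime.coprime_iff_not_dvd hp).mpr fun h => hz (Int.natCast_dvd.mpr h))
  by_cases hp3 : p = 3
  · subst hp3
    by_cases he : e = 0
    · subst he
      have hx1 : x = 1 ∨ x = -1 := by omega
      rcases hx1 with rfl | rfl <;> nlinarith [pow_le_pow_left₀ (by norm_num : (0 : ℤ) ≤ 2) hy 3]
    have h3x : (3 : ℤ) ∣ x := Int.natCast_dvd.mpr (hx ▸ dvd_pow_self 3 he)
    have hy1 : ∃ m, y = 3 * m + 1 := by
      have h3 : (y ^ 3) % 3 = 1 := by
        obtain ⟨m, rfl⟩ := h3x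
        rw [← h]
        ring_nf
        omega
      have : y % 3 = 0 ∨ y % 3 = 1 ∨ y % 3 = 2 := by omega
      rcases this with h | h | h
      · simp [pow_succ, Int.mul_emod, h] at h3
      · exact ⟨y / 3, by omega⟩
      · simp [pow_succ, Int.mul_emod, h] at h3
    obtain ⟨m, rfl⟩ := hy1
    have hd : x ∣ 9 * m * (3 * m ^ 2 + 3 * m + 1) := ⟨x + 1, by linear_combination -hmul⟩
    have hc : IsCoprime x (3 * m ^ 2 + 3 * m + 1) := hcop (by push_cast; omega)
    have hle := Int.le_of_dvd (by omega) ((abs_dvd x _).mpr (hc.dvd_of_dvd_mul_right hd))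
    rw [abs_le] at hle
    have hm : m ≤ 2 := by
      by_contra hm
      have h9 : x ^ 2 ≤ (9 * m) ^ 2 := sq_le_sq' hle.1 hle.2
      nlinarith [mul_nonneg (sq_nonneg m) (by omega : 0 ≤ m - 3)]
    exact small (by omega)
  · have h3 : ¬ (p : ℤ) ∣ 3 := fun h3 => hp3
      ((Nat.prime_dvd_prime_iff_eq hp Nat.prime_three).mp (by exact_mod_cast h3))
    by_cases hpy : (p : ℤ) ∣ y - 1
    · have hpy2 : ¬ (p : ℤ) ∣ y ^ 2 + y + 1 := fun h4 => h3 (by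
        have := dvd_sub h4 (hpy.mul_right (y + 2))
        ring_nf at this
        exact this)
      have hd : x ∣ y - 1 := (hcop hpy2).dvd_of_dvd_mul_right (hmul ▸ dvd_mul_right x (x + 1))
      have hle := Int.le_of_dvd (by omega) ((abs_dvd x _).mpr hd)
      rw [abs_le] at hle
      nlinarith
    · obtain ⟨w, hw⟩ := (hcop hpy).dvd_of_dvd_mul_left (hmul ▸ dvd_mul_right x (x + 1))
      have hx0 : x ≠ 0 := by rintro rfl; nlinarith
      have hw1 : x + 1 = (y - 1) * w := by
        apply mul_left_cancel₀ hx0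
        rw [hmul, hw]; ring
      have hw2 : (y - 1) * w ^ 2 - w = (y - 1) ^ 2 + 3 * (y - 1) + 3 := by
        linear_combination -hw - w * hw1
      obtain ⟨t, ht⟩ : y - 1 ∣ w + 3 := ⟨w ^ 2 - (y - 1) - 3, by linear_combination -hw2⟩
      by_contra hne
      have hy8 : 9 ≤ y := by
        by_contra hy8
        exact hne (small (by omega))
      obtain ⟨m, rfl⟩ : ∃ m, y = m + 9 := ⟨y - 9, by ring⟩
      have hm : 0 ≤ m := by omega
      rcases lt_trichotomy t 0 with ht0 | rfl | ht0
      · have : w ≤ -3 - (m + 8) := by nlinarith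
        nlinarith
      · have : w = -3 := by linarith
        subst this
        nlinarith
      · have : m + 8 - 3 ≤ w := by nlinarith
        nlinarith

theorem xn_two_succ (n : ℕ) :
    Pell.xn one_lt_two (n + 1) = Pell.xn one_lt_two n * 2 + 3 * Pell.yn one_lt_two n :=
  Pell.xn_succ one_lt_two n

theorem xn_two_sq (n : ℕ) : Pell.xn one_lt_two n ^ 2 = 3 * Pell.yn one_lt_two n ^ 2 + 1 := by
  induction n with
  | zero => simp
  | succ n ih =>
    rw [xn_two_succ, Pell.yn_succ]
    linear_combination ih

theorem xn_two_three_mul (n : ℕ) :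
    Pell.xn one_lt_two (3 * n) + 3 * Pell.xn one_lt_two n = 4 * Pell.xn one_lt_two n ^ 3 := by
  have hadd (m n : ℕ) : Pell.xn one_lt_two (m + n) = Pell.xn one_lt_two m * Pell.xn one_lt_two n +
      3 * Pell.yn one_lt_two m * Pell.yn one_lt_two n := Pell.xn_add one_lt_two m n
  rw [(by ring : 3 * n = n + n + n), hadd, hadd, Pell.yn_add]
  have hsq := xn_two_sq n
  zify at hsq ⊢
  linear_combination (-3 * Pell.xn one_lt_two n : ℤ) * hsq

theorem xn_two_mod_two (n : ℕ) :
    Pell.xn one_lt_two n % 2 = (n + 1) % 2 ∧ Pell.yn one_lt_two n % 2 = n % 2 := by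
  induction n with
  | zero => simp
  | succ n ih =>
    rw [xn_two_succ, Pell.yn_succ]
    omega

theorem xn_two_add_mul {R : Type*} [CommRing R] {s : R} (hs : s ^ 2 = 3) (n : ℕ) :
    (2 + s) ^ n = (Pell.xn one_lt_two n : R) + Pell.yn one_lt_two n * s := by
  induction n with
  | zero => simp
  | succ n ih =>
    rw [pow_succ, ih, xn_two_succ, Pell.yn_succ]
    push_cast
    linear_combination (Pell.yn one_lt_two n : R) * hs

/-- If `r` divides a term of odd index of the sequence `xₙ` of the Pell equation `x² - 3y² = 1`,
`3` is a square modulo `r`, and `r - 1 = 4·3ʲ`, then `3` divides the index. -/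
theorem three_dvd_of_dvd_xn_two {r j n : ℕ} (hr : r.Prime) (hr3 : 3 < r) (hj : r - 1 = 4 * 3 ^ j)
    {s : ZMod r} (hs : s ^ 2 = 3) (h : r ∣ Pell.xn one_lt_two n) : 3 ∣ n := by
  by_contra h3
  have := Fact.mk hr
  have hX : (Pell.xn one_lt_two n : ZMod r) = 0 := (ZMod.natCast_eq_zero_iff _ _).mpr h
  have h1 := xn_two_add_mul hs n
  have h2 := xn_two_add_mul (s := -s) (by rw [neg_sq, hs]) n
  have hmul : (2 + s) * (2 + -s) = 1 := by linear_combination -hs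
  have hmuln : (2 + s) ^ n * (2 + -s) ^ n = 1 := by rw [← mul_pow, hmul, one_pow]
  have he0 : (2 + s) ≠ 0 := left_ne_zero_of_mul_eq_one hmul
  have h2n : ((2 + s) ^ n) ^ 2 = -1 := by
    linear_combination (2 + s) ^ n * (h1 + h2 + 2 * hX) - hmuln
  have h4n : (2 + s) ^ (4 * n) = 1 := by
    rw [mul_comm, (by norm_num : 4 = 2 * 2), pow_mul, pow_mul, h2n]; norm_num
  have hcard : (2 + s) ^ (4 * 3 ^ j) = 1 := hj ▸ ZMod.pow_card_sub_one_eq_one he0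
  have hgcd : orderOf (2 + s) ∣ 4 := by
    have := Nat.dvd_gcd (orderOf_dvd_of_pow_eq_one h4n) (orderOf_dvd_of_pow_eq_one hcard)
    rwa [Nat.gcd_mul_left, Nat.Coprime.gcd_eq_one, mul_one] at this
    exact (((Nat.Prime.coprime_iff_not_dvd Nat.prime_three).mpr h3).pow_left j).symm
  have h4 : (2 + s) ^ 4 = 1 := orderOf_dvd_iff_pow_eq_one.mp hgcd
  have h192 : ((192 : ℕ) : ZMod r) = 0 := by
    push_cast
    have h5 : 2 = 14 * (2 + s) ^ 2 := by
      linear_combination -h4 + ((2 + s) ^ 2 + 1 + 4 * (2 + s)) * hs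
    linear_combination -(2 + 14 * (2 + s) ^ 2) * h5 - 196 * h4
  rw [ZMod.natCast_eq_zero_iff, (by norm_num : 192 = 2 ^ 6 * 3), hr.dvd_mul] at h192
  rcases h192 with h | h
  · have := Nat.le_of_dvd two_pos (hr.dvd_of_dvd_pow h)
    omega
  · have := Nat.le_of_dvd three_pos h
    omega

theorem eq_thirteen_of_three_mul_sq_add_one {r i j : ℕ} {b z : ℕ} (hr : r.Prime) (hr3 : 3 < r)
    (hj : r - 1 = 4 * 3 ^ j) (hi : i ≠ 0) (hb : 2 * r ^ i + 1 = 3 * b ^ 2)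
    (h : 3 * z ^ 2 + 1 = 4 * (r ^ i) ^ 2) : r = 13 ∧ i = 1 := by
  obtain ⟨n, hn, -⟩ := Pell.eq_pell one_lt_two (x := 2 * r ^ i) (y := z) (by
    change 2 * r ^ i * (2 * r ^ i) - 3 * z * z = 1
    rw [(by ring : 2 * r ^ i * (2 * r ^ i) = 4 * (r ^ i) ^ 2), ← h]
    have : 3 * z * z = 3 * z ^ 2 := by ring
    omega)
  have hr0 : ((r : ℕ) : ZMod r) = 0 := ZMod.natCast_self r
  have hs : (3 * b : ZMod r) ^ 2 = 3 := by
    have hb' : (2 * r ^ i + 1 : ZMod r) = 3 * b ^ 2 := by exact_mod_cast congrArg (Nat.cast) hb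
    rw [hr0, zero_pow hi] at hb'
    linear_combination (-3 : ZMod r) * hb'
  obtain ⟨m, rfl⟩ := three_dvd_of_dvd_xn_two hr hr3 hj hs (hn ▸ (dvd_pow_self r hi).mul_left 2)
  have hm := (xn_two_mod_two m).1
  have h3m := (xn_two_mod_two (3 * m)).1
  obtain ⟨V, hV⟩ : ∃ V, Pell.xn one_lt_two m = 2 * V := ⟨Pell.xn one_lt_two m / 2, by omega⟩
  have hV1 : r ^ i + 3 * V = 16 * V ^ 3 := by
    have := xn_two_three_mul m
    rw [← hn, hV] at this
    linarith
  have hr2 : ¬ r ∣ 3 := fun h => by have := Nat.le_of_dvd three_pos h; omega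
  have hri : r ^ i = V * (16 * V ^ 2 - 3) := by
    rw [Nat.mul_sub]
    have : V * (16 * V ^ 2) = 16 * V ^ 3 := by ring
    omega
  obtain ⟨v, -, hv⟩ := (Nat.dvd_prime_pow hr).mp (hri ▸ dvd_mul_right V _)
  obtain ⟨t, -, ht⟩ := (Nat.dvd_prime_pow hr).mp (hri ▸ dvd_mul_left (16 * V ^ 2 - 3) V)
  have hV0 : 0 < V := by rw [hv]; exact pow_pos hr.pos v
  have hVsq : 1 ≤ V ^ 2 := Nat.one_le_pow _ _ hV0
  have ht0 : t ≠ 0 := by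
    rintro rfl
    rw [pow_zero] at ht
    omega
  have hv0 : v = 0 := by
    by_contra hv0
    apply hr2
    have h1 : r ∣ 16 * V ^ 2 - 3 := ht ▸ dvd_pow_self r ht0
    have h2 : r ∣ 16 * V ^ 2 := (hv ▸ (dvd_pow_self r hv0).pow two_ne_zero : r ∣ V ^ 2).mul_left 16
    have := Nat.dvd_sub h2 h1
    rwa [Nat.sub_sub_self (by omega)] at this
  rw [hv0, pow_zero] at hv
  rw [hv] at hri
  have hr13 : r = 13 := (Nat.prime_dvd_prime_iff_eq hr (by norm_num)).mp
    (by have := dvd_pow_self r hi; rwa [hri] at this)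
  subst hr13
  exact ⟨rfl, Nat.pow_right_injective (by norm_num : 2 ≤ 13) (by simpa using hri)⟩

theorem not_isSquare_of_emod_three {x : ℤ} (h : x % 3 = 2) : ¬ IsSquare x := by
  rintro ⟨y, rfl⟩
  have : y % 3 = 0 ∨ y % 3 = 1 ∨ y % 3 = 2 := by omega
  rcases this with h' | h' | h' <;> simp [Int.mul_emod, h'] at h

theorem exists_eq_sq_of_mul_eq_sq {a b c : ℤ} (hab : IsCoprime a b) (ha : 0 < a)
    (h : a * b = c ^ 2) : ∃ d, a = d ^ 2 := by
  obtain ⟨d, hd | hd⟩ := Int.sq_of_gcd_eq_one (Int.isCoprime_iff_gcd_eq_one.mp hab) h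
  · exact ⟨d, hd⟩
  · nlinarith [sq_nonneg d]

/-- From `x² + x + 1 = 3 y²`, the factorization `(2y - 1)(2y + 1) = 3 z²`, with `2x + 1 = 3z`,
gives a square and three times a square. -/
theorem exists_of_sq_add_add_one_eq {x y : ℤ} (hy : 0 < y) (h : x ^ 2 + x + 1 = 3 * y ^ 2) :
    ∃ a b z, 2 * y - 1 = a ^ 2 ∧ 2 * y + 1 = 3 * b ^ 2 ∧ 3 * z ^ 2 + 1 = 4 * y ^ 2 := by
  obtain ⟨z, hz⟩ : 3 ∣ 2 * x + 1 := Int.prime_three.dvd_of_dvd_pow (n := 2)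
    ⟨4 * y ^ 2 - 1, by linear_combination 4 * h⟩
  have hyz : (2 * y - 1) * (2 * y + 1) = 3 * z ^ 2 := by
    have h9 : (2 * x + 1) ^ 2 = 9 * z ^ 2 := by rw [hz]; ring
    linarith
  have hc : IsCoprime (2 * y - 1) (2 * y + 1) := ⟨y, 1 - y, by ring⟩
  rcases Int.prime_three.dvd_or_dvd ⟨z ^ 2, hyz⟩ with ⟨w, hw⟩ | ⟨w, hw⟩
  · exfalso
    rw [hw] at hc hyz
    obtain ⟨d, hd⟩ := exists_eq_sq_of_mul_eq_sq (a := 2 * y + 1) (b := w) (c := z)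
      hc.of_mul_left_right.symm (by omega)
      (by linarith)
    exact not_isSquare_of_emod_three (x := 2 * y + 1) (by omega) ⟨d, by rw [hd]; ring⟩
  · rw [hw] at hc hyz
    have hwz : w * (2 * y - 1) = z ^ 2 := by linarith
    obtain ⟨b, rfl⟩ := exists_eq_sq_of_mul_eq_sq hc.of_mul_right_right.symm (by omega) hwz
    obtain ⟨a, ha⟩ := exists_eq_sq_of_mul_eq_sq hc.of_mul_right_right (by omega)
      ((mul_comm _ _).trans hwz)
    exact ⟨a, b, z, ha, hw, by linear_combination -hyz - (2 * y - 1) * hw⟩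

theorem sq_add_add_one_dvd_pow {x : ℤ} {s : ℕ} (hs : ¬ 3 ∣ s) :
    x ^ 2 + x + 1 ∣ (x ^ s) ^ 2 + x ^ s + 1 := by
  set N := x ^ 2 + x + 1
  have h0 : x ^ 2 + x + 1 ≡ 0 [ZMOD N] := Int.modEq_zero_iff_dvd.mpr dvd_rfl
  have h3 : x ^ 3 ≡ 1 [ZMOD N] := (Int.modEq_iff_dvd.mpr ⟨1 - x, by ring⟩)
  rw [← Int.modEq_zero_iff_dvd]
  have hpow : x ^ s ≡ x ^ (s % 3) [ZMOD N] := by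
    have := ((h3.pow (s / 3)).mul_right (x ^ (s % 3)))
    rwa [← pow_mul, ← pow_add, Nat.div_add_mod, one_pow, one_mul] at this
  refine (((hpow.pow 2).add hpow).add_right 1).trans ?_
  have : s % 3 = 1 ∨ s % 3 = 2 := by omega
  rcases this with h | h <;> rw [h]
  · simpa using h0
  · refine Int.ModEq.trans ?_ h0
    have h4 : (x ^ 2) ^ 2 ≡ x [ZMOD N] := by
      have := h3.mul_right x
      rwa [one_mul, ← pow_succ, (by norm_num : 3 + 1 = 2 * 2), pow_mul] at this
    rw [add_comm (x ^ 2) x]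
    exact (h4.add_right _).add_right 1

theorem pow_dvd_of_pow_dvd_sq_add_add_one {r : ℕ} (hr : r.Prime) (hr3 : 3 < r) {x : ℤ} {s k : ℕ}
    (h1 : (r : ℤ) ∣ x ^ 2 + x + 1) (hk : (r : ℤ) ^ k ∣ (x ^ s) ^ 2 + x ^ s + 1) :
    (r : ℤ) ^ k ∣ (x ^ 2 + x + 1) * s := by
  have hrZ : Prime (r : ℤ) := Nat.prime_iff_prime_int.mp hr
  have hx : ¬ (r : ℤ) ∣ x := fun h => hrZ.not_dvd_one (by
    have := dvd_sub h1 (h.mul_right (x + 1))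
    ring_nf at this
    exact this)
  have hx1 : ¬ (r : ℤ) ∣ x - 1 := fun h => by
    have := dvd_sub h1 (h.mul_right (x + 2))
    ring_nf at this
    have := Int.le_of_dvd (by norm_num) this
    omega
  have h3 : (r : ℤ) ^ k ∣ (x ^ 3) ^ s - 1 ^ s :=
    hk.trans ⟨x ^ s - 1, by rw [← pow_mul, mul_comm 3 s, pow_mul]; ring⟩
  have hlte := Int.emultiplicity_pow_sub_pow hr (hr.odd_of_ne_two (by omega)) (x := x ^ 3) (y := 1)
    (h1.trans ⟨x - 1, by ring⟩) (fun h => hx (hrZ.dvd_of_dvd_pow h)) s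
  rw [← Int.natCast_emultiplicity r s, ← emultiplicity_mul hrZ] at hlte
  have h4 : (r : ℤ) ^ k ∣ (x ^ 3 - 1) * s := by
    rw [pow_dvd_iff_le_emultiplicity, ← hlte, ← pow_dvd_iff_le_emultiplicity]
    exact h3
  have h5 : (x ^ 3 - 1) * s = (x - 1) * ((x ^ 2 + x + 1) * s) := by ring
  rw [h5] at h4
  exact ((hrZ.irreducible.coprime_iff_not_dvd.mpr hx1).pow_left).dvd_of_dvd_mul_left h4

/-- The powers `xˢ` grow too fast for lifting the exponent. -/
theorem lt_sq_add_add_one_pow {x : ℤ} (hx : 3 ≤ |x|) {s : ℕ} (hs : 2 ≤ s) :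
    3 * s * (x ^ 2 + x + 1) < (x ^ s) ^ 2 + x ^ s + 1 := by
  rcases hs.eq_or_lt with rfl | hs
  · have : 6 < x ^ 2 - x + 1 := by
      rcases abs_cases x with h | h <;> nlinarith
    push_cast
    nlinarith
  · obtain ⟨m, rfl⟩ := Nat.exists_eq_add_of_lt hs
    set t := |x| with ht
    have h1 : x ^ 2 + x + 1 ≤ t ^ 2 + t + 1 := by
      rw [← sq_abs x]; linarith [le_abs_self x]
    have h2 : (t ^ (2 + m + 1)) ^ 2 - t ^ (2 + m + 1) + 1 ≤
        (x ^ (2 + m + 1)) ^ 2 + x ^ (2 + m + 1) + 1 := by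
      rw [ht, ← abs_pow, sq_abs]
      linarith [neg_abs_le (x ^ (2 + m + 1))]
    have hT1 : (3 * (2 + m + 1) : ℤ) ≤ 3 ^ (2 + m) := by
      clear h2
      induction m with
      | zero => norm_num
      | succ m ih =>
        rw [← add_assoc, pow_succ]
        push_cast
        have := ih (by omega) (by omega)
        have : (0 : ℤ) ≤ m := by positivity
        linarith
    have hT : (3 ^ (2 + m) : ℤ) ≤ t ^ (2 + m) := pow_le_pow_left₀ (by norm_num) hx _
    have h3 : t ^ (2 + m + 1) = t ^ (2 + m) * t := pow_succ _ _
    rw [h3] at h2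
    set T := t ^ (2 + m)
    have hT9 : 9 ≤ T := by
      have : (0 : ℤ) ≤ m := by positivity
      linarith
    push_cast
    have h4 : 3 * (2 + m + 1 : ℤ) * (x ^ 2 + x + 1) ≤ T * (t ^ 2 + t + 1) :=
      mul_le_mul (hT1.trans hT) h1 (by nlinarith) (by linarith)
    have h5 : t ^ 2 + t + 1 ≤ t ^ 2 * T - t := by nlinarith
    nlinarith

theorem emod_three_eq_one {x y : ℤ} (h : x ^ 2 + x + 1 = 3 * y) : x % 3 = 1 := by
  have h3 : (x ^ 2 + x + 1) % 3 = 0 := by rw [h, Int.mul_emod_right]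
  have : x % 3 = 0 ∨ x % 3 = 1 ∨ x % 3 = 2 := by omega
  rcases this with h | h | h
  · simp [pow_two, Int.add_emod, Int.mul_emod, h] at h3
  · exact h
  · simp [pow_two, Int.add_emod, Int.mul_emod, h] at h3

theorem ne_two_of_sq_add_add_one_eq {p e : ℕ} (he : e ≠ 0) {x y : ℤ} (hx : x.natAbs = p ^ e)
    (hy : 1 < y) (h : x ^ 2 + x + 1 = 3 * y ^ 2) : p ≠ 2 := by
  rintro rfl
  have hodd : Odd y := by
    have := odd_sq_add_add_one x
    rw [h, Int.odd_mul, Int.odd_pow' two_ne_zero] at this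
    exact this.2
  by_cases he3 : 3 ≤ e
  · obtain ⟨t, rfl⟩ : (8 : ℤ) ∣ x := Int.natCast_dvd.mpr (hx ▸ pow_dvd_pow 2 he3)
    obtain ⟨w, rfl⟩ := hodd
    obtain ⟨v, hv⟩ := (Int.even_mul_succ_self w).two_dvd
    have : 64 * t ^ 2 + 8 * t + 1 = 24 * v + 3 := by linear_combination h + 12 * hv
    omega
  · have h4 : y ^ 2 < 3 ^ 2 := by
      have h12 : e = 1 ∨ e = 2 := by omega
      have hx' : x = 2 ∨ x = -2 ∨ x = 4 ∨ x = -4 := by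
        rcases h12 with rfl | rfl <;> omega
      rcases hx' with rfl | rfl | rfl | rfl <;> omega
    have := lt_of_pow_lt_pow_left₀ 2 (by norm_num) h4
    obtain rfl : y = 2 := by omega
    exact absurd hodd (by decide)

/-- If `3 ∤ s` and `2 ≤ s`, then `x² + x + 1` has a prime divisor besides `3` dividing
`x²ˢ + xˢ + 1` too; lifting the exponent shows that the latter is not of the form `3 rᵏ`. -/
theorem sq_add_add_one_pow_ne {r s k : ℕ} (hr : r.Prime) (hr3 : 3 < r) (hs2 : 2 ≤ s)
    (hs3 : ¬ 3 ∣ s) {x : ℤ} (hx : 3 ≤ |x|) : (x ^ s) ^ 2 + x ^ s + 1 ≠ 3 * (r : ℤ) ^ k := by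
  intro h
  have hpos : 0 < x ^ 2 + x + 1 := by nlinarith [sq_nonneg (2 * x + 1)]
  have hr1 : (r : ℤ) ∣ x ^ 2 + x + 1 := by
    by_contra hr1
    have hd : x ^ 2 + x + 1 ∣ 3 * (r : ℤ) ^ k := h ▸ sq_add_add_one_dvd_pow hs3
    have hc : IsCoprime (x ^ 2 + x + 1) ((r : ℤ) ^ k) :=
      ((Nat.prime_iff_prime_int.mp hr).irreducible.coprime_iff_not_dvd.mpr hr1).symm.pow_right
    have := Int.le_of_dvd three_pos (hc.dvd_of_dvd_mul_right hd)
    rcases abs_cases x with h | h <;> nlinarith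
  have hd := pow_dvd_of_pow_dvd_sq_add_add_one hr hr3 hr1 (k := k) (s := s) ⟨3, by rw [h]; ring⟩
  have hle := Int.le_of_dvd (by positivity) hd
  have hlt := lt_sq_add_add_one_pow hx hs2
  rw [h] at hlt
  linarith

theorem exists_eq_three_pow {p e r i : ℕ} (hp : p.Prime) (he : e ≠ 0) (hr : r.Prime) (hr3 : 3 < r)
    (hi : i ≠ 0) {σ : ℤ} (hσ : σ = 1 ∨ σ = -1)
    (h : (σ * p ^ e) ^ 2 + σ * p ^ e + 1 = 3 * ((r : ℤ) ^ i) ^ 2) :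
    ∃ c, e = 3 ^ c ∧ 4 * 3 ^ (c + 1) ∣ r - 1 := by
  have hrZ : Prime (r : ℤ) := Nat.prime_iff_prime_int.mp hr
  have hy : 1 < (r : ℤ) ^ i := one_lt_pow₀ (by exact_mod_cast hr.one_lt) hi
  have hσ1 : |σ| = 1 := by rcases hσ with rfl | rfl <;> rfl
  have hp2 : p ≠ 2 := ne_two_of_sq_add_add_one_eq he (x := σ * p ^ e)
    (by rcases hσ with rfl | rfl <;> simp [Int.natAbs_pow]) hy h
  have hp3 : 3 ≤ p := by have := hp.two_le; omega
  have hx3 := emod_three_eq_one h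
  obtain ⟨c, s, hs, rfl⟩ := Nat.exists_eq_pow_mul_and_not_dvd he 3 (by norm_num)
  have hσs : σ ^ s = σ := by
    rcases hσ with rfl | rfl
    · simp
    · refine (Nat.not_even_iff_odd.mp fun ⟨t, ht⟩ => ?_).neg_one_pow
      refine not_isSquare_of_emod_three (x := (p : ℤ) ^ (3 ^ c * s)) (by omega)
        ⟨p ^ (3 ^ c * t), ?_⟩
      rw [← pow_add, ht, mul_add]
  have hs1 : s = 1 := by
    by_contra hs1
    have hs0 : s ≠ 0 := by rintro rfl; exact hs (dvd_zero 3)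
    refine sq_add_add_one_pow_ne (r := r) (s := s) (k := i * 2) (x := σ * p ^ 3 ^ c) hr hr3
      (by omega) hs ?_ ?_
    · rw [abs_mul, hσ1, one_mul, abs_pow, Nat.abs_cast]
      exact_mod_cast hp3.trans (Nat.le_self_pow (by positivity) p)
    · rw [mul_pow, hσs, ← pow_mul, pow_mul (r : ℤ)]
      exact h
  subst hs1
  rw [mul_one] at h
  refine ⟨c, mul_one _, ?_⟩
  have hrx : (r : ℤ) ∣ (σ * p ^ 3 ^ c) ^ 2 + σ * p ^ 3 ^ c + 1 :=
    h ▸ ((dvd_pow_self _ hi).trans (dvd_pow_self _ two_ne_zero)).mul_left 3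
  have := Fact.mk hr
  refine Nat.Coprime.mul_dvd_of_dvd_of_dvd ?_ ?_ ?_
  · exact Nat.Coprime.pow_right _ (by norm_num)
  · obtain ⟨a, -, -, ha, -, -⟩ := exists_of_sq_add_add_one_eq (by omega) h
    have hra : (a : ZMod r) ^ 2 = -1 := by
      have : ((2 * (r : ℤ) ^ i - 1 : ℤ) : ZMod r) = ((a ^ 2 : ℤ) : ZMod r) := congrArg _ ha
      push_cast at this
      rw [← this, ZMod.natCast_self, zero_pow hi]
      ring
    have h4 := ZMod.mod_four_ne_three_of_sq_eq_neg_one hra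
    have := hr.eq_two_or_odd
    omega
  · have hX : ((σ : ZMod r) * p ^ 3 ^ c) ^ 2 + σ * p ^ 3 ^ c + 1 = 0 := by
      rw [← ZMod.intCast_zmod_eq_zero_iff_dvd] at hrx
      exact_mod_cast hrx
    set t : ZMod r := σ * p ^ 3 ^ c
    have hσ2 : (σ : ZMod r) ^ 2 = 1 := by rcases hσ with rfl | rfl <;> simp
    have ht2 : ((p : ZMod r) ^ 2) ^ 3 ^ c = t ^ 2 := by
      simp only [t, mul_pow, hσ2]; ring
    have h0 : ((p : ZMod r) ^ 2) ^ 3 ^ c ≠ 1 := by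
      intro h1
      rw [ht2] at h1
      have h3 : ((3 : ℕ) : ZMod r) = 0 := by
        push_cast
        linear_combination (2 - t) * hX + (t - 1) * h1
      rw [ZMod.natCast_eq_zero_iff] at h3
      have := Nat.le_of_dvd three_pos h3
      omega
    have h1 : ((p : ZMod r) ^ 2) ^ 3 ^ (c + 1) = 1 := by
      rw [pow_succ 3 c, pow_mul, ht2]
      linear_combination (t ^ 3 + 1) * (t - 1) * hX
    rw [← orderOf_eq_prime_pow h0 h1]
    apply ZMod.orderOf_dvd_card_sub_one
    intro h2
    rw [h2, zero_pow (by positivity)] at h1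
    exact zero_ne_one h1

/-- The only solution of `x² + x + 1 = 3 r²ⁱ` with `x = -pᵉ` and `r ≤ 24 e`. -/
theorem eq_of_sq_add_add_one_eq_three_mul_sq {p e r i : ℕ} (hp : p.Prime) (he : e ≠ 0)
    (hr : r.Prime) (hr3 : 3 < r) (hi : i ≠ 0) (hre : r ≤ 24 * e)
    (h : ((p : ℤ) ^ e) ^ 2 - p ^ e + 1 = 3 * ((r : ℤ) ^ i) ^ 2) : p ^ e = 23 ∧ e = 1 ∧ r = 13 := by
  have h' : (-1 * (p : ℤ) ^ e) ^ 2 + -1 * p ^ e + 1 = 3 * ((r : ℤ) ^ i) ^ 2 := by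
    rw [← h]; ring
  obtain ⟨c, rfl, k, hk⟩ := exists_eq_three_pow hp he hr hr3 hi (Or.inr rfl) h'
  have hk1 : k = 1 := by
    rw [pow_succ] at hk
    have h3 : 0 < 3 ^ c := by positivity
    rcases (by omega : k = 0 ∨ k = 1 ∨ 2 ≤ k) with rfl | rfl | hk2
    · omega
    · rfl
    · have h4 : r - 1 = 12 * (3 ^ c * k) := by rw [hk]; ring
      have h5 := Nat.mul_le_mul_left (3 ^ c) hk2
      omega
  subst hk1
  rw [mul_one] at hk
  obtain ⟨a, b, z, -, hb, hz⟩ :=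
    exists_of_sq_add_add_one_eq (pow_pos (by exact_mod_cast hr.pos) i) h'
  obtain ⟨rfl, rfl⟩ := eq_thirteen_of_three_mul_sq_add_one (b := b.natAbs) (z := z.natAbs) hr hr3
    hk hi (by zify; rw [sq_abs]; exact hb) (by zify; rw [sq_abs]; exact hz)
  have hc : c = 0 := by
    by_contra hc
    have := Nat.pow_le_pow_right (n := 3) (by norm_num) (by omega : 2 ≤ c + 1)
    omega
  subst hc
  refine ⟨?_, rfl, rfl⟩
  have h2 : ((p : ℤ) ^ 3 ^ 0 - 23) * (p ^ 3 ^ 0 + 22) = 0 := by linear_combination h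
  have h3 : (p : ℤ) ^ 3 ^ 0 + 22 ≠ 0 := by positivity
  have := (mul_eq_zero.mp h2).resolve_right h3
  zify
  linarith

/-- The exponents of `r` in `x² + x + 1`, for `x = ±pᵉ`, apart from the solutions of
`x² + x + 1 = 3 y²` and `x = -19`. -/
theorem exponent_of_sq_add_add_one_eq {p e r k ε : ℕ} (hp : p.Prime) (he : e ≠ 0) (hr : r.Prime)
    (hk : k ≠ 0) (hε : ε ≤ 1) {x : ℤ} (hx : x.natAbs = p ^ e)
    (h : x ^ 2 + x + 1 = 3 ^ ε * (r : ℤ) ^ k) :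
    k = 1 ∨ (ε = 1 ∧ Even k) ∨ (x = -19 ∧ r = 7) := by
  have hxa : 2 ≤ x.natAbs := hx ▸ hp.two_le.trans (Nat.le_self_pow he p)
  have hy (i : ℕ) (hi : i ≠ 0) : 1 < (r : ℤ) ^ i := one_lt_pow₀ (by exact_mod_cast hr.one_lt) hi
  rcases (by omega : ε = 0 ∨ ε = 1) with rfl | rfl
  · rw [pow_zero, one_mul] at h
    refine or_iff_not_imp_left.mpr fun hk1 => Or.inr ?_
    obtain ⟨l, hl, i, rfl⟩ := Nat.exists_prime_and_dvd hk1
    have hi : i ≠ 0 := right_ne_zero_of_mul hk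
    rw [mul_comm, pow_mul] at h
    rcases (by have := hl.two_le; omega : l = 2 ∨ l = 3 ∨ l = 4 ∨ 5 ≤ l) with rfl | rfl | rfl | h5
    · exact absurd h (sq_add_add_one_ne_sq (by omega) (by omega))
    · obtain ⟨hx19, h7⟩ := eq_of_sq_add_add_one_eq_cube hp hx (hy i hi) h
      have h7' : r ^ i = 7 := by exact_mod_cast h7
      exact ⟨hx19, (Nat.prime_dvd_prime_iff_eq hr (by norm_num)).mp (h7' ▸ dvd_pow_self r hi)⟩
    · exact absurd hl (by norm_num)
    · exact absurd h (sq_add_add_one_ne_pow hl h5 (hy i hi))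
  · rw [pow_one] at h
    refine or_iff_not_imp_left.mpr fun hk1 => Or.inl ⟨rfl, ?_⟩
    obtain ⟨l, hl, i, rfl⟩ := Nat.exists_prime_and_dvd hk1
    have hi : i ≠ 0 := right_ne_zero_of_mul hk
    rcases (by have := hl.two_le; omega : l = 2 ∨ l = 3 ∨ l = 4 ∨ 5 ≤ l) with rfl | rfl | rfl | h5
    · exact even_two_mul i
    · rw [mul_comm 3 i, pow_mul] at h
      by_cases hx2 : x = -2
      · subst hx2
        have := one_lt_pow₀ (hy i hi) three_ne_zero
        omega
      · exact absurd h (sq_add_add_one_ne_three_mul_cube (by omega) hx2)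
    · exact absurd hl (by norm_num)
    · rw [mul_comm l i, pow_mul] at h
      exact absurd h (sq_add_add_one_ne_three_mul_pow hl h5 (hy i hi))

theorem mem_ppdSet_iff {q n l : ℕ} (hq : 0 < q) (hn : 0 < n) :
    l ∈ ppdSet q n ↔ l.Prime ∧ orderOf (q : ZMod l) = n := by
  have hdvd (i : ℕ) : l ∣ q ^ i - 1 ↔ (q : ZMod l) ^ i = 1 := by
    rw [← ZMod.natCast_eq_zero_iff, Nat.cast_sub (Nat.one_le_pow _ _ hq), sub_eq_zero]
    push_cast
    rfl
  simp only [ppdSet, Set.mem_ofPred_eq, hdvd, orderOf_eq_iff hn]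
  exact and_congr_right fun _ => and_congr_right fun _ =>
    ⟨fun h i hi h0 => h i h0 hi, fun h i h0 hi => h i hi h0⟩

theorem lt_of_mem_ppdSet {q n l : ℕ} (hq : 0 < q) (hn : 0 < n) (h : l ∈ ppdSet q n) : n < l := by
  obtain ⟨hl, ho⟩ := (mem_ppdSet_iff hq hn).mp h
  have := Fact.mk hl
  have h0 : (q : ZMod l) ≠ 0 := by
    intro h0
    have := pow_orderOf_eq_one (q : ZMod l)
    rw [ho, h0, zero_pow hn.ne'] at this
    exact zero_ne_one this
  have := Nat.le_of_dvd (by have := hl.two_le; omega) (ZMod.orderOf_dvd_card_sub_one h0)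
  rw [ho] at this
  omega

theorem ZMod.three_ne_zero_of_prime {l : ℕ} (hl : l.Prime) (hl3 : l ≠ 3) : (3 : ZMod l) ≠ 0 := by
  intro h
  exact hl3 ((Nat.prime_dvd_prime_iff_eq hl Nat.prime_three).mp
    ((ZMod.natCast_eq_zero_iff 3 l).mp (by exact_mod_cast h)))

theorem dvd_of_mem_ppdSet_three {q l : ℕ} (hq : 0 < q) (h : l ∈ ppdSet q 3) :
    (l : ℤ) ∣ (q : ℤ) ^ 2 + q + 1 := by
  obtain ⟨hl, ho⟩ := (mem_ppdSet_iff hq three_pos).mp h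
  have := Fact.mk hl
  rw [orderOf_eq_iff three_pos] at ho
  have h1 := ho.2 1 (by norm_num) one_pos
  rw [pow_one] at h1
  rw [← ZMod.intCast_zmod_eq_zero_iff_dvd]
  push_cast
  apply mul_left_cancel₀ (sub_ne_zero.mpr h1)
  linear_combination ho.1

theorem mem_ppdSet_three {q l : ℕ} (hq : 0 < q) (hl : l.Prime) (hl3 : l ≠ 3)
    (h : (l : ℤ) ∣ (q : ℤ) ^ 2 + q + 1) : l ∈ ppdSet q 3 := by
  have := Fact.mk hl
  have := Fact.mk Nat.prime_three
  rw [← ZMod.intCast_zmod_eq_zero_iff_dvd] at h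
  push_cast at h
  refine (mem_ppdSet_iff hq three_pos).mpr ⟨hl, orderOf_eq_prime ?_ ?_⟩
  · linear_combination ((q : ZMod l) - 1) * h
  · intro h1
    exact ZMod.three_ne_zero_of_prime hl hl3 (by rw [h1] at h; linear_combination h)

theorem dvd_of_mem_ppdSet_six_mul {q m l : ℕ} (hq : 0 < q) (hm : 0 < m)
    (h : l ∈ ppdSet q (m * 6)) : (l : ℤ) ∣ ((q : ℤ) ^ m) ^ 2 - q ^ m + 1 := by
  obtain ⟨hl, ho⟩ := (mem_ppdSet_iff hq (by omega)).mp h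
  have := Fact.mk hl
  rw [orderOf_eq_iff (by omega)] at ho
  have h2 := ho.2 (m * 2) (by omega) (by omega)
  have h3 := ho.2 (m * 3) (by omega) (by omega)
  have h6 := ho.1
  rw [pow_mul] at h2 h3 h6
  rw [← ZMod.intCast_zmod_eq_zero_iff_dvd]
  push_cast
  set t := (q : ZMod l) ^ m
  have h1 : t + 1 ≠ 0 := fun h => h2 (by linear_combination (t - 1) * h)
  apply mul_left_cancel₀ (mul_ne_zero (sub_ne_zero.mpr h3) h1)
  linear_combination h6

theorem ZMod.two_sq_sub_add_one_ne_zero : ∀ t : ZMod 2, t ^ 2 - t + 1 ≠ 0 := by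
  decide

theorem mem_ppdSet_six_mul {q a l : ℕ} (hq : 0 < q) (hl : l.Prime) (hl3 : l ≠ 3)
    (h : (l : ℤ) ∣ ((q : ℤ) ^ 2 ^ a) ^ 2 - q ^ 2 ^ a + 1) : l ∈ ppdSet q (2 ^ a * 6) := by
  have hFact := Fact.mk hl
  rw [← ZMod.intCast_zmod_eq_zero_iff_dvd] at h
  push_cast at h
  have h30 := ZMod.three_ne_zero_of_prime hl hl3
  have hpow (k : ℕ) : (q : ZMod l) ^ (2 ^ a * k) = ((q : ZMod l) ^ 2 ^ a) ^ k := pow_mul _ _ _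
  refine (mem_ppdSet_iff hq (by positivity)).mpr
    ⟨hl, orderOf_eq_of_pow_and_pow_div_prime (by positivity) ?_ ?_⟩
  · rw [hpow]
    generalize (q : ZMod l) ^ 2 ^ a = t at h
    linear_combination (t + 1) * (t ^ 3 - 1) * h
  · intro s hs hsn
    have hs23 : s = 2 ∨ s = 3 := by
      rw [(by ring : 2 ^ a * 6 = 2 ^ (a + 1) * 3), hs.dvd_mul] at hsn
      exact hsn.imp
        (fun h => (Nat.prime_dvd_prime_iff_eq hs Nat.prime_two).mp (hs.dvd_of_dvd_pow h))
        (fun h => (Nat.prime_dvd_prime_iff_eq hs Nat.prime_three).mp h)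
    rcases hs23 with rfl | rfl
    · rw [Nat.mul_div_assoc _ (by norm_num), hpow]
      generalize (q : ZMod l) ^ 2 ^ a = t at h
      intro h1
      have h2 : ((2 : ℕ) : ZMod l) = 0 := by
        push_cast
        linear_combination -h1 + (t + 1) * h
      rw [ZMod.natCast_eq_zero_iff, Nat.prime_dvd_prime_iff_eq hl Nat.prime_two] at h2
      subst h2
      exact ZMod.two_sq_sub_add_one_ne_zero t h
    · rw [Nat.mul_div_assoc _ (by norm_num), hpow]
      generalize (q : ZMod l) ^ 2 ^ a = t at h
      intro h1
      replace h1 : t ^ 2 = 1 := h1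
      exact h30 (by linear_combination (2 + t) * h - (1 + t) * h1)

/-- A number of the form `x² + x + 1` with no prime divisors besides `3` and `r`. -/
theorem exists_eq_three_pow_mul_pow {r : ℕ} (hr : r.Prime) (hr3 : 3 < r) {x : ℤ}
    (hrx : (r : ℤ) ∣ x ^ 2 + x + 1)
    (h : ∀ l : ℕ, l.Prime → l ≠ 3 → (l : ℤ) ∣ x ^ 2 + x + 1 → l = r) :
    ∃ ε k : ℕ, ε ≤ 1 ∧ k ≠ 0 ∧ x ^ 2 + x + 1 = 3 ^ ε * (r : ℤ) ^ k := by
  obtain ⟨N, hN⟩ := Int.eq_ofNat_of_zero_le (by nlinarith [sq_nonneg (2 * x + 1)] :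
    0 ≤ x ^ 2 + x + 1)
  have h9 := not_nine_dvd x
  rw [hN] at h9 hrx ⊢
  simp only [hN, Int.natCast_dvd_natCast] at h hrx
  have hN0 : N ≠ 0 := by
    rintro rfl
    exact h9 (dvd_zero 9)
  obtain ⟨ε, M, hM, hNM⟩ := Nat.exists_eq_pow_mul_and_not_dvd hN0 3 (by norm_num)
  have hMr := Nat.eq_prime_pow_of_unique_prime_dvd (n := M) (p := r)
    (by rintro rfl; exact hM (dvd_zero 3)) fun {d} hd hdM =>
      h d hd (by rintro rfl; exact hM hdM) (hNM ▸ hdM.mul_left _)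
  refine ⟨ε, _, ?_, ?_, by rw [hNM]; push_cast; rw [← Nat.cast_pow, ← hMr]⟩
  · by_contra hε
    apply h9
    have : 3 ^ 2 ∣ N := hNM ▸ (pow_dvd_pow 3 (by omega : 2 ≤ ε)).mul_right M
    exact_mod_cast this
  · intro hk
    rw [hk, pow_zero] at hMr
    rw [hNM, hMr, mul_one] at hrx
    have := Nat.le_of_dvd three_pos (hr.dvd_of_dvd_pow hrx)
    omega

theorem ppdSet_three_eq_singleton {p f r : ℕ} (hp : p.Prime) (hf : 0 < f)
    (h : ppdSet (p ^ f) 3 = {r}) (hlt : r ≤ 12 * f) :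
    p = 2 ∧ (f = 1 ∨ f = 2) ∧ r = 7 := by
  have hq : 0 < p ^ f := pow_pos hp.pos f
  have hrm : r ∈ ppdSet (p ^ f) 3 := h ▸ Set.mem_singleton r
  have hr : r.Prime := hrm.1
  have hr3 : 3 < r := lt_of_mem_ppdSet hq three_pos hrm
  obtain ⟨ε, k, hε, hk, he⟩ := exists_eq_three_pow_mul_pow hr hr3
    (dvd_of_mem_ppdSet_three hq hrm) fun l hl hl3 hd =>
      (h ▸ mem_ppdSet_three hq hl hl3 hd : l ∈ ({r} : Set ℕ))
  rcases exponent_of_sq_add_add_one_eq hp hf.ne' hr hk hε (Int.natAbs_natCast _) he with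
    rfl | ⟨rfl, i, rfl⟩ | ⟨hx, -⟩
  · have he' : (p ^ f) ^ 2 + p ^ f + 1 = 3 ^ ε * r := by exact_mod_cast (pow_one (r : ℤ) ▸ he)
    have h2 : 2 ^ f ≤ p ^ f := Nat.pow_le_pow_left hp.two_le f
    have hN : (p ^ f) ^ 2 + p ^ f + 1 ≤ 36 * f := by
      rw [he']
      have : 3 ^ ε ≤ 3 ^ 1 := Nat.pow_le_pow_right three_pos hε
      nlinarith
    have hf5 : f ≤ 5 := by
      by_contra! hf6
      have : f < 2 ^ f := f.lt_two_pow_self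
      have h64 : 2 ^ 6 ≤ 2 ^ f := Nat.pow_le_pow_right two_pos hf6
      nlinarith
    have hp13 : p ≤ 13 := by
      have := Nat.le_self_pow hf.ne' p
      nlinarith
    have h3 : ¬ 3 ∣ r := fun h => hr3.ne ((Nat.prime_dvd_prime_iff_eq Nat.prime_three hr).mp h)
    clear h2 he hrm h hq
    interval_cases f <;> interval_cases ε <;> interval_cases p <;>
      first | omega | (revert hp; norm_num)
  · obtain ⟨c, hc, hd⟩ := exists_eq_three_pow hp hf.ne' hr hr3 (by omega : i ≠ 0) (.inl rfl)
      (σ := 1) (by rw [← pow_mul, mul_two]; simpa using he)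
    have := Nat.le_of_dvd (by omega) hd
    rw [pow_succ, ← hc] at this
    omega
  · have : (0 : ℤ) ≤ ((p ^ f : ℕ) : ℤ) := Int.natCast_nonneg _
    omega

theorem ppdSet_two_pow_mul_six_eq_singleton {p f b r : ℕ} (hp : p.Prime) (hf : 0 < f)
    (h : ppdSet (p ^ f) (2 ^ b * 6) = {r}) (hlt : r ≤ 24 * (f * 2 ^ b)) :
    f * 2 ^ b = 1 ∧ (p = 3 ∧ r = 7 ∨ p = 5 ∧ r = 7 ∨ p = 19 ∧ r = 7 ∨ p = 23 ∧ r = 13) ∨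
      f * 2 ^ b = 2 ∧ p = 2 ∧ r = 13 ∨ f * 2 ^ b = 3 ∧ p = 2 ∧ r = 19 := by
  have hq : 0 < p ^ f := pow_pos hp.pos f
  have hrm : r ∈ ppdSet (p ^ f) (2 ^ b * 6) := h ▸ Set.mem_singleton r
  have hr : r.Prime := hrm.1
  have hb : 0 < 2 ^ b := by positivity
  have hr3 : 3 < r := by
    have := lt_of_mem_ppdSet hq (by positivity) hrm
    omega
  have hcast : ((p ^ f : ℕ) : ℤ) ^ 2 ^ b = (p : ℤ) ^ (f * 2 ^ b) := by push_cast; rw [pow_mul]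
  have hd := dvd_of_mem_ppdSet_six_mul hq hb hrm
  have hmem (l : ℕ) (hl : l.Prime) (hl3 : l ≠ 3) := mem_ppdSet_six_mul (a := b) hq hl hl3
  rw [h] at hmem
  rw [hcast] at hd hmem
  have hg : 0 < f * 2 ^ b := by positivity
  generalize f * 2 ^ b = g at *
  have hneg : ((p : ℤ) ^ g) ^ 2 - p ^ g + 1 = (-(p : ℤ) ^ g) ^ 2 + -(p : ℤ) ^ g + 1 := by ring
  obtain ⟨ε, k, hε, hk, he⟩ := exists_eq_three_pow_mul_pow hr hr3 (hneg ▸ hd)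
    fun l hl hl3 hd => hmem l hl hl3 (hneg ▸ hd)
  have habs : (-(p : ℤ) ^ g).natAbs = p ^ g := by simp [Int.natAbs_pow]
  rcases exponent_of_sq_add_add_one_eq hp hg.ne' hr hk hε habs he with
    rfl | ⟨rfl, i, rfl⟩ | ⟨hx, rfl⟩
  · rw [← hneg, pow_one] at he
    have he' : (p ^ g) ^ 2 + 1 = 3 ^ ε * r + p ^ g := by zify; linarith
    have h2 : 2 ^ g ≤ p ^ g := Nat.pow_le_pow_left hp.two_le g
    have hN : (p ^ g) ^ 2 + 1 ≤ 72 * g + p ^ g := by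
      rw [he']
      have : 3 ^ ε ≤ 3 ^ 1 := Nat.pow_le_pow_right three_pos hε
      nlinarith
    have hg4 : g ≤ 6 := by
      by_contra! hg7
      have : g < 2 ^ g := g.lt_two_pow_self
      have h128 : 2 ^ 7 ≤ 2 ^ g := Nat.pow_le_pow_right two_pos hg7
      nlinarith
    have hp21 : p ≤ 21 := by
      have := Nat.le_self_pow hg.ne' p
      nlinarith
    have h3 : ¬ 3 ∣ r := fun h => hr3.ne ((Nat.prime_dvd_prime_iff_eq Nat.prime_three hr).mp h)
    clear h2 habs hneg he hd hmem hrm h hq hcast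
    interval_cases g <;> interval_cases ε <;> interval_cases p <;>
      first | omega | (revert hp; norm_num)
  · left
    obtain ⟨hpg, rfl, rfl⟩ := eq_of_sq_add_add_one_eq_three_mul_sq hp hg.ne' hr hr3
      (by omega : i ≠ 0) hlt (by rw [hneg, ← pow_mul, mul_two]; simpa using he)
    rw [pow_one] at hpg
    simp [hpg]
  · left
    have hpg : p ^ g = 19 := by rw [← habs, hx]; rfl
    obtain ⟨rfl, rfl⟩ := (Nat.Prime.pow_eq_iff (by norm_num)).mp hpg
    simp

/-- Lemma 2.9: if `n = 2^a · 3` (`a ≥ 0`), `q = p^f` a prime power, and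
`q^n - 1` has a unique primitive prime divisor `r`, then `r ≥ 4nf + 1` or
one of the listed exceptions holds. -/
theorem stmt10 (a p f n q r : ℕ) (hn : n = 2 ^ a * 3) (hp : p.Prime)
    (hf : 0 < f) (hq : q = p ^ f) (h : ppdSet q n = {r}) :
    4 * n * f + 1 ≤ r ∨
    (((n, q) = (3, 4) ∨ (n, q) = (6, 3) ∨ (n, q) = (6, 4) ∨ (n, q) = (6, 5) ∨
        (n, q) = (6, 8) ∨ (n, q) = (6, 19) ∨ (n, q) = (12, 2)) ∧ r = n * f + 1) ∨
    (((n, q) = (3, 2) ∨ (n, q) = (6, 23)) ∧ r = 2 * n * f + 1) := by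
  refine or_iff_not_imp_left.mpr fun hr => ?_
  replace hr : r ≤ 4 * (n * f) := by rw [← mul_assoc]; omega
  subst hn hq
  cases a with
  | zero =>
    obtain ⟨rfl, rfl | rfl, rfl⟩ := ppdSet_three_eq_singleton hp hf h (by omega) <;> simp
  | succ b =>
    have hn : 2 ^ (b + 1) * 3 = 2 ^ b * 6 := by ring
    rw [hn] at h hr ⊢
    rcases ppdSet_two_pow_mul_six_eq_singleton hp hf h (by linarith) with
      ⟨hg, hpr⟩ | ⟨hg, rfl, rfl⟩ | ⟨hg, rfl, rfl⟩
    · obtain ⟨rfl, hb⟩ := mul_eq_one.mp hg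
      rw [hb]
      rcases hpr with ⟨rfl, rfl⟩ | ⟨rfl, rfl⟩ | ⟨rfl, rfl⟩ | ⟨rfl, rfl⟩ <;> simp
    · have hb : b ≤ 1 := by
        by_contra! hb
        have := Nat.pow_le_pow_right two_pos hb
        nlinarith
      interval_cases b
      · obtain rfl : f = 2 := by omega
        simp
      · obtain rfl : f = 1 := by omega
        simp
    · have hb : b = 0 := by
        by_contra! hb
        have := (dvd_pow_self 2 hb).mul_left f
        omega
      subst hb
      obtain rfl : f = 3 := by omega
      simp
end

section
/- Let n ≥ 5 be an odd prime and let q = 2^f for some positive integer f. If q^{2n} - 1 has exactly one primitive prime divisor r (i.e., P_q^{2n} = {r}), then either r ≥ 4nf + 1, or r = 2nf + 1 and one of the following holds: (i) (n,q) = (5,2); (ii) n divides q + 1. Moreover, if P_q^{2n} = {r} then f = 2^a · n^b for some integers a, b ≥ 0. -/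
theorem natCast_zmod_pow_eq_one_iff {a : ℕ} (ha : 0 < a) (r i : ℕ) :
    (a : ZMod r) ^ i = 1 ↔ r ∣ a ^ i - 1 := by
  rw [← ZMod.natCast_eq_zero_iff, Nat.cast_sub (Nat.one_le_pow _ _ ha), sub_eq_zero]
  push_cast
  rfl

theorem mem_ppdSet_iff_orderOf {a N : ℕ} (ha : 0 < a) (hN : 0 < N) (r : ℕ) :
    r ∈ ppdSet a N ↔ r.Prime ∧ orderOf (a : ZMod r) = N := by
  rw [orderOf_eq_iff hN]
  simp only [ppdSet, Set.mem_ofPred_eq, ne_eq, natCast_zmod_pow_eq_one_iff ha]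
  exact and_congr_right fun _ => and_congr_right fun _ =>
    ⟨fun h m hm h0 => h m h0 hm, fun h m h0 hm => h m hm h0⟩

theorem natCast_zmod_pow_eq_neg_one_iff (a r i : ℕ) :
    (a : ZMod r) ^ i = -1 ↔ r ∣ a ^ i + 1 := by
  rw [← ZMod.natCast_eq_zero_iff, eq_neg_iff_add_eq_zero]
  push_cast
  rfl

theorem mem_ppdSet_of_dvd_pow_add_one {q n s : ℕ} (hn : n.Prime) (hodd : Odd n) (hq : 0 < q)
    (hqe : Even q) (hs : s.Prime) (h : s ∣ q ^ n + 1) (h' : ¬ s ∣ q + 1) :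
    s ∈ ppdSet q (2 * n) := by
  refine (mem_ppdSet_iff_orderOf hq (by have := hn.pos; omega) s).2 ⟨hs, ?_⟩
  have := Fact.mk hs
  have hs2 : s ≠ 2 := by
    rintro rfl
    have : Odd (q ^ n + 1) := (hqe.pow_of_ne_zero hn.ne_zero).add_one
    exact (Nat.not_even_iff_odd.2 this) (even_iff_two_dvd.2 h)
  have : Fact (2 < s) := ⟨lt_of_le_of_ne hs.two_le hs2.symm⟩
  have hneg : (q : ZMod s) ^ n = -1 := (natCast_zmod_pow_eq_neg_one_iff q s n).2 h
  have hneg1 : (q : ZMod s) ≠ -1 := fun e => h' <| by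
    simpa using (natCast_zmod_pow_eq_neg_one_iff q s 1).1 (by simpa using e)
  have hdvd : orderOf (q : ZMod s) ∣ 2 * n := orderOf_dvd_of_pow_eq_one (by
    rw [mul_comm, pow_mul, hneg]; norm_num)
  have hnd : ¬ orderOf (q : ZMod s) ∣ n := fun e => by
    rw [orderOf_dvd_iff_pow_eq_one, hneg] at e
    exact ZMod.neg_one_ne_one e
  have hnd2 : ¬ orderOf (q : ZMod s) ∣ 2 := fun e => by
    rw [orderOf_dvd_iff_pow_eq_one] at e
    obtain ⟨m, rfl⟩ := hodd
    rw [pow_succ, pow_mul, e, one_pow, one_mul] at hneg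
    exact hneg1 hneg
  obtain ⟨x, y, hx, hy, hxy⟩ := Nat.dvd_mul.1 hdvd
  rcases (Nat.dvd_prime Nat.prime_two).1 hx with rfl | rfl
  · exact absurd (by rw [← hxy, one_mul]; exact hy) hnd
  · rcases (Nat.dvd_prime hn).1 hy with rfl | rfl
    · exact absurd (by rw [← hxy]) hnd2
    · exact hxy.symm

/-- Solutions of `e u² + 1 = (e s² + 1) y²` satisfy `u = s c` with `c` odd. -/
theorem exists_odd_mul_of_pell {e s : ℤ} (he : 0 < e) (hs : 0 < s) (N : ℕ) :
    ∀ u y : ℤ, 0 < y → y ≤ N → e * u ^ 2 + 1 = (e * s ^ 2 + 1) * y ^ 2 →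
      ∃ c : ℤ, Odd c ∧ u = s * c := by
  induction N with
  | zero => intro u y h0 h1; simp at h1; omega
  | succ N ih =>
    intro u y hy hyN h
    wlog hu : 0 ≤ u generalizing u
    · obtain ⟨c, hc, hc'⟩ := this (-u) (by simpa using h) (by omega)
      exact ⟨-c, hc.neg, by linarith⟩
    rcases eq_or_lt_of_le (show 1 ≤ y from hy) with rfl | hy1
    · refine ⟨1, odd_one, ?_⟩
      have : u ^ 2 = s ^ 2 := mul_left_cancel₀ he.ne' (by linarith)
      have := (sq_eq_sq₀ hu hs.le).1 this
      omega
    have hes : 0 < e * s := mul_pos he hs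
    have hlt : s * y < u := by
      refine lt_of_pow_lt_pow_left₀ 2 hu ?_
      have : e * (s * y) ^ 2 < e * u ^ 2 := by nlinarith
      exact lt_of_mul_lt_mul_left this he.le
    have hpos : 2 * s * e * u < (2 * e * s ^ 2 + 1) * y := by
      refine lt_of_pow_lt_pow_left₀ 2 (by positivity) ?_
      have : (2 * s * e * u) ^ 2 = 4 * e * s ^ 2 * ((e * s ^ 2 + 1) * y ^ 2 - 1) := by
        rw [← h]; ring
      rw [this]
      have : 0 < e * s ^ 2 := by positivity
      nlinarith [pow_pos hy 2]
    obtain ⟨c, hc, hc'⟩ := ih ((2 * e * s ^ 2 + 1) * u - 2 * s * (e * s ^ 2 + 1) * y)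
      ((2 * e * s ^ 2 + 1) * y - 2 * s * e * u) (by linarith)
      (by push_cast at hyN; nlinarith [mul_lt_mul_of_pos_left hlt hes]) (by linear_combination h)
    have key : u = s * (c + 2 * (e * s ^ 2 + 1) * y - 2 * e * s * u) := by linear_combination hc'
    refine ⟨_, ?_, key⟩
    obtain ⟨d, rfl⟩ := hc
    exact ⟨d + (e * s ^ 2 + 1) * y - e * s * u, by ring⟩

theorem two_pow_pow_add_one_ne_mul_sq {f n : ℕ} (hf : 0 < f) (hn : 1 < n) (hodd : Odd n) (y : ℕ) :
    (2 ^ f) ^ n + 1 ≠ (2 ^ f + 1) * y ^ 2 := by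
  intro h
  obtain ⟨m, rfl⟩ := hodd
  obtain ⟨e, g, he, hfg⟩ : ∃ e g : ℕ, 0 < e ∧ 2 ^ f = e * (2 ^ g) ^ 2 := by
    rcases Nat.even_or_odd' f with ⟨g, rfl | rfl⟩
    · exact ⟨1, g, one_pos, by ring⟩
    · exact ⟨2, g, two_pos, by ring⟩
  have hy : 0 < y := by
    rcases Nat.eq_zero_or_pos y with rfl | hy
    · simp at h
    · exact hy
  have h' : (e : ℤ) * ((2 : ℤ) ^ g * (2 ^ f) ^ m) ^ 2 + 1 = (e * ((2 : ℤ) ^ g) ^ 2 + 1) * y ^ 2 := by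
    have hfg' : ((2 : ℤ) ^ f) = e * (2 ^ g) ^ 2 := by exact_mod_cast hfg
    have h2 : ((2 : ℤ) ^ f) ^ (2 * m + 1) + 1 = (2 ^ f + 1) * y ^ 2 := by exact_mod_cast h
    rw [← hfg', ← h2]
    linear_combination (-((2 : ℤ) ^ f) ^ (2 * m)) * hfg'
  obtain ⟨c, hc, hc'⟩ := exists_odd_mul_of_pell (by exact_mod_cast he) (by positivity) y _ _
    (by exact_mod_cast hy) le_rfl h'
  have := mul_left_cancel₀ (by positivity) hc'
  rw [← this, ← pow_mul, Int.odd_pow' (by have : m ≠ 0 := by omega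
                                          positivity)] at hc
  exact absurd hc (by decide)

theorem pow_add_one_factorization_of_dvd {x k s : ℕ} (hs : s.Prime) (hk : Odd k) (hx : Even x)
    (h : s ∣ x + 1) :
    (x ^ k + 1).factorization s = (x + 1).factorization s + k.factorization s := by
  have := Fact.mk hs
  have hs1 : Odd s := (hx.add_one).of_dvd_nat h
  have := padicValNat.pow_add_pow (x := x) (y := 1) hs1 h (fun hx' => hs.one_lt.ne'
    (Nat.dvd_one.1 ((Nat.dvd_add_right hx').1 h))) hk
  simpa [Nat.factorization_def _ hs] using this

theorem three_mul_le_two_pow_pred {n : ℕ} (hn : 5 ≤ n) : 3 * n ≤ 2 ^ (n - 1) := by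
  induction n, hn using Nat.le_induction with
  | base => norm_num
  | succ k hk ih =>
    obtain ⟨j, rfl⟩ : ∃ j, k = j + 1 := ⟨k - 1, by omega⟩
    simp only [Nat.add_sub_cancel] at *
    rw [pow_succ]
    omega

theorem exists_prime_dvd_pow_add_one {x n : ℕ} (hn5 : 5 ≤ n) (hodd : Odd n)
    (hx : Even x) (hx2 : 2 ≤ x) : ∃ s, s.Prime ∧ s ∣ x ^ n + 1 ∧ ¬ s ∣ x + 1 := by
  by_contra! hcon
  have hd : x ^ n + 1 ∣ (x + 1) * n := by
    refine (Nat.factorization_prime_le_iff_dvd (by positivity) (by positivity)).1 fun s hs => ?_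
    by_cases h : s ∣ x ^ n + 1
    · rw [pow_add_one_factorization_of_dvd hs hodd hx (hcon s hs h),
        Nat.factorization_mul (by positivity) (by positivity)]
      rfl
    · rw [Nat.factorization_eq_zero_of_not_dvd h]; exact Nat.zero_le _
  have hle := Nat.le_of_dvd (by positivity) hd
  have h1 := three_mul_le_two_pow_pred hn5
  have h2 : 2 ^ (n - 1) ≤ x ^ (n - 1) := Nat.pow_le_pow_left hx2 _
  have h3 : x ^ n = x ^ (n - 1) * x := by rw [← pow_succ]; congr 1; omega
  have h4 : 2 * n * x ≤ x ^ (n - 1) * x := Nat.mul_le_mul_right _ (by omega)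
  nlinarith

theorem mul_lt_pow_mul_add_one {n p x : ℕ} (hn : 5 ≤ n) (hp : 3 ≤ p) (hx : 2 ≤ x) :
    n * p * ((x ^ p + 1) * (x ^ n + 1)) < (x ^ p) ^ n + 1 := by
  have h1 := three_mul_le_two_pow_pred hn
  have h2 : p ≤ 2 ^ (p - 1) := by
    have := Nat.lt_two_pow_self (n := p - 1)
    omega
  obtain ⟨N, rfl⟩ : ∃ N, n = N + 5 := ⟨n - 5, by omega⟩
  obtain ⟨P, rfl⟩ : ∃ P, p = P + 3 := ⟨p - 3, by omega⟩
  obtain ⟨t, ht⟩ : ∃ t, (P + 3) * (N + 5) =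
      (P + 3) + (N + 5) + ((N + 5 - 1) + (P + 3 - 1) + 1 + t) :=
    ⟨(P + 3) * (N + 5) - ((P + 3) + (N + 5) + ((N + 5 - 1) + (P + 3 - 1) + 1)), by
      have : (P + 3) * (N + 5) = P * N + 5 * P + 3 * N + 15 := by ring
      have := Nat.zero_le (P * N)
      omega⟩
  generalize N + 5 = n at *
  generalize P + 3 = p at *
  have h3 : 2 ^ ((n - 1) + (p - 1) + 1 + t) ≤ x ^ ((n - 1) + (p - 1) + 1 + t) :=
    Nat.pow_le_pow_left hx _
  have h4 : 4 * (n * p) ≤ 2 ^ ((n - 1) + (p - 1) + 1 + t) := by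
    calc 4 * (n * p) ≤ 2 * ((3 * n) * p) := by nlinarith [Nat.zero_le (n * p)]
      _ ≤ 2 * (2 ^ (n - 1) * 2 ^ (p - 1)) := Nat.mul_le_mul_left _ (Nat.mul_le_mul h1 h2)
      _ = 2 ^ ((n - 1) + (p - 1) + 1) := by ring
      _ ≤ _ := Nat.pow_le_pow_right two_pos (by omega)
  rw [← pow_mul, ht, pow_add, pow_add x p n, Nat.lt_succ_iff]
  have hp1 : x ^ p + 1 ≤ 2 * x ^ p := by have := Nat.one_le_pow p x (by omega); omega
  have hn1 : x ^ n + 1 ≤ 2 * x ^ n := by have := Nat.one_le_pow n x (by omega); omega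
  calc n * p * ((x ^ p + 1) * (x ^ n + 1)) ≤ n * p * ((2 * x ^ p) * (2 * x ^ n)) :=
        Nat.mul_le_mul_left _ (Nat.mul_le_mul hp1 hn1)
    _ = x ^ p * x ^ n * (4 * (n * p)) := by ring
    _ ≤ _ := Nat.mul_le_mul_left _ (h4.trans h3)

theorem eq_two_or_eq_of_prime_dvd_exponent {n f r p : ℕ} (hn : n.Prime) (hn5 : 5 ≤ n)
    (hodd : Odd n) (hf : 0 < f) (h : ppdSet (2 ^ f) (2 * n) = {r}) (hp : p.Prime) (hpf : p ∣ f) :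
    p = 2 ∨ p = n := by
  by_contra! hcon
  obtain ⟨hp2, hpn⟩ := hcon
  obtain ⟨g, rfl⟩ := hpf
  have hg : g ≠ 0 := by rintro rfl; simp at hf
  have hpodd : Odd p := hp.odd_of_ne_two hp2
  have hq : 2 ^ (p * g) = (2 ^ g) ^ p := by rw [← pow_mul, mul_comm]
  rw [hq] at h
  have hx : Even (2 ^ g) := even_two.pow_of_ne_zero hg
  have hx2 : 2 ≤ 2 ^ g := Nat.le_self_pow hg 2
  generalize 2 ^ g = x at *
  have hq0 : 0 < x ^ p := by positivity
  have hqe : Even (x ^ p) := hx.pow_of_ne_zero hp.ne_zero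
  have hmem {s : ℕ} (hs : s.Prime) (h1 : s ∣ (x ^ p) ^ n + 1) (h2 : ¬ s ∣ x ^ p + 1) : s = r := by
    have := mem_ppdSet_of_dvd_pow_add_one hn hodd hq0 hqe hs h1 h2
    rwa [h] at this
  have hdvd : x ^ n + 1 ∣ (x ^ p) ^ n + 1 := by
    have := hpodd.nat_add_dvd_pow_add_pow (x ^ n) 1
    rwa [one_pow, ← pow_mul, mul_comm, pow_mul] at this
  have hr : r ∣ x ^ n + 1 := by
    obtain ⟨s, hs, hs1, hs2⟩ := exists_prime_dvd_pow_add_one hn5 hodd hx hx2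
    suffices hsp : ¬ s ∣ x ^ p + 1 from hmem hs (hs1.trans hdvd) hsp ▸ hs1
    intro hsp
    have hord := mem_ppdSet_of_dvd_pow_add_one hn hodd (by omega) hx hs hs1 hs2
    rw [mem_ppdSet_iff_orderOf (by omega) (by omega)] at hord
    have h2p : orderOf (x : ZMod s) ∣ p * 2 := orderOf_dvd_of_pow_eq_one (by
      rw [pow_mul, (natCast_zmod_pow_eq_neg_one_iff x s p).2 hsp]; norm_num)
    rw [hord.2, mul_comm, Nat.mul_dvd_mul_iff_right two_pos] at h2p
    exact hpn ((Nat.prime_dvd_prime_iff_eq hn hp).1 h2p).symm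
  have hd : (x ^ p) ^ n + 1 ∣ n * p * ((x ^ p + 1) * (x ^ n + 1)) := by
    have := hn.ne_zero
    have := hp.ne_zero
    refine (Nat.factorization_prime_le_iff_dvd (by positivity) (by positivity)).1 fun s hs => ?_
    rw [Nat.factorization_mul (by positivity) (by positivity),
      Nat.factorization_mul (by positivity) (by positivity),
      Nat.factorization_mul (by positivity) (by positivity)]
    simp only [Finsupp.add_apply]
    by_cases h1 : s ∣ (x ^ p) ^ n + 1
    · by_cases h2 : s ∣ x ^ p + 1
      · rw [pow_add_one_factorization_of_dvd hs hodd hqe h2]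
        omega
      · obtain rfl := hmem hs h1 h2
        rw [← pow_mul, mul_comm p n, pow_mul, pow_add_one_factorization_of_dvd hs hpodd
          (hx.pow_of_ne_zero hn.ne_zero) hr]
        omega
    · rw [Nat.factorization_eq_zero_of_not_dvd h1]; exact Nat.zero_le _
  have h3 : 3 ≤ p := by have := hp.two_le; omega
  exact absurd (Nat.le_of_dvd (by positivity) hd) (not_le.2 (mul_lt_pow_mul_add_one hn5 h3 hx2))

theorem exists_eq_pow_mul_pow_of_prime_dvd {u v f : ℕ} (hf : 0 < f)
    (h : ∀ p : ℕ, p.Prime → p ∣ f → p = u ∨ p = v) : ∃ a b : ℕ, f = u ^ a * v ^ b := by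
  induction f using Nat.strong_induction_on with
  | _ f ih =>
    rcases eq_or_ne f 1 with rfl | hf1
    · exact ⟨0, 0, by simp⟩
    · obtain ⟨p, hp, g, rfl⟩ := Nat.exists_prime_and_dvd hf1
      have hg : 0 < g := Nat.pos_of_mul_pos_left hf
      obtain ⟨a, b, hab⟩ := ih g (by have := hp.two_le; nlinarith) hg
        fun s hs hsg => h s hs (hsg.mul_left p)
      rcases h p hp (dvd_mul_right p g) with rfl | rfl
      · exact ⟨a + 1, b, by rw [hab]; ring⟩
      · exact ⟨a, b + 1, by rw [hab]; ring⟩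

/-- If every prime factor of `f` divides `N` and `x ^ f` has order `N`, then `x` has order
`N * f`. -/
theorem orderOf_eq_mul_of_orderOf_pow {G : Type*} [Monoid G] {x : G} {f N : ℕ} (hf : 0 < f)
    (hx : orderOf (x ^ f) = N) (h : ∀ p : ℕ, p.Prime → p ∣ f → p ∣ N) :
    orderOf x = N * f := by
  rw [orderOf_pow' x hf.ne'] at hx
  set m := orderOf x with hm
  have hg : 0 < Nat.gcd m f := Nat.gcd_pos_of_pos_right _ hf
  have hmN : m = N * Nat.gcd m f := by
    rw [← hx, Nat.div_mul_cancel (Nat.gcd_dvd_left _ _)]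
  suffices Nat.gcd m f = f by rw [this] at hmN; exact hmN
  obtain ⟨c, hc⟩ := Nat.gcd_dvd_right m f
  by_contra hne
  have hc1 : c ≠ 1 := by rintro rfl; rw [mul_one] at hc; exact hne hc.symm
  obtain ⟨p, hp, hpc⟩ := Nat.exists_prime_and_dvd hc1
  have hpN : p ∣ N := h p hp (hc ▸ hpc.mul_left _)
  have h1 : p * Nat.gcd m f ∣ m := by
    conv_rhs => rw [hmN]
    exact Nat.mul_dvd_mul_right hpN _
  have h2 : p * Nat.gcd m f ∣ f := by
    conv_rhs => rw [hc, mul_comm]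
    exact Nat.mul_dvd_mul_right hpc _
  have := Nat.le_of_dvd hg (Nat.dvd_gcd h1 h2)
  nlinarith [hp.two_le]

theorem exists_pow_add_one_eq_mul_prime_pow {n q r : ℕ} (hn : n.Prime) (hodd : Odd n)
    (hq : 0 < q) (hqe : Even q) (h : ppdSet q (2 * n) = {r}) (hnq : ¬ n ∣ q + 1) :
    ∃ k, q ^ n + 1 = (q + 1) * r ^ k := by
  obtain ⟨B, hB⟩ : q + 1 ∣ q ^ n + 1 := by simpa using hodd.nat_add_dvd_pow_add_pow q 1
  have hB0 : B ≠ 0 := by rintro rfl; simp at hB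
  refine ⟨_, hB.trans (congrArg _ (Nat.eq_prime_pow_of_unique_prime_dvd hB0 (p := r) ?_))⟩
  intro s hs hsB
  have hs1 : s ∣ q ^ n + 1 := hB ▸ hsB.mul_left _
  by_cases h2 : s ∣ q + 1
  · have h3 := pow_add_one_factorization_of_dvd hs hodd hqe h2
    have hsn : n.factorization s = 0 := Nat.factorization_eq_zero_of_not_dvd fun e => hnq
      ((Nat.prime_dvd_prime_iff_eq hs hn).1 e ▸ h2)
    rw [hB, Nat.factorization_mul (by positivity) hB0, Finsupp.add_apply, hsn] at h3
    have := hs.factorization_pos_of_dvd hB0 hsB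
    omega
  · have := mem_ppdSet_of_dvd_pow_add_one hn hodd hq hqe hs hs1 h2
    rwa [h] at this

theorem le_two_of_mul_odd_pow_eq {n f r k : ℕ} (hodd : Odd n) (hf : 0 < f)
    (hn : n ≠ 0) (hr : r = 2 * n * f + 1)
    (hk : Odd k) (h : (2 ^ f) ^ n + 1 = (2 ^ f + 1) * r ^ k) : f ≤ 2 := by
  have h1 : (2 : ℤ) ^ f ∣ (r : ℤ) ^ k - 1 := by
    have hz : ((2 : ℤ) ^ f) ^ n + 1 = (2 ^ f + 1) * (r : ℤ) ^ k := by exact_mod_cast h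
    have : (2 : ℤ) ^ f ∣ (2 ^ f) ^ n := dvd_pow_self _ hn
    have e : (r : ℤ) ^ k - 1 = (2 ^ f) ^ n - 2 ^ f * (r : ℤ) ^ k := by linear_combination -hz
    rw [e]
    exact dvd_sub this (dvd_mul_right _ _)
  have hrodd : Odd r := by
    rw [hr]; exact ⟨n * f, by ring⟩
  have hsum : Odd (∑ i ∈ Finset.range k, (r : ℤ) ^ i) := by
    have : Odd (∑ i ∈ Finset.range k, r ^ i) := by
      rw [Finset.odd_sum_iff_odd_card_odd]
      simpa [hrodd.pow] using hk
    exact_mod_cast this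
  rw [← geom_sum_mul] at h1
  have h2 : (2 : ℤ) ^ f ∣ (r : ℤ) - 1 :=
    (IsCoprime.pow_left (Int.isCoprime_two_left.2 hsum)).dvd_of_dvd_mul_left h1
  have h3 : 2 ^ f ∣ 2 * f := by
    have h4 : (2 : ℤ) ^ f ∣ (n : ℤ) * (2 * f) := by
      convert h2 using 1; rw [hr]; push_cast; ring
    have h5 : 2 ^ f ∣ n * (2 * f) := by exact_mod_cast h4
    exact (Nat.Coprime.pow_left f (Nat.coprime_two_left.2 hodd)).dvd_of_dvd_mul_left h5
  have h6 := Nat.le_of_dvd (by omega) h3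
  by_contra! hlt
  have : ∀ m, 2 * (m + 3) < 2 ^ (m + 3) := fun m => by
    induction m with
    | zero => norm_num
    | succ m ih => rw [show m + 1 + 3 = (m + 3) + 1 by ring, pow_succ]; omega
  have := this (f - 3)
  rw [Nat.sub_add_cancel hlt] at this
  omega

theorem four_pow_add_one_ne_five_mul_prime_pow {n r : ℕ} (hn5 : 5 ≤ n) (hodd : Odd n)
    (hr : r.Prime) (hr2 : r ≠ 2) (k : ℕ) : 4 ^ n + 1 ≠ 5 * r ^ k := by
  intro h
  obtain ⟨m, rfl⟩ := hodd
  have hm : 4 ≤ 2 ^ m := by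
    calc 4 = 2 ^ 2 := rfl
      _ ≤ 2 ^ m := Nat.pow_le_pow_right two_pos (by omega)
  obtain ⟨u, hu⟩ : ∃ u, 2 * 2 ^ m * 2 ^ m + 1 = u + 2 * 2 ^ m :=
    ⟨2 * 2 ^ m * 2 ^ m + 1 - 2 * 2 ^ m, by
      have : 2 * 2 ^ m ≤ 2 * 2 ^ m * 2 ^ m := Nat.le_mul_of_pos_right _ (by positivity)
      omega⟩
  have hu5 : 5 < u := by nlinarith
  have huv : u * (u + 2 ^ (m + 2)) = 5 * r ^ k := by
    rw [← h, show 4 = 2 ^ 2 by rfl, ← pow_mul, show 2 * (2 * m + 1) = m + m + m + m + 2 by ring]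
    simp only [pow_add]
    zify at hu ⊢
    have : (u : ℤ) = 2 * 2 ^ m * 2 ^ m + 1 - 2 * 2 ^ m := by linarith
    rw [this]; ring
  have key : ∀ w, 5 < w → w ∣ 5 * r ^ k → r ∣ w := fun w hw hwd => by
    by_contra hrw
    have : w ∣ 5 :=
      (Nat.Coprime.pow_right k ((Nat.Prime.coprime_iff_not_dvd hr).2 hrw).symm).dvd_of_dvd_mul_right
        hwd
    exact absurd (Nat.le_of_dvd (by norm_num) this) (by omega)
  have h1 : r ∣ u := key u hu5 (huv ▸ dvd_mul_right _ _)
  have h2 : r ∣ u + 2 ^ (m + 2) :=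
    key _ (hu5.trans_le (Nat.le_add_right _ _)) (huv ▸ dvd_mul_left _ _)
  have h3 := hr.dvd_of_dvd_pow ((Nat.dvd_add_right h1).1 h2)
  exact hr2 ((Nat.prime_dvd_prime_iff_eq hr Nat.prime_two).1 h3)

theorem eq_five_of_two_pow_add_one_eq {n k : ℕ} (hn : n.Prime) (hn5 : 5 ≤ n) (hodd : Odd n)
    (hk : Odd k) (h : 2 ^ n + 1 = 3 * (2 * n + 1) ^ k) : n = 5 := by
  obtain ⟨j, rfl⟩ := hk
  have h8 : (2 * n + 1) ^ (2 * j) % 8 = 1 := by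
    have : (2 * n + 1) ^ 2 % 8 = 1 := by
      obtain ⟨m, rfl⟩ := hodd
      have := Nat.even_mul_succ_self m
      obtain ⟨c, hc⟩ := Nat.even_mul_succ_self (2 * m + 1)
      rw [show (2 * (2 * m + 1) + 1) ^ 2 = 4 * ((2 * m + 1) * (2 * m + 1 + 1)) + 1 by ring, hc]
      omega
    rw [pow_mul, Nat.pow_mod, this]; simp
  have hn4 : n % 4 = 1 := by
    have h1 : 2 ^ n % 8 = 0 := Nat.mod_eq_zero_of_dvd (pow_dvd_pow 2 (by omega : 3 ≤ n))
    have h2 : (2 * n + 1) ^ (2 * j + 1) % 8 = (2 * n + 1) % 8 := by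
      rw [pow_succ, Nat.mul_mod, h8]; simp
    omega
  have h5 : (2 * n + 1) ^ (2 * j + 1) % 5 = 1 := by
    have h1 : 2 ^ n % 5 = 2 := by
      obtain ⟨c, rfl⟩ : ∃ c, n = 4 * c + 1 := ⟨n / 4, by omega⟩
      rw [pow_succ, pow_mul, Nat.mul_mod, Nat.pow_mod]; simp
    omega
  have hr5 : (2 * n + 1) % 5 = 1 := by
    rw [Nat.pow_mod] at h5
    have hlt : (2 * n + 1) % 5 < 5 := Nat.mod_lt _ (by norm_num)
    generalize (2 * n + 1) % 5 = z at *
    rw [pow_succ, pow_mul, Nat.mul_mod, Nat.pow_mod] at h5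
    rcases Nat.even_or_odd' j with ⟨i, rfl | rfl⟩ <;>
    interval_cases z <;> simp [pow_succ, pow_mul, Nat.mul_mod, Nat.pow_mod] at h5 ⊢
  have : 5 ∣ n := by omega
  exact ((Nat.prime_dvd_prime_iff_eq Nat.prime_five hn).1 this).symm

/-- Lemma 2.11: if `n ≥ 5` is an odd prime, `q = 2^f`, and `q^{2n} - 1` has a
unique primitive prime divisor `r`, then either `r ≥ 4nf + 1`, or
`r = 2nf + 1` and `(n,q) = (5,2)` or `n ∣ q + 1`; moreover `f = 2^a · n^b`
for some `a, b ≥ 0`. -/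
theorem stmt12 (n f q r : ℕ) (hn : n.Prime) (hn5 : 5 ≤ n) (hodd : Odd n)
    (hf : 0 < f) (hq : q = 2 ^ f) (h : ppdSet q (2 * n) = {r}) :
    (4 * n * f + 1 ≤ r ∨
      (r = 2 * n * f + 1 ∧ ((n = 5 ∧ q = 2) ∨ n ∣ q + 1))) ∧
    (∃ a b : ℕ, f = 2 ^ a * n ^ b) := by
  subst hq
  have hprimes : ∀ p : ℕ, p.Prime → p ∣ f → p = 2 ∨ p = n := fun p hp hpf =>
    eq_two_or_eq_of_prime_dvd_exponent hn hn5 hodd hf h hp hpf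
  refine ⟨?_, exists_eq_pow_mul_pow_of_prime_dvd hf hprimes⟩
  have hmem : r ∈ ppdSet (2 ^ f) (2 * n) := by rw [h]; rfl
  rw [mem_ppdSet_iff_orderOf (by positivity) (by omega)] at hmem
  obtain ⟨hr, hord⟩ := hmem
  have := Fact.mk hr
  push_cast at hord
  have hord2 := orderOf_eq_mul_of_orderOf_pow hf hord fun p hp hpf => by
    rcases hprimes p hp hpf with rfl | rfl
    exacts [dvd_mul_right _ _, dvd_mul_left _ _]
  have hpos : 0 < 2 * n * f := by positivity
  have h20 : (2 : ZMod r) ≠ 0 := fun e => by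
    have : orderOf (2 : ZMod r) = 0 := by
      rw [orderOf_eq_zero_iff', e]
      intro m hm
      rw [zero_pow hm.ne']
      exact zero_ne_one
    omega
  obtain ⟨j, hj⟩ := hord2 ▸ ZMod.orderOf_dvd_card_sub_one h20
  have hr2 := hr.two_le
  rcases lt_or_ge j 2 with hj2 | hj2
  swap
  · left
    have := Nat.mul_le_mul_left (2 * n * f) hj2
    have e : 4 * n * f = 2 * n * f * 2 := by ring
    omega
  right
  obtain rfl : j = 1 := by
    interval_cases j
    · omega
    · rfl
  have hreq : r = 2 * n * f + 1 := by omega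
  refine ⟨hreq, or_iff_not_imp_right.2 fun hnq => ?_⟩
  obtain ⟨k, hk⟩ := exists_pow_add_one_eq_mul_prime_pow hn hodd (by positivity)
    (even_two.pow_of_ne_zero hf.ne') h hnq
  have hkodd : Odd k := by
    by_contra hke
    obtain ⟨y, rfl⟩ := Nat.not_odd_iff_even.1 hke
    refine two_pow_pow_add_one_ne_mul_sq hf hn.one_lt hodd (r ^ y) (hk.trans ?_)
    ring
  have hf2 := le_two_of_mul_odd_pow_eq hodd hf hn.ne_zero hreq hkodd hk
  interval_cases f
  · exact ⟨eq_five_of_two_pow_add_one_eq hn hn5 hodd hkodd (by simpa [hreq] using hk), rfl⟩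
  · exact absurd (by simpa using hk)
      (four_pow_add_one_ne_five_mul_prime_pow hn5 hodd hr (by omega) k)
end

section
/- Let n ≥ 7 be an integer and let q ≥ 2 be a prime power. Then either (n,q) ∈ {(10,2),(9,2),(8,3),(8,2),(7,3),(7,2)}, or there exist two distinct primes r, s, both greater than n + 2, which divide N := ∏_{i=1}^{m} (q^{2i} - 1), where m = ⌈(n-2)/2⌉. -/
open Polynomial in
/-- A prime dividing `Φ_{p^a e}(q)`, where `p ∤ e`, sees `q` with order exactly `e`. -/
theorem orderOf_eq_of_dvd_cyclotomic_eval {p a e q : ℕ} (hp : p.Prime) (he : ¬ p ∣ e)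
    (h : (p : ℤ) ∣ (cyclotomic (p ^ a * e) ℤ).eval (q : ℤ)) : orderOf (q : ZMod p) = e := by
  have := Fact.mk hp
  have : NeZero (e : ZMod p) := ⟨by rwa [Ne, ZMod.natCast_eq_zero_iff]⟩
  have hroot : (cyclotomic (p ^ a * e) (ZMod p)).IsRoot (q : ZMod p) := by
    rw [← ZMod.intCast_zmod_eq_zero_iff_dvd] at h
    rw [IsRoot.def, ← map_cyclotomic_int, eval_map, ← Int.cast_natCast q,
      ← eq_intCast (Int.castRingHom (ZMod p)), eval₂_at_apply]
    simpa using h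
  exact ((isRoot_cyclotomic_prime_pow_mul_iff_of_charP).1 hroot).eq_orderOf.symm

theorem orderOf_natCast_dvd_sub_one {p q : ℕ} (hp : p.Prime) (h : 0 < orderOf (q : ZMod p)) :
    orderOf (q : ZMod p) ∣ p - 1 := by
  have := Fact.mk hp
  refine ZMod.orderOf_dvd_card_sub_one fun h0 => ?_
  rw [h0, orderOf_zero] at h
  exact h.false

theorem dvd_pow_sub_one_iff_orderOf_dvd {p q k : ℕ} (hq : 1 ≤ q) :
    p ∣ q ^ k - 1 ↔ orderOf (q : ZMod p) ∣ k := by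
  rw [orderOf_dvd_iff_pow_eq_one, ← ZMod.natCast_eq_zero_iff,
    Nat.cast_sub (Nat.one_le_pow _ _ hq), sub_eq_zero]
  simp

open Polynomial in
/-- An odd prime dividing its index divides a cyclotomic value at most once. -/
theorem not_sq_dvd_cyclotomic_eval {p k q : ℕ} (hp : p.Prime) (hodd : Odd p) (hk : 0 < k)
    (hq : 2 ≤ q) (h : p ∣ q ^ k - 1) :
    ¬ (p : ℤ) ^ 2 ∣ (cyclotomic (p * k) ℤ).eval (q : ℤ) := by
  intro hsq
  have hkd : k ∈ (p * k).properDivisors := by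
    rw [Nat.mem_properDivisors]
    exact ⟨dvd_mul_left _ _, by nlinarith [hp.two_le]⟩
  have hdvd := eval_dvd (x := (q : ℤ)) (X_pow_sub_one_mul_cyclotomic_dvd_X_pow_sub_one_of_dvd ℤ hkd)
  simp only [eval_mul, eval_sub, eval_pow, eval_X, eval_one] at hdvd
  have hy : (1 : ℤ) < (q : ℤ) ^ k := one_lt_pow₀ (by exact_mod_cast hq) hk.ne'
  have hpy : (p : ℤ) ∣ (q : ℤ) ^ k - 1 := by
    have := Int.natCast_dvd_natCast.2 h
    rwa [Nat.cast_sub (Nat.one_le_pow _ _ (by omega)), Nat.cast_pow, Nat.cast_one] at this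
  have hne : (q : ℤ) ^ k - 1 ≠ 0 := by omega
  have hgeom : (q : ℤ) ^ (p * k) - 1 =
      ((q : ℤ) ^ k - 1) * ∑ i ∈ Finset.range p, ((q : ℤ) ^ k) ^ i := by
    rw [mul_comm p k, pow_mul, ← geom_sum_mul, mul_comm]
  rw [hgeom] at hdvd
  have h2 := hsq.trans ((mul_dvd_mul_iff_left hne).1 hdvd)
  have hnot : ¬ (p : ℤ) ∣ (q : ℤ) ^ k := fun h' => by
    have := (dvd_sub h' hpy)
    rw [sub_sub_cancel] at this
    exact (Nat.prime_iff_prime_int.1 hp).not_dvd_one this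
  have := emultiplicity_geom_sum₂_eq_one (Nat.prime_iff_prime_int.1 hp) hodd hpy hnot
  simp only [one_pow, mul_one] at this
  have h3 := le_emultiplicity_of_pow_dvd h2
  rw [this] at h3
  norm_num at h3

theorem mul_succ_lt_pow_sub_one {p q : ℕ} (hp : 3 ≤ p) (hq : 2 ≤ q) (h : ¬ (p = 3 ∧ q = 2))
    (hp4 : p ≠ 4) : p * (q + 1) < q ^ p - 1 := by
  obtain hq3 | rfl := hq.lt_or_eq
  · clear h hp4
    suffices p * (q + 1) + 1 < q ^ p by omega
    induction p, hp using Nat.le_induction with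
    | base =>
      have h1 : 9 ≤ q ^ 2 := Nat.pow_le_pow_left hq3 2
      rw [pow_succ]
      nlinarith
    | succ n hn ih =>
      have h1 : q ^ n * 3 ≤ q ^ n * q := Nat.mul_le_mul_left _ hq3
      rw [pow_succ]
      nlinarith
  · have hp5 : 5 ≤ p := by omega
    clear h hp hp4
    suffices p * 3 + 1 < 2 ^ p by omega
    induction p, hp5 using Nat.le_induction with
    | base => norm_num
    | succ n hn ih => rw [pow_succ]; omega

open Polynomial in
/-- The value of a cyclotomic polynomial exceeds any odd prime factor of its index whose
cofactor carries the order of `q`. -/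
theorem lt_cyclotomic_eval {p k q : ℕ} (hp : p.Prime) (hodd : p ≠ 2) (hk : 0 < k)
    (hq : 2 ≤ q) (h : ¬ (p = 3 ∧ q = 2 ∧ ¬ p ∣ k)) :
    (p : ℤ) < (cyclotomic (k * p) ℤ).eval (q : ℤ) := by
  have hp3 : 3 ≤ p := by have := hp.two_le; omega
  have hq1 : (1 : ℝ) < q := by exact_mod_cast hq
  have hqp : (1 : ℝ) < (q : ℝ) ^ p := one_lt_pow₀ hq1 hp.ne_zero
  have htot : k.totient ≠ 0 := (Nat.totient_pos.2 hk).ne'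
  have hlow := sub_one_pow_totient_le_cyclotomic_eval hqp k
  suffices (p : ℝ) < (cyclotomic (k * p) ℝ).eval (q : ℝ) by
    rw [← map_cyclotomic_int, ← Int.cast_natCast q, ← eq_intCast (Int.castRingHom ℝ),
      eval_map, eval₂_at_apply] at this
    simp only [eq_intCast] at this
    exact_mod_cast this
  by_cases hpk : p ∣ k
  · rw [← cyclotomic_expand_eq_cyclotomic hp hpk, expand_eval]
    have h1 : (p : ℝ) + 1 < (q : ℝ) ^ p := by
      have : p + 1 < q ^ p := by
        refine lt_of_lt_of_le ?_ (Nat.pow_le_pow_left hq p)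
        clear * - hp3
        induction p, hp3 using Nat.le_induction with
        | base => norm_num
        | succ n hn ih => rw [pow_succ]; omega
      exact_mod_cast this
    refine lt_of_lt_of_le ?_ hlow
    calc (p : ℝ) < (q : ℝ) ^ p - 1 := by linarith
      _ ≤ _ := le_self_pow₀ (by linarith [(Nat.cast_le (α := ℝ)).2 hp.one_le, Nat.cast_one (R := ℝ)]) htot
  · have h1 : (p : ℝ) * (q + 1) < (q : ℝ) ^ p - 1 := by
      have := mul_succ_lt_pow_sub_one hp3 hq (fun h' => h ⟨h'.1, h'.2, hpk⟩)
        (by rintro rfl; norm_num at hp)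
      have h2 : p * (q + 1) + 1 < q ^ p := by omega
      have h3 : (p : ℝ) * (q + 1) + 1 < (q : ℝ) ^ p := by exact_mod_cast h2
      linarith
    have hmul := congrArg (eval (q : ℝ)) (cyclotomic_expand_eq_cyclotomic_mul hp hpk ℝ)
    rw [expand_eval, eval_mul] at hmul
    rw [hmul] at hlow
    have hup := cyclotomic_eval_le_add_one_pow_totient hq1 k
    have hpos := cyclotomic_pos' k hq1
    by_contra! hle
    have h4 : ((p : ℝ) * (q + 1)) ^ k.totient < ((q : ℝ) ^ p - 1) ^ k.totient :=
      pow_lt_pow_left₀ h1 (by positivity) htot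
    have h5 : (p : ℝ) * (q + 1) ^ k.totient ≤ ((p : ℝ) * (q + 1)) ^ k.totient := by
      rw [mul_pow]
      gcongr
      exact le_self_pow₀ (by exact_mod_cast hp.one_le) htot
    have h6 : (cyclotomic (k * p) ℝ).eval (q : ℝ) * (cyclotomic k ℝ).eval (q : ℝ) ≤
        p * (q + 1) ^ k.totient := by
      gcongr
    linarith

open Polynomial in
/-- **Zsigmondy's theorem** for `q ^ d - 1` with `3 ≤ d`. -/
theorem exists_prime_orderOf_eq {q d : ℕ} (hq : 2 ≤ q) (hd : 3 ≤ d) (h : ¬ (d = 6 ∧ q = 2)) :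
    ∃ p : ℕ, p.Prime ∧ orderOf (q : ZMod p) = d := by
  by_contra! hno
  set N := ((cyclotomic d ℤ).eval (q : ℤ)).natAbs with hN
  have hN1 : 1 < N := by
    have := sub_one_pow_totient_lt_natAbs_cyclotomic_eval (n := d) (q := q) (by omega) (by omega)
    exact lt_of_le_of_lt (Nat.one_le_pow _ _ (by omega)) this
  have hNeval : ((N : ℕ) : ℤ) = (cyclotomic d ℤ).eval (q : ℤ) :=
    Int.natAbs_of_nonneg (cyclotomic_pos (by omega) _).le
  -- every prime factor `p` of `N` divides `d`, and the `p`-free part of `d` is the order of `q`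
  have key : ∀ p : ℕ, p.Prime → p ∣ N → ∃ a e : ℕ, a ≠ 0 ∧ ¬ p ∣ e ∧ d = p ^ a * e ∧
      orderOf (q : ZMod p) = e := by
    intro p hp hpN
    obtain ⟨a, e, he, hde⟩ := Nat.exists_eq_pow_mul_and_not_dvd (n := d) (by omega) p hp.ne_one
    have ho : orderOf (q : ZMod p) = e := by
      refine orderOf_eq_of_dvd_cyclotomic_eval (a := a) hp he ?_
      rw [← hde, ← hNeval]
      exact_mod_cast hpN
    refine ⟨a, e, ?_, he, hde, ho⟩
    rintro rfl
    exact hno p hp (by rw [ho, hde, pow_zero, one_mul])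
  have hle : ∀ p r : ℕ, p.Prime → p ∣ N → r.Prime → r ∣ N → r ≤ p := by
    intro p r hp hpN hr hrN
    obtain ⟨a, e, ha, he, hde, ho⟩ := key p hp hpN
    obtain ⟨b, f, hb, -, hdf, -⟩ := key r hr hrN
    have hrd : r ∣ p ^ a * e := hde ▸ hdf ▸ (dvd_pow_self r hb).mul_right f
    have he0 : 0 < e := Nat.pos_of_ne_zero fun h0 => he (h0 ▸ dvd_zero p)
    obtain h1 | h1 := hr.dvd_mul.1 hrd
    · exact Nat.le_of_dvd hp.pos (hr.dvd_of_dvd_pow h1)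
    · have h2 := h1.trans (ho ▸ orderOf_natCast_dvd_sub_one hp (ho ▸ he0))
      have := Nat.le_of_dvd (by have := hp.two_le; omega) h2
      omega
  obtain ⟨p, hp, hpN⟩ := Nat.exists_prime_and_dvd hN1.ne'
  have hpow := Nat.eq_prime_pow_of_unique_prime_dvd (n := N) (p := p) (by omega)
    fun {r} hr hrN => le_antisymm (hle p r hp hpN hr hrN) (hle r p hr hrN hp hpN)
  obtain ⟨a, e, ha, he, hde, ho⟩ := key p hp hpN
  obtain ⟨a, rfl⟩ := Nat.exists_eq_succ_of_ne_zero ha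
  have he0 : 0 < e := Nat.pos_of_ne_zero fun h0 => he (h0 ▸ dvd_zero p)
  have hep := ho ▸ orderOf_natCast_dvd_sub_one hp (ho ▸ he0)
  have hdk : d = p * (p ^ a * e) := by rw [hde, pow_succ']; ring
  have hk0 : 0 < p ^ a * e := Nat.mul_pos (pow_pos hp.pos _) he0
  have hNp : ¬ p ^ 2 ∣ N → N = p := by
    intro hsq
    rw [hpow] at hsq hN1 ⊢
    have : ¬ 2 ≤ N.primeFactorsList.length := fun h2 => hsq (pow_dvd_pow _ h2)
    have h0 : N.primeFactorsList.length ≠ 0 := fun h0 => by rw [h0] at hN1; simp at hN1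
    rw [show N.primeFactorsList.length = 1 by omega, pow_one]
  by_cases hp2 : p = 2
  · subst hp2
    have he1 : e = 1 := by simpa using hep
    subst he1
    have ha1 : a ≠ 0 := by rintro rfl; omega
    obtain ⟨a, rfl⟩ := Nat.exists_eq_succ_of_ne_zero ha1
    have hNv : N = 1 + (q ^ 2 ^ a) ^ 2 := by
      have : ((N : ℕ) : ℤ) = ((1 + (q ^ 2 ^ a) ^ 2 : ℕ) : ℤ) := by
        rw [hNeval, hde, mul_one, cyclotomic_prime_pow_eq_geom_sum hp]
        simp [Finset.sum_range_succ, pow_succ, mul_two, pow_add]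
      exact_mod_cast this
    have hbig : 1 < q ^ 2 ^ a := one_lt_pow₀ (by omega) (by positivity)
    generalize q ^ 2 ^ a = y at hNv hbig
    have hN2 := hNp (by
      rw [hNv]
      intro h4
      obtain ⟨z, rfl | rfl⟩ := Nat.even_or_odd' y <;> ring_nf at h4 <;> omega)
    nlinarith
  · have hodd := hp.odd_of_ne_two hp2
    have hN' := hNp (fun hsq => not_sq_dvd_cyclotomic_eval hp hodd hk0 hq
      ((dvd_pow_sub_one_iff_orderOf_dvd (by omega)).2 (ho ▸ dvd_mul_left _ _))
      (by rw [← hdk, ← hNeval]; exact_mod_cast hsq))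
    by_cases hex : p = 3 ∧ q = 2 ∧ ¬ p ∣ p ^ a * e
    · obtain ⟨rfl, rfl, hnd⟩ := hex
      have ha0 : a = 0 := by
        by_contra ha0
        exact hnd ((dvd_pow_self 3 ha0).mul_right e)
      subst ha0
      have : e ≤ 2 := Nat.le_of_dvd (by norm_num) hep
      interval_cases e
      · rw [hdk] at hNeval
        simp [cyclotomic_three, hN'] at hNeval
      · exact h ⟨by omega, rfl⟩
    · have := lt_cyclotomic_eval hp hp2 hk0 hq hex
      rw [mul_comm, ← hdk, ← hNeval, hN'] at this
      exact lt_irrefl _ this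

theorem dvd_prod_of_orderOf_dvd {p q m i : ℕ} (hq : 2 ≤ q) (hi : 1 ≤ i) (him : i ≤ m)
    (h : orderOf (q : ZMod p) ∣ 2 * i) : p ∣ ∏ j ∈ Finset.Icc 1 m, (q ^ (2 * j) - 1) :=
  ((dvd_pow_sub_one_iff_orderOf_dvd (by omega)).2 h).trans
    (Finset.dvd_prod_of_mem _ (Finset.mem_Icc.2 ⟨hi, him⟩))

/-- At most one of the orders `k` and `2 * k` is realised by the prime `ℓ`. -/
theorem exists_prime_orderOf_eq_or_two_mul {q k : ℕ} (ℓ : ℕ) (hq : 2 ≤ q) (hk : 3 ≤ k)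
    (hkq : ¬ (k = 3 ∧ q = 2)) (hk6 : k ≠ 6) :
    ∃ p : ℕ, p.Prime ∧ p ≠ ℓ ∧ (orderOf (q : ZMod p) = k ∨ orderOf (q : ZMod p) = 2 * k) := by
  obtain ⟨p, hp, ho⟩ := exists_prime_orderOf_eq hq hk (by omega)
  obtain ⟨p', hp', ho'⟩ := exists_prime_orderOf_eq (d := 2 * k) hq (by omega) (by omega)
  by_cases hpl : p = ℓ
  · refine ⟨p', hp', ?_, Or.inr ho'⟩
    rintro rfl
    rw [hpl] at ho
    omega
  · exact ⟨p, hp, hpl, Or.inl ho⟩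

theorem exists_two_primes_of_orders {m b q k d i ℓ : ℕ} (hq : 2 ≤ q) (hk : 3 ≤ k)
    (hkq : ¬ (k = 3 ∧ q = 2)) (hk6 : k ≠ 6) (hd : 3 ≤ d) (hd6 : d ≠ 6) (hdk : d ≠ k)
    (hdk2 : d ≠ 2 * k) (hkm : k ≤ m) (hi : 1 ≤ i) (him : i ≤ m) (hdi : d ∣ 2 * i)
    (hbd : ∀ p ≤ b, p.Prime → ¬ d ∣ p - 1)
    (hbk : ∀ p ≤ b, p.Prime → k ∣ p - 1 → p = ℓ) :
    ∃ r s : ℕ, r.Prime ∧ s.Prime ∧ r ≠ s ∧ b < r ∧ b < s ∧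
      r ∣ ∏ i ∈ Finset.Icc 1 m, (q ^ (2 * i) - 1) ∧
      s ∣ ∏ i ∈ Finset.Icc 1 m, (q ^ (2 * i) - 1) := by
  obtain ⟨r, hr, hro⟩ := exists_prime_orderOf_eq hq hd (fun h => hd6 h.1)
  obtain ⟨s, hs, hsl, hso⟩ := exists_prime_orderOf_eq_or_two_mul ℓ hq hk hkq hk6
  have hks : k ∣ orderOf (q : ZMod s) ∧ orderOf (q : ZMod s) ∣ 2 * k := by
    obtain h | h := hso <;> simp [h]
  refine ⟨r, s, hr, hs, ?_, ?_, ?_, dvd_prod_of_orderOf_dvd hq hi him (hro ▸ hdi),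
    dvd_prod_of_orderOf_dvd hq (by omega) hkm hks.2⟩
  · rintro rfl
    omega
  · by_contra! hrb
    exact hbd r hrb hr (hro ▸ orderOf_natCast_dvd_sub_one hr (by omega))
  · by_contra! hsb
    exact hsl (hbk s hsb hs (hks.1.trans (orderOf_natCast_dvd_sub_one hs (by omega))))

/-- If `d ≡ 2 mod 6` and `3 < d + 1`, then `d + 1` is not prime, so a prime `≡ 1 mod d` exceeds
`2 * d`. -/
theorem two_mul_lt_of_dvd_sub_one {p d : ℕ} (hp : p.Prime) (hd : 2 < d) (hd6 : d % 6 = 2)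
    (h : d ∣ p - 1) : 2 * d < p := by
  obtain ⟨c, hc⟩ := h
  have := hp.two_le
  match c with
  | 0 => omega
  | 1 => have := (Nat.prime_dvd_prime_iff_eq Nat.prime_three hp).1 (by omega); omega
  | c + 2 =>
    rw [mul_add] at hc
    omega

theorem exists_two_primes_of_ten_le {m q : ℕ} (hq : 2 ≤ q) (hm : 10 ≤ m) :
    ∃ r s : ℕ, r.Prime ∧ s.Prime ∧ r ≠ s ∧ 2 * m + 4 < r ∧ 2 * m + 4 < s ∧
      r ∣ ∏ i ∈ Finset.Icc 1 m, (q ^ (2 * i) - 1) ∧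
      s ∣ ∏ i ∈ Finset.Icc 1 m, (q ^ (2 * i) - 1) := by
  have key : ∀ d, d % 6 = 2 → m + 2 ≤ d → d ≤ 2 * m → ∃ p : ℕ, p.Prime ∧
      orderOf (q : ZMod p) = d ∧ 2 * m + 4 < p ∧
      p ∣ ∏ i ∈ Finset.Icc 1 m, (q ^ (2 * i) - 1) := by
    intro d hd6 hmd hdm
    obtain ⟨p, hp, ho⟩ := exists_prime_orderOf_eq (d := d) hq (by omega) (by omega)
    have hlt := two_mul_lt_of_dvd_sub_one hp (by omega) hd6
      (ho ▸ orderOf_natCast_dvd_sub_one hp (by omega))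
    refine ⟨p, hp, ho, by omega, dvd_prod_of_orderOf_dvd (i := d / 2) hq (by omega) (by omega) ?_⟩
    rw [ho, Nat.mul_div_cancel' (by omega)]
  obtain ⟨d, hd6, hmd, hdm⟩ : ∃ d, d % 6 = 2 ∧ m + 8 ≤ d ∧ d ≤ 2 * m :=
    ⟨2 * m - (2 * m - 2) % 6, by omega, by omega, by omega⟩
  obtain ⟨r, hr, hro, hrm, hrN⟩ := key d hd6 (by omega) hdm
  obtain ⟨s, hs, hso, hsm, hsN⟩ := key (d - 6) (by omega) (by omega) (by omega)
  refine ⟨r, s, hr, hs, ?_, hrm, hsm, hrN, hsN⟩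
  rintro rfl
  omega

theorem three_le_of_eq_two_mul_five_pow_add_one {q c : ℕ} (hq : 4 ≤ q) (hq7 : q ≠ 7)
    (h : q ^ 2 + 1 = 2 * 5 ^ c) : 3 ≤ c := by
  by_contra! hc
  have : q < 8 := by
    by_contra! h8
    interval_cases c <;> nlinarith
  interval_cases q <;> interval_cases c <;> omega

/-- The case of the orders `1, 2, 3, 4, 6`. -/
theorem exists_two_primes_of_three {q : ℕ} (hq : 4 ≤ q) :
    ∃ r s : ℕ, r.Prime ∧ s.Prime ∧ r ≠ s ∧ 10 < r ∧ 10 < s ∧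
      r ∣ ∏ i ∈ Finset.Icc 1 3, (q ^ (2 * i) - 1) ∧
      s ∣ ∏ i ∈ Finset.Icc 1 3, (q ^ (2 * i) - 1) := by
  have hq2 : 2 ≤ q := by omega
  obtain rfl | hq7 := eq_or_ne q 7
  · exact ⟨19, 43, by norm_num, by norm_num, by norm_num, by norm_num, by norm_num,
      by decide +kernel, by decide +kernel⟩
  obtain ⟨r, hr, hr7, hro⟩ := exists_prime_orderOf_eq_or_two_mul 7 hq2 (le_refl 3) (by omega)
    (by omega)
  have hr3 : 3 ∣ orderOf (q : ZMod r) ∧ orderOf (q : ZMod r) ∣ 6 := by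
    obtain h | h := hro <;> rw [h] <;> norm_num
  have hmod := hr3.1.trans (orderOf_natCast_dvd_sub_one hr (by omega))
  have hr10 : 10 < r := by
    by_contra! hle
    interval_cases r <;> first | omega | norm_num at hr
  by_contra! hno
  have hsmall : ∀ s : ℕ, s.Prime → orderOf (q : ZMod s) ∣ 4 ∨
      (orderOf (q : ZMod s) ∣ 6 ∧ orderOf (q : ZMod s) ≠ orderOf (q : ZMod r)) →
      s = 2 ∨ s = 3 ∨ s = 5 ∨ s = 7 := by
    intro s hs hso
    have hrs : r ≠ s := by
      rintro rfl
      obtain h | h := hso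
      · have := hr3.1.trans h
        omega
      · exact h.2 rfl
    have hs10 : s ≤ 10 := by
      by_contra! hs10
      refine hno r s hr hs hrs hr10 hs10
        (dvd_prod_of_orderOf_dvd (i := 3) hq2 (by omega) le_rfl hr3.2) ?_
      obtain h | h := hso
      · exact dvd_prod_of_orderOf_dvd (i := 2) hq2 (by omega) (by omega) h
      · exact dvd_prod_of_orderOf_dvd (i := 3) hq2 (by omega) le_rfl h.1
    interval_cases s <;> first | omega | norm_num at hs
  have hord2 : ∀ s : ℕ, s ∣ q ^ 2 - 1 ↔ orderOf (q : ZMod s) ∣ 2 := fun s =>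
    dvd_pow_sub_one_iff_orderOf_dvd (by omega)
  have hq16 : 16 ≤ q ^ 2 := Nat.pow_le_pow_left hq 2
  -- the prime `7` carries the order among `3, 6` that `r` does not
  have h7 : ¬ 7 ∣ q ^ 2 - 1 := by
    obtain ⟨t, ht, hto⟩ := exists_prime_orderOf_eq (d := 9 - orderOf (q : ZMod r)) hq2 (by omega)
      (by omega)
    have ht3 : 3 ∣ orderOf (q : ZMod t) ∧ orderOf (q : ZMod t) ∣ 6 := by
      rw [hto]
      obtain h | h := hro <;> rw [h] <;> norm_num
    have htm := ht3.1.trans (orderOf_natCast_dvd_sub_one ht (by omega))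
    have ht7 : t = 7 := by
      obtain rfl | rfl | rfl | rfl := hsmall t ht (Or.inr ⟨ht3.2, by omega⟩) <;> omega
    subst ht7
    rw [hord2]
    intro h
    have := ht3.1.trans h
    omega
  have hdvd4 : ∀ s, s ∣ q ^ 2 + 1 → orderOf (q : ZMod s) ∣ 4 := fun s hs => by
    rw [← dvd_pow_sub_one_iff_orderOf_dvd (by omega)]
    refine hs.trans ⟨q ^ 2 - 1, ?_⟩
    rw [← Nat.sq_sub_sq, ← pow_mul, one_pow]
  have hsq3 : ¬ 3 ∣ q ^ 2 + 1 := by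
    rw [Nat.dvd_iff_mod_eq_zero, Nat.add_mod, Nat.pow_mod]
    have := Nat.mod_lt q (show 3 > 0 by norm_num)
    interval_cases q % 3 <;> norm_num
  have hsq7 : ¬ 7 ∣ q ^ 2 + 1 := by
    rw [Nat.dvd_iff_mod_eq_zero, Nat.add_mod, Nat.pow_mod]
    have := Nat.mod_lt q (show 7 > 0 by norm_num)
    interval_cases q % 7 <;> norm_num
  have hsq4 : ¬ 4 ∣ q ^ 2 + 1 := by
    rw [Nat.dvd_iff_mod_eq_zero, Nat.add_mod, Nat.pow_mod]
    have := Nat.mod_lt q (show 4 > 0 by norm_num)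
    interval_cases q % 4 <;> norm_num
  have h25 : ∀ s : ℕ, s.Prime → s ∣ q ^ 2 + 1 → s = 2 ∨ s = 5 := by
    intro s hs hsd
    obtain rfl | rfl | rfl | rfl := hsmall s hs (Or.inl (hdvd4 s hsd)) <;> tauto
  have h5 : ¬ 5 ∣ q ^ 2 - 1 := by
    suffices 5 ∣ q ^ 2 + 1 by omega
    by_contra h5
    have := Nat.eq_prime_pow_of_unique_prime_dvd (n := q ^ 2 + 1) (p := 2) (by omega)
      fun {s} hs hsd => (h25 s hs hsd).resolve_right (by rintro rfl; exact h5 hsd)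
    rw [this] at hsq4
    have : ¬ 2 ≤ (q ^ 2 + 1).primeFactorsList.length := fun h => hsq4 (pow_dvd_pow 2 h)
    interval_cases (q ^ 2 + 1).primeFactorsList.length <;> omega
  have h23 : ∀ s : ℕ, s.Prime → s ∣ q ^ 2 - 1 → s = 2 ∨ s = 3 := by
    intro s hs hsd
    obtain rfl | rfl | rfl | rfl :=
      hsmall s hs (Or.inl (((hord2 s).1 hsd).trans (by norm_num))) <;> tauto
  obtain hev | hodd := Nat.even_or_odd q
  · replace hev := hev.two_dvd
    have hfac : q ^ 2 - 1 = (q + 1) * (q - 1) := by rw [← Nat.sq_sub_sq, one_pow]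
    have hsub : ∀ x, x ≠ 1 → ¬ 2 ∣ x → x ∣ q ^ 2 - 1 → 3 ∣ x := by
      intro x hx h2 hxd
      obtain h | h := h23 _ (Nat.minFac_prime hx) ((Nat.minFac_dvd x).trans hxd)
      · exact absurd (h ▸ Nat.minFac_dvd x) h2
      · exact h ▸ Nat.minFac_dvd x
    have h1 := hsub (q + 1) (by omega) (by omega) (hfac ▸ dvd_mul_right _ _)
    have h2 := hsub (q - 1) (by omega) (by omega) (hfac ▸ dvd_mul_left _ _)
    omega
  · obtain ⟨x, hx⟩ : 2 ∣ q ^ 2 + 1 := by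
      exact (hodd.pow.add_odd odd_one).two_dvd
    have hx5 := Nat.eq_prime_pow_of_unique_prime_dvd (n := x) (p := 5) (by omega)
      fun {s} hs hsd => (h25 s hs (hx ▸ hsd.mul_left 2)).resolve_left (by rintro rfl; omega)
    rw [hx5] at hx
    have hc := three_le_of_eq_two_mul_five_pow_add_one hq hq7 hx
    obtain ⟨p, hp, hpo⟩ := exists_prime_orderOf_eq (q := 5) (by norm_num) hc (by norm_num)
    have hpd : p ∣ 5 ^ x.primeFactorsList.length - 1 :=
      (dvd_pow_sub_one_iff_orderOf_dvd (by norm_num)).2 (dvd_of_eq hpo)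
    have hpm := Nat.le_of_dvd (by have := hp.two_le; omega)
      (hpo ▸ orderOf_natCast_dvd_sub_one hp (by omega))
    obtain h | h := h23 p hp (hpd.trans ⟨2, by omega⟩)
    · omega
    · omega

/-- Lemma 4.1: for `n ≥ 7` and `q` a prime power, either `(n,q)` is one of six
exceptions, or `∏_{i=1}^{m} (q^{2i} - 1)` with `m = ⌈(n-2)/2⌉` has two
distinct prime divisors greater than `n + 2`. -/
theorem stmt13 (n q : ℕ) (hn : 7 ≤ n) (hq : ∃ p f : ℕ, p.Prime ∧ 0 < f ∧ q = p ^ f) :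
    ((n, q) = (10, 2) ∨ (n, q) = (9, 2) ∨ (n, q) = (8, 3) ∨ (n, q) = (8, 2) ∨
      (n, q) = (7, 3) ∨ (n, q) = (7, 2)) ∨
    ∃ r s : ℕ, r.Prime ∧ s.Prime ∧ r ≠ s ∧ n + 2 < r ∧ n + 2 < s ∧
      r ∣ ∏ i ∈ Finset.Icc 1 ((n - 2 + 1) / 2), (q ^ (2 * i) - 1) ∧
      s ∣ ∏ i ∈ Finset.Icc 1 ((n - 2 + 1) / 2), (q ^ (2 * i) - 1) := by
  have hq2 : 2 ≤ q := by
    obtain ⟨p, f, hp, hf, rfl⟩ := hq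
    exact hp.two_le.trans (Nat.le_self_pow hf.ne' p)
  rw [or_iff_not_imp_left]
  intro hex
  simp only [Prod.mk.injEq, not_or] at hex
  obtain ⟨m, hm⟩ : ∃ m, m = (n - 2 + 1) / 2 := ⟨_, rfl⟩
  rw [← hm]
  suffices ∃ r s : ℕ, r.Prime ∧ s.Prime ∧ r ≠ s ∧ 2 * m + 4 < r ∧ 2 * m + 4 < s ∧
      r ∣ ∏ i ∈ Finset.Icc 1 m, (q ^ (2 * i) - 1) ∧
      s ∣ ∏ i ∈ Finset.Icc 1 m, (q ^ (2 * i) - 1) by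
    obtain ⟨r, s, hr, hs, hrs, hrm, hsm, hrN, hsN⟩ := this
    exact ⟨r, s, hr, hs, hrs, by omega, by omega, hrN, hsN⟩
  obtain h10 | h10 := le_or_gt 10 m
  · exact exists_two_primes_of_ten_le hq2 h10
  have hm3 : 3 ≤ m := by omega
  obtain rfl | rfl | ⟨h5, h6⟩ | h7 : m = 3 ∨ m = 4 ∨ (5 ≤ m ∧ m ≤ 6) ∨ 7 ≤ m := by omega
  · exact exists_two_primes_of_three (by omega)
  · refine exists_two_primes_of_orders (k := 3) (d := 8) (i := 4) (ℓ := 7) hq2 le_rfl (by omega)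
      (by omega) (by omega) (by omega) (by omega) (by omega) (by omega) (by omega) (by omega)
      (by omega) ?_ ?_
    all_goals
      intro p hpb hp hd
      have := hp.two_le
      interval_cases p <;> first | omega | norm_num at hp
  · refine exists_two_primes_of_orders (k := 5) (d := 8) (i := 4) (ℓ := 11) hq2 (by omega)
      (by omega) (by omega) (by omega) (by omega) (by omega) (by omega) (by omega) (by omega)
      (by omega) (by omega) ?_ ?_
    all_goals
      intro p hpb hp hd
      have := hp.two_le
      replace hpb : p ≤ 16 := by omega
      interval_cases p <;> first | omega | norm_num at hp
  · refine exists_two_primes_of_orders (k := 5) (d := 14) (i := 7) (ℓ := 11) hq2 (by omega)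
      (by omega) (by omega) (by omega) (by omega) (by omega) (by omega) (by omega) (by omega)
      (by omega) (by omega) ?_ ?_
    all_goals
      intro p hpb hp hd
      have := hp.two_le
      replace hpb : p ≤ 22 := by omega
      interval_cases p <;> first | omega | norm_num at hp
end
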